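/- There exists a recursive infinite sequence V₁, V₂, V₃, … of optimal computers satisfying: (i) 𝒵(V_i) ∩ 𝒵(V_j) = ℱ(V_i) ∩ ℱ(V_j) = ℰ(V_i) ∩ ℰ(V_j) = 𝒮(V_i) ∩ 𝒮(V_j) = ∅ for all i ≠ j; (ii) ⋃_i 𝒵(V_i) ⊆ FP_w and ⋃_i ℱ(V_i) ⊆ FP_w; (iii) ⋃_i ℰ(V_i) ⊆ FP and ⋃_i 𝒮(V_i) ⊆ FP. -/

import Mathlib

open Filter Topology

/-- A set of finite binary strings is prefix-free if no string in it is a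
proper prefix of another string in it. -/
def PrefixFree (S : Set (List Bool)) : Prop :=
  ∀ p ∈ S, ∀ q ∈ S, p <+: q → p = q

/-- A computer: a partial recursive function from finite binary strings to
finite binary strings whose domain is a nonempty prefix-free set. -/
structure Computer where
  f : List Bool →. List Bool
  partrec : Partrec f
  dom_nonempty : f.Dom.Nonempty
  dom_prefixFree : PrefixFree f.Dom

/-- A computer `U` is optimal if for each computer `C` there is `d ∈ ℕ` such
that every `p ∈ Dom C` admits `q` with `U(q) = C(p)` and `|q| ≤ |p| + d`. -/
def Optimal (U : Computer) : Prop :=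
  ∀ C : Computer, ∃ d : ℕ, ∀ p ∈ C.f.Dom,
    ∃ q : List Bool, U.f q = C.f p ∧ q.length ≤ p.length + d

/-- `H_C(s)`: the length of a shortest program for `C` printing `s`. -/
noncomputable def complexity (C : Computer) (s : List Bool) : ℕ :=
  sInf {n | ∃ p : List Bool, s ∈ C.f p ∧ p.length = n}

/-- The `i`-th bit (for `i = 0, 1, 2, …`) of the base-two expansion of
`α - ⌊α⌋` with infinitely many zeros. -/
noncomputable def bitOf (α : ℝ) (i : ℕ) : Bool :=
  decide (⌊(α - ⌊α⌋) * 2 ^ (i + 1)⌋ % 2 = 1)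

/-- `α↾n`: the first `n` bits of the base-two expansion of `α - ⌊α⌋`
with infinitely many zeros. -/
noncomputable def firstBits (α : ℝ) (n : ℕ) : List Bool :=
  (List.range n).map (bitOf α)

/-- A real `α` is computable if some total recursive `f : ℕ⁺ → ℚ` satisfies
`|α - f n| < 1/n` for all `n ≥ 1`. -/
def ComputableReal (α : ℝ) : Prop :=
  ∃ f : ℕ → ℚ, Computable f ∧ ∀ n : ℕ, 0 < n → |α - (f n : ℝ)| < 1 / n

/-- `α` is weakly Chaitin `T`-random (w.r.t. the computer `U`). -/
def WeaklyChaitinTRandom (U : Computer) (T α : ℝ) : Prop :=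
  ∃ c : ℕ, ∀ n : ℕ, 0 < n → T * n - c ≤ (complexity U (firstBits α n) : ℝ)

/-- `α` is Chaitin `T`-random (w.r.t. the computer `U`). -/
def ChaitinTRandom (U : Computer) (T α : ℝ) : Prop :=
  Tendsto (fun n : ℕ => (complexity U (firstBits α n) : ℝ) - T * n) atTop atTop

/-- `α` is `T`-compressible (w.r.t. the computer `U`): `H(α↾n) ≤ Tn + o(n)`. -/
def TCompressible (U : Computer) (T α : ℝ) : Prop :=
  ∃ g : ℕ → ℝ, Tendsto (fun n : ℕ => g n / n) atTop (nhds 0) ∧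
    ∀ n : ℕ, 0 < n → (complexity U (firstBits α n) : ℝ) ≤ T * n + g n

/-- The Boltzmann factor `2^(-|p|/T)` of a program `p`. -/
noncomputable def boltzmann (T : ℝ) (p : List Bool) : ℝ :=
  (2 : ℝ) ^ (-(p.length : ℝ) / T)

/-- Partition function `Z_C(T) = Σ_{p ∈ Dom C} 2^(-|p|/T)`. -/
noncomputable def Zfun (C : Computer) (T : ℝ) : ℝ :=
  ∑' p : C.f.Dom, boltzmann T p.1

/-- Free energy `F_C(T) = -T log₂ Z_C(T)`. -/
noncomputable def Ffun (C : Computer) (T : ℝ) : ℝ :=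
  -T * Real.logb 2 (Zfun C T)

/-- Energy `E_C(T) = Z_C(T)⁻¹ Σ_{p ∈ Dom C} |p| 2^(-|p|/T)`. -/
noncomputable def Efun (C : Computer) (T : ℝ) : ℝ :=
  (Zfun C T)⁻¹ * ∑' p : C.f.Dom, (p.1.length : ℝ) * boltzmann T p.1

/-- Statistical mechanical entropy `S_C(T) = (E_C(T) - F_C(T))/T`. -/
noncomputable def Sfun (C : Computer) (T : ℝ) : ℝ :=
  (Efun C T - Ffun C T) / T

/-- `𝒵(V)`: the set of `T ∈ (0,1)` with `Z_V(T)` computable. -/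
def setZ (V : Computer) : Set ℝ := {T | T ∈ Set.Ioo 0 1 ∧ ComputableReal (Zfun V T)}

/-- `ℱ(V)`: the set of `T ∈ (0,1)` with `F_V(T)` computable. -/
def setF (V : Computer) : Set ℝ := {T | T ∈ Set.Ioo 0 1 ∧ ComputableReal (Ffun V T)}

/-- `ℰ(V)`: the set of `T ∈ (0,1)` with `E_V(T)` computable. -/
def setE (V : Computer) : Set ℝ := {T | T ∈ Set.Ioo 0 1 ∧ ComputableReal (Efun V T)}

/-- `𝒮(V)`: the set of `T ∈ (0,1)` with `S_V(T)` computable. -/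
def setS (V : Computer) : Set ℝ := {T | T ∈ Set.Ioo 0 1 ∧ ComputableReal (Sfun V T)}

/-- `FP_w` (w.r.t. the optimal computer `U` fixing `H`): the set of `T ∈ (0,1)`
that are weakly Chaitin `T`-random and `T`-compressible. -/
def FPw (U : Computer) : Set ℝ :=
  {T | T ∈ Set.Ioo 0 1 ∧ WeaklyChaitinTRandom U T T ∧ TCompressible U T T}

/-- `FP` (w.r.t. the optimal computer `U` fixing `H`): the set of `T ∈ (0,1)`
that are Chaitin `T`-random and `T`-compressible. -/
def FP (U : Computer) : Set ℝ :=
  {T | T ∈ Set.Ioo 0 1 ∧ ChaitinTRandom U T T ∧ TCompressible U T T}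

/-- A computer is physically reasonable if its domain contains two strings of
different lengths. -/
def PhysicallyReasonable (C : Computer) : Prop :=
  ∃ p ∈ C.f.Dom, ∃ q ∈ C.f.Dom, p.length ≠ q.length

/-- A computable measure machine: `Z_C(1)` is a computable real. -/
def ComputableMeasureMachine (C : Computer) : Prop :=
  ComputableReal (Zfun C 1)

/-- `D` is the composition `C₀ ⊘ C₁ ⊘ ⋯ ⊘ C_{N-1}`: its domain consists of the
concatenations `p₀p₁⋯p_{N-1}` with each `pᵢ ∈ Dom Cᵢ`, and on such a
concatenation it returns `C₀(p₀)`. -/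
def IsComposition {N : ℕ} (C : Fin N → Computer) (hN : 0 < N) (D : Computer) : Prop :=
  (∀ l, l ∈ D.f.Dom ↔
      ∃ ps : Fin N → List Bool, (∀ i, ps i ∈ (C i).f.Dom) ∧ l = (List.ofFn ps).flatten) ∧
  (∀ ps : Fin N → List Bool, (∀ i, ps i ∈ (C i).f.Dom) →
      D.f ((List.ofFn ps).flatten) = (C ⟨0, hN⟩).f (ps ⟨0, hN⟩))

/-- A sequence of computers is recursive if a single partial recursive function
uniformly computes all of them. -/
def RecursiveSeq (V : ℕ → Computer) : Prop :=
  ∃ F : ℕ × List Bool →. List Bool, Partrec F ∧ ∀ n p, (V n).f p = F (n, p)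

section RatCode

/-- The raw code of a rational number, as used by the `Encodable ℚ` instance. -/
def rawCode (q : ℚ) : ℕ := @Encodable.encode ℚ Rat.instEncodable q

theorem rawCode_eq (q : ℚ) : rawCode q = Nat.pair (Encodable.encode q.num) q.den := by
  cases q; rfl

theorem encode_int_ofNat (z : ℕ) : Encodable.encode (z : ℤ) = 2 * z := by
  show Equiv.intEquivNat _ = _
  rfl

theorem encode_int_negSucc (z : ℕ) : Encodable.encode (Int.negSucc z) = 2 * z + 1 := by
  show Equiv.intEquivNat _ = _
  rfl

theorem natAbs_eq_code (z : ℤ) : z.natAbs = (Encodable.encode z + 1) / 2 := by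
  cases z with
  | ofNat n =>
    have := encode_int_ofNat n
    simp only [Int.ofNat_eq_natCast] at *
    rw [this]; simp; omega
  | negSucc n => rw [encode_int_negSucc]; simp; omega

theorem toNat_eq_code (z : ℤ) :
    z.toNat = if Encodable.encode z % 2 = 0 then Encodable.encode z / 2 else 0 := by
  cases z with
  | ofNat n =>
    have := encode_int_ofNat n
    simp only [Int.ofNat_eq_natCast] at *
    rw [this]; simp
  | negSucc n => rw [encode_int_negSucc]; simp

theorem encode_int_surj (n : ℕ) : ∃ z : ℤ, Encodable.encode z = n :=
  ⟨Equiv.intEquivNat.symm n, by show Equiv.intEquivNat _ = _; simp⟩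

theorem mem_range_rawCode (x : ℕ) :
    x ∈ Set.range rawCode ↔
      0 < x.unpair.2 ∧ Nat.Coprime ((x.unpair.1 + 1) / 2) x.unpair.2 := by
  constructor
  · rintro ⟨q, rfl⟩
    rw [rawCode_eq]
    simp only [Nat.unpair_pair]
    rw [← natAbs_eq_code]
    exact ⟨q.den_pos, q.reduced⟩
  · rintro ⟨h1, h2⟩
    obtain ⟨z, hz⟩ := encode_int_surj x.unpair.1
    refine ⟨⟨z, x.unpair.2, h1.ne', ?_⟩, ?_⟩
    · rw [natAbs_eq_code, hz]; exact h2
    · rw [rawCode_eq]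
      simp only [hz, Nat.pair_unpair]

theorem coprime_iff_bdd (a b : ℕ) (hb : 0 < b) :
    Nat.Coprime a b ↔ ∀ k < b + 1, ¬ (1 < k ∧ a % k = 0 ∧ b % k = 0) := by
  constructor
  · rintro h k - ⟨h1, h2, h3⟩
    have := Nat.dvd_gcd (Nat.dvd_of_mod_eq_zero h2) (Nat.dvd_of_mod_eq_zero h3)
    rw [h] at this
    have := Nat.le_of_dvd one_pos this
    omega
  · intro h
    by_contra hne
    have hpos : 0 < Nat.gcd a b := Nat.gcd_pos_of_pos_right _ hb
    refine h (Nat.gcd a b) (Nat.lt_succ_of_le (Nat.gcd_le_right _ hb)) ⟨?_, ?_, ?_⟩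
    · unfold Nat.Coprime at hne; omega
    · exact Nat.mod_eq_zero_of_dvd (Nat.gcd_dvd_left _ _)
    · exact Nat.mod_eq_zero_of_dvd (Nat.gcd_dvd_right _ _)

theorem primrec_range_rawCode : PrimrecPred (fun x => x ∈ Set.range rawCode) := by
  have hR : PrimrecRel (fun (k x : ℕ) =>
      ¬ (1 < k ∧ ((x.unpair.1 + 1) / 2) % k = 0 ∧ x.unpair.2 % k = 0)) := by
    have hk : Primrec (fun p : ℕ × ℕ => p.1) := Primrec.fst
    have hu : Primrec (fun p : ℕ × ℕ => p.2.unpair) := Primrec.unpair.comp Primrec.snd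
    have h1 : Primrec (fun p : ℕ × ℕ => (p.2.unpair.1 + 1) / 2) :=
      Primrec.nat_div.comp (Primrec.succ.comp (Primrec.fst.comp hu)) (Primrec.const 2)
    have h2 : Primrec (fun p : ℕ × ℕ => p.2.unpair.2) := Primrec.snd.comp hu
    exact PrimrecPred.not (PrimrecPred.and (Primrec.nat_lt.comp (Primrec.const 1) hk)
      (PrimrecPred.and (Primrec.eq.comp (Primrec.nat_mod.comp h1 hk) (Primrec.const 0))
        (Primrec.eq.comp (Primrec.nat_mod.comp h2 hk) (Primrec.const 0))))
  have hA := hR.forall_lt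
  have hu2 : Primrec (fun x : ℕ => x.unpair.2) := Primrec.snd.comp Primrec.unpair
  have hB : PrimrecPred (fun x : ℕ => 0 < x.unpair.2 ∧ ∀ k < x.unpair.2 + 1,
      ¬ (1 < k ∧ ((x.unpair.1 + 1) / 2) % k = 0 ∧ x.unpair.2 % k = 0)) :=
    PrimrecPred.and (Primrec.nat_lt.comp (Primrec.const 0) hu2)
      (hA.comp (Primrec.succ.comp hu2) Primrec.id)
  refine hB.of_eq fun x => ?_
  rw [mem_range_rawCode]
  constructor
  · rintro ⟨h1, h2⟩; exact ⟨h1, (coprime_iff_bdd _ _ h1).2 h2⟩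
  · rintro ⟨h1, h2⟩; exact ⟨h1, (coprime_iff_bdd _ _ h1).1 h2⟩

theorem computable_subtype_ofNat (s : Set ℕ) [DecidablePred (· ∈ s)] [Infinite s]
    (hs : PrimrecPred (fun x => x ∈ s)) :
    Computable (fun n => ((Nat.Subtype.ofNat s n : s) : ℕ)) := by
  have hex : ∀ x : ℕ, ∃ m, x + m + 1 ∈ s := by
    intro x
    have hinf : s.Infinite := Set.infinite_coe_iff.1 inferInstance
    obtain ⟨y, hy, hxy⟩ := hinf.exists_gt x
    exact ⟨y - x - 1, by rwa [show x + (y - x - 1) + 1 = y by omega]⟩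
  have hP : ComputablePred (fun p : ℕ × ℕ => p.1 + p.2 + 1 ∈ s) :=
    (hs.comp (Primrec.succ.comp (Primrec.nat_add.comp Primrec.fst Primrec.snd))).computablePred
  have hfind := Computable.find (P := fun x m => x + m + 1 ∈ s) hP hex
  have hstep : Computable (fun x => x + Nat.find (hex x) + 1) :=
    Computable.succ.comp (Primrec.nat_add.to_comp.comp Computable.id hfind)
  have hrec : Computable (fun n : ℕ => (Nat.rec ((Nat.Subtype.ofNat s 0 : s) : ℕ)
      (fun _ IH => IH + Nat.find (hex IH) + 1) n : ℕ)) :=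
    Computable.nat_rec (f := fun n : ℕ => n) (g := fun _ => ((Nat.Subtype.ofNat s 0 : s) : ℕ))
      (h := fun _ p => p.2 + Nat.find (hex p.2) + 1) Computable.id (Computable.const _)
      ((hstep.comp (Computable.snd.comp Computable.snd)).to₂)
  refine hrec.of_eq fun n => ?_
  induction n with
  | zero => rfl
  | succ k ih =>
    simp only [] at ih ⊢
    rw [ih]
    rfl

theorem computable_rawCode : Computable rawCode := by
  let _ := @Encodable.decidableRangeEncode ℚ Rat.instEncodable
  have : Infinite (Set.range (@Encodable.encode ℚ Rat.instEncodable)) :=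
    Infinite.of_injective _
      (Equiv.ofInjective _ (@Encodable.encode_injective ℚ Rat.instEncodable)).injective
  have h1 : ∀ n, (Denumerable.ofNat ℚ n) = (@Encodable.equivRangeEncode ℚ Rat.instEncodable).symm
      (Nat.Subtype.ofNat (Set.range (@Encodable.encode ℚ Rat.instEncodable)) n) := fun n => rfl
  have h2 : ∀ n, rawCode (Denumerable.ofNat ℚ n) =
      (Nat.Subtype.ofNat (Set.range (@Encodable.encode ℚ Rat.instEncodable)) n : ℕ) := by
    intro n
    rw [h1]
    exact congrArg Subtype.val ((@Encodable.equivRangeEncode ℚ Rat.instEncodable).apply_symm_apply _)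
  have h3 := (computable_subtype_ofNat (Set.range (@Encodable.encode ℚ Rat.instEncodable))
    primrec_range_rawCode).comp (Computable.encode (α := ℚ))
  refine h3.of_eq fun q => ?_
  rw [← h2, Denumerable.ofNat_encode]

theorem computable_rat_den : Computable (fun q : ℚ => q.den) := by
  refine ((Computable.snd.comp Primrec.unpair.to_comp).comp computable_rawCode).of_eq fun q => ?_
  simp [rawCode_eq]

theorem computable_rat_toNat : Computable (fun q : ℚ => q.num.toNat) := by
  have h0 : Primrec (fun n : ℕ => if n % 2 = 0 then n / 2 else 0) :=
    Primrec.ite (Primrec.eq.comp (Primrec.nat_mod.comp Primrec.id (Primrec.const 2))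
      (Primrec.const 0)) (Primrec.nat_div.comp Primrec.id (Primrec.const 2)) (Primrec.const 0)
  refine (h0.to_comp.comp
    ((Computable.fst.comp Primrec.unpair.to_comp).comp computable_rawCode)).of_eq fun q => ?_
  simp [rawCode_eq, toNat_eq_code]

end RatCode

section Sigma1

set_option linter.unusedSectionVars false

variable {α β γ : Type} [Primcodable α] [Primcodable β] [Primcodable γ]

/-- A predicate is `Sig` if it is an existential projection of a decidable one. -/
def Sig (p : α → Prop) : Prop :=
  ∃ Q : α × ℕ → Bool, Computable Q ∧ ∀ a, p a ↔ ∃ n, Q (a, n) = true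

theorem Sig.of_eq {p q : α → Prop} (hp : Sig p) (h : ∀ a, p a ↔ q a) : Sig q := by
  obtain ⟨Q, hQ, hQ'⟩ := hp
  exact ⟨Q, hQ, fun a => (h a).symm.trans (hQ' a)⟩

theorem Sig.comp {p : β → Prop} (hp : Sig p) {f : α → β} (hf : Computable f) :
    Sig (fun a => p (f a)) := by
  obtain ⟨Q, hQ, hQ'⟩ := hp
  exact ⟨fun x => Q (f x.1, x.2), hQ.comp ((hf.comp Computable.fst).pair Computable.snd),
    fun a => hQ' (f a)⟩

theorem Sig.of_bool {f : α → Bool} (hf : Computable f) : Sig (fun a => f a = true) :=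
  ⟨fun x => f x.1, hf.comp Computable.fst, fun a => by simp⟩

theorem Sig.of_comp {p : α → Prop} (hp : ComputablePred p) : Sig p := by
  obtain ⟨_, h⟩ := hp
  exact (Sig.of_bool h).of_eq fun a => by simp

theorem Sig.of_prim {p : α → Prop} (hp : PrimrecPred p) : Sig p :=
  Sig.of_comp hp.computablePred

theorem Sig.and {p q : α → Prop} (hp : Sig p) (hq : Sig q) : Sig (fun a => p a ∧ q a) := by
  obtain ⟨Q, hQ, hQ'⟩ := hp
  obtain ⟨R, hR, hR'⟩ := hq
  have hu : Computable (fun x : α × ℕ => x.2.unpair) :=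
    Primrec.unpair.to_comp.comp Computable.snd
  refine ⟨fun x => Q (x.1, x.2.unpair.1) && R (x.1, x.2.unpair.2), ?_, fun a => ?_⟩
  · exact Primrec.and.to_comp.comp
      (hQ.comp (Computable.fst.pair (Computable.fst.comp hu)))
      (hR.comp (Computable.fst.pair (Computable.snd.comp hu)))
  · show (p a ∧ q a) ↔ _
    rw [hQ' a, hR' a]
    constructor
    · rintro ⟨⟨n, hn⟩, m, hm⟩
      exact ⟨Nat.pair n m, by simp [hn, hm]⟩
    · rintro ⟨n, hn⟩
      simp only [Bool.and_eq_true] at hn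
      exact ⟨⟨_, hn.1⟩, _, hn.2⟩

/-- The search step used for existential quantification. -/
def searchStep (Q : (α × β) × ℕ → Bool) (x : α × ℕ) : Option β :=
  (Encodable.decode (α := β) x.2.unpair.1).bind
    (fun b => bif Q ((x.1, b), x.2.unpair.2) then some b else none)

theorem searchStep_computable {Q : (α × β) × ℕ → Bool} (hQ : Computable Q) :
    Computable (searchStep Q) := by
  have hu : Computable (fun x : α × ℕ => x.2.unpair) :=
    Primrec.unpair.to_comp.comp Computable.snd
  refine Computable.option_bind (Computable.decode.comp (Computable.fst.comp hu)) ?_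
  refine Computable.cond ?_ (Computable.option_some.comp Computable.snd) (Computable.const _)
  exact hQ.comp (((Computable.fst.comp Computable.fst).pair Computable.snd).pair
    (Computable.snd.comp (hu.comp Computable.fst)))

theorem searchStep_some {Q : (α × β) × ℕ → Bool} {a : α} {n : ℕ} {b : β}
    (h : searchStep Q (a, n) = some b) : Q ((a, b), n.unpair.2) = true := by
  unfold searchStep at h
  rw [Option.bind_eq_some_iff] at h
  obtain ⟨c, hc, h⟩ := h
  cases hq : Q ((a, c), n.unpair.2) with
  | false => simp [hq] at h
  | true => simp [hq] at h; rwa [← h]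

theorem searchStep_ex {Q : (α × β) × ℕ → Bool} {a : α} {n : ℕ} {b : β}
    (h : Q ((a, b), n) = true) : searchStep Q (a, Nat.pair (Encodable.encode b) n) = some b := by
  simp [searchStep, h]

theorem Sig.ex {p : α × β → Prop} (hp : Sig p) : Sig (fun a => ∃ b, p (a, b)) := by
  obtain ⟨Q, hQ, hQ'⟩ := hp
  refine ⟨fun x => (searchStep Q x).isSome,
    Primrec.option_isSome.to_comp.comp (searchStep_computable hQ), fun a => ?_⟩
  constructor
  · rintro ⟨b, hb⟩
    obtain ⟨n, hn⟩ := (hQ' _).1 hb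
    exact ⟨Nat.pair (Encodable.encode b) n, by
      show (searchStep Q _).isSome = true
      rw [searchStep_ex hn]; rfl⟩
  · rintro ⟨n, hn⟩
    obtain ⟨b, hb⟩ := Option.isSome_iff_exists.1 hn
    exact ⟨b, (hQ' _).2 ⟨_, searchStep_some hb⟩⟩

theorem Sig.select {p : α × β → Prop} (hp : Sig p) :
    ∃ f : α →. β, Partrec f ∧ (∀ a, ∀ b ∈ f a, p (a, b)) ∧ ∀ a, (∃ b, p (a, b)) → (f a).Dom := by
  obtain ⟨Q, hQ, hQ'⟩ := hp
  refine ⟨fun a => Nat.rfindOpt fun n => searchStep Q (a, n),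
    Partrec.rfindOpt (searchStep_computable hQ), ?_, ?_⟩
  · intro a b hb
    obtain ⟨n, hn⟩ := Nat.rfindOpt_spec hb
    exact (hQ' _).2 ⟨_, searchStep_some hn⟩
  · rintro a ⟨b, hb⟩
    obtain ⟨n, hn⟩ := (hQ' _).1 hb
    rw [Nat.rfindOpt_dom]
    exact ⟨_, b, searchStep_ex hn⟩

/-- Nonnegative fractions. -/
noncomputable def fr (x : ℕ × ℕ) : ℝ := (x.1 : ℝ) / ((x.2 : ℝ) + 1)

theorem fr_nonneg (x : ℕ × ℕ) : 0 ≤ fr x := by unfold fr; positivity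

theorem fr_dense {x y : ℝ} (hx : 0 ≤ x) (h : x < y) : ∃ u, x < fr u ∧ fr u < y := by
  obtain ⟨q, h1, h2⟩ := exists_rat_btwn h
  have hq : 0 < q := by exact_mod_cast hx.trans_lt h1
  have : fr (q.num.toNat, q.den - 1) = (q : ℝ) := by
    unfold fr
    have hd : ((q.den - 1 : ℕ) : ℝ) + 1 = q.den := by
      rw [Nat.cast_sub q.den_pos]; simp
    have hn : ((q.num.toNat : ℕ) : ℝ) = (q.num : ℝ) := by
      have : ((q.num.toNat : ℕ) : ℤ) = q.num := Int.toNat_of_nonneg (Rat.num_nonneg.2 hq.le)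
      exact_mod_cast this
    simp only [hd, hn]
    exact (Rat.cast_def q).symm
  exact ⟨_, by rwa [this], by rwa [this]⟩

/-- Both cuts of the real-valued function `f` are `Sig`. -/
def CR (f : α → ℝ) : Prop :=
  Sig (fun x : α × (ℕ × ℕ) => fr x.2 < f x.1) ∧ Sig (fun x : α × (ℕ × ℕ) => f x.1 < fr x.2)

theorem CR.of_eq {f g : α → ℝ} (hf : CR f) (h : ∀ a, f a = g a) : CR g := by
  rwa [← (funext h : f = g)]

theorem CR.comp {f : β → ℝ} (hf : CR f) {h : α → β} (hh : Computable h) :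
    CR (fun a => f (h a)) :=
  ⟨hf.1.comp ((hh.comp Computable.fst).pair Computable.snd : Computable
      (fun x : α × (ℕ × ℕ) => (h x.1, x.2))),
   hf.2.comp ((hh.comp Computable.fst).pair Computable.snd : Computable
      (fun x : α × (ℕ × ℕ) => (h x.1, x.2)))⟩

theorem CR.lt {f g : α → ℝ} (hf : CR f) (hg : CR g) (h0 : ∀ a, 0 ≤ f a) :
    Sig (fun a => f a < g a) := by
  refine (Sig.ex (hf.2.and hg.1)).of_eq fun a => ?_
  constructor
  · rintro ⟨u, h1, h2⟩; exact h1.trans h2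
  · intro h
    obtain ⟨u, h1, h2⟩ := fr_dense (h0 a) h
    exact ⟨u, h1, h2⟩

theorem CR.map₂ {op : α → ℝ → ℝ → ℝ} {f g : α → ℝ} (hf : CR f) (hg : CR g)
    (f0 : ∀ a, 0 < f a) (g0 : ∀ a, 0 < g a)
    (hmono : ∀ a x y x' y', 0 ≤ x → x ≤ x' → 0 ≤ y → y ≤ y' → op a x y ≤ op a x' y')
    (hcont : ∀ a, Continuous (fun p : ℝ × ℝ => op a p.1 p.2))
    (hl : Sig (fun z : α × ((ℕ × ℕ) × ((ℕ × ℕ) × (ℕ × ℕ))) =>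
      fr z.2.1 < op z.1 (fr z.2.2.1) (fr z.2.2.2)))
    (hu : Sig (fun z : α × ((ℕ × ℕ) × ((ℕ × ℕ) × (ℕ × ℕ))) =>
      op z.1 (fr z.2.2.1) (fr z.2.2.2) < fr z.2.1)) :
    CR (fun a => op a (f a) (g a)) := by
  have c1 : Computable (fun z : (α × (ℕ × ℕ)) × ((ℕ × ℕ) × (ℕ × ℕ)) => (z.1.1, z.2.1)) :=
    (Computable.fst.comp Computable.fst).pair (Computable.fst.comp Computable.snd)
  have c2 : Computable (fun z : (α × (ℕ × ℕ)) × ((ℕ × ℕ) × (ℕ × ℕ)) => (z.1.1, z.2.2)) :=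
    (Computable.fst.comp Computable.fst).pair (Computable.snd.comp Computable.snd)
  have c3 : Computable (fun z : (α × (ℕ × ℕ)) × ((ℕ × ℕ) × (ℕ × ℕ)) =>
      (z.1.1, (z.1.2, z.2))) :=
    (Computable.fst.comp Computable.fst).pair
      ((Computable.snd.comp Computable.fst).pair Computable.snd)
  have hbox : ∀ a (s : Set ℝ), IsOpen s → op a (f a) (g a) ∈ s → ∃ ε > 0,
      ∀ x y, |x - f a| < ε → |y - g a| < ε → op a x y ∈ s := by
    intro a s hs hm
    have := (hcont a).continuousAt (x := (f a, g a)) (hs.mem_nhds hm)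
    obtain ⟨ε, he, hb⟩ := Metric.mem_nhds_iff.1 this
    refine ⟨ε, he, fun x y hx hy => ?_⟩
    have : (x, y) ∈ Metric.ball (f a, g a) ε := by
      rw [Metric.mem_ball, Prod.dist_eq]
      exact max_lt hx hy
    exact hb this
  constructor
  · refine (Sig.ex ((hf.1.comp c1).and ((hg.1.comp c2).and (hl.comp c3)))).of_eq fun x => ?_
    obtain ⟨a, q⟩ := x
    constructor
    · rintro ⟨⟨u, v⟩, h1, h2, h3⟩
      exact h3.trans_le (hmono a _ _ _ _ (fr_nonneg _) h1.le (fr_nonneg _) h2.le)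
    · intro h
      obtain ⟨ε, he, hb⟩ := hbox a (Set.Ioi (fr q)) isOpen_Ioi h
      obtain ⟨u, hu1, hu2⟩ := fr_dense (le_max_left 0 (f a - ε))
        (max_lt (f0 a) (by linarith) : _ < f a)
      obtain ⟨v, hv1, hv2⟩ := fr_dense (le_max_left 0 (g a - ε))
        (max_lt (g0 a) (by linarith) : _ < g a)
      have hu3 := (le_max_right 0 (f a - ε)).trans_lt hu1
      have hv3 := (le_max_right 0 (g a - ε)).trans_lt hv1
      refine ⟨(u, v), hu2, hv2, hb _ _ ?_ ?_⟩ <;> rw [abs_lt] <;> constructor <;> linarith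
  · refine (Sig.ex ((hf.2.comp c1).and ((hg.2.comp c2).and (hu.comp c3)))).of_eq fun x => ?_
    obtain ⟨a, q⟩ := x
    constructor
    · rintro ⟨⟨u, v⟩, h1, h2, h3⟩
      exact (hmono a _ _ _ _ (f0 a).le (le_of_lt h1) (g0 a).le (le_of_lt h2)).trans_lt h3
    · intro h
      obtain ⟨ε, he, hb⟩ := hbox a (Set.Iio (fr q)) isOpen_Iio h
      obtain ⟨u, hu1, hu2⟩ := fr_dense (f0 a).le (by linarith : f a < f a + ε)
      obtain ⟨v, hv1, hv2⟩ := fr_dense (g0 a).le (by linarith : g a < g a + ε)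
      refine ⟨(u, v), hu1, hv1, hb _ _ ?_ ?_⟩ <;> rw [abs_lt] <;> constructor <;> linarith

end Sigma1

section CRAlgebra

set_option linter.unusedSectionVars false

variable {α β γ : Type} [Primcodable α] [Primcodable β] [Primcodable γ]

theorem prim_pow : Primrec₂ ((· ^ ·) : ℕ → ℕ → ℕ) :=
  Primrec₂.unpaired'.1 Nat.Primrec.pow

theorem prim_list_sum : Primrec (List.sum : List ℕ → ℕ) := by
  have : Primrec (fun l : List ℕ => l.foldr (fun b s => b + s) 0) :=
    Primrec.list_foldr Primrec.id (Primrec.const 0)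
      ((Primrec.nat_add.comp (Primrec.fst.comp Primrec.snd)
        (Primrec.snd.comp Primrec.snd)).to₂)
  exact this.of_eq fun l => rfl

theorem fr_lt_fr_iff (q : ℕ × ℕ) (a b : ℕ) (hb : 0 < b) :
    fr q < (a : ℝ) / b ↔ q.1 * b < a * (q.2 + 1) := by
  unfold fr
  rw [div_lt_div_iff₀ (by positivity) (by exact_mod_cast hb)]
  exact_mod_cast Iff.rfl

theorem fr_gt_iff (q : ℕ × ℕ) (a b : ℕ) (hb : 0 < b) :
    (a : ℝ) / b < fr q ↔ a * (q.2 + 1) < q.1 * b := by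
  unfold fr
  rw [div_lt_div_iff₀ (by exact_mod_cast hb) (by positivity)]
  exact_mod_cast Iff.rfl

/-- A rational-valued computable function has `Sig` comparison predicates. -/
theorem sig_frac {A B : α → ℕ} {q : α → ℕ × ℕ} {F : α → ℝ} (hA : Computable A)
    (hB : Computable B) (hq : Computable q) (hpos : ∀ a, 0 < B a)
    (hF : ∀ a, F a = (A a : ℝ) / (B a : ℝ)) :
    Sig (fun a => fr (q a) < F a) ∧ Sig (fun a => F a < fr (q a)) := by
  have h1 : Computable (fun a => (q a).1 * B a) :=
    Primrec.nat_mul.to_comp.comp (Computable.fst.comp hq) hB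
  have h2 : Computable (fun a => A a * ((q a).2 + 1)) :=
    Primrec.nat_mul.to_comp.comp hA (Computable.succ.comp (Computable.snd.comp hq))
  have hlt : Sig (fun x : ℕ × ℕ => x.1 < x.2) := Sig.of_prim Primrec.nat_lt
  constructor
  · exact (hlt.comp (h1.pair h2)).of_eq fun a => by
      rw [hF, fr_lt_fr_iff _ _ _ (hpos a)]
  · exact (hlt.comp (h2.pair h1)).of_eq fun a => by
      rw [hF, fr_gt_iff _ _ _ (hpos a)]

theorem CR.frac {A B : α → ℕ} {F : α → ℝ} (hA : Computable A)
    (hB : Computable B) (hpos : ∀ a, 0 < B a)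
    (hF : ∀ a, F a = (A a : ℝ) / (B a : ℝ)) : CR F :=
  sig_frac (α := α × (ℕ × ℕ)) (hA.comp Computable.fst) (hB.comp Computable.fst)
    Computable.snd (fun x => hpos x.1) (fun x => hF x.1)

theorem CR.natConst (n : ℕ) : CR (fun _ : α => (n : ℝ)) :=
  CR.frac (A := fun _ => n) (B := fun _ => 1) (Computable.const _) (Computable.const _)
    (fun _ => one_pos) (fun _ => by simp)

theorem CR.add {f g : α → ℝ} (hf : CR f) (hg : CR g) (f0 : ∀ a, 0 < f a) (g0 : ∀ a, 0 < g a) :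
    CR (fun a => f a + g a) := by
  have hu : Primrec (fun z : α × ((ℕ × ℕ) × ((ℕ × ℕ) × (ℕ × ℕ))) => z.2.2.1) :=
    Primrec.fst.comp (Primrec.snd.comp Primrec.snd)
  have hv : Primrec (fun z : α × ((ℕ × ℕ) × ((ℕ × ℕ) × (ℕ × ℕ))) => z.2.2.2) :=
    Primrec.snd.comp (Primrec.snd.comp Primrec.snd)
  have hA : Primrec (fun z : α × ((ℕ × ℕ) × ((ℕ × ℕ) × (ℕ × ℕ))) =>
      z.2.2.1.1 * (z.2.2.2.2 + 1) + z.2.2.2.1 * (z.2.2.1.2 + 1)) :=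
    Primrec.nat_add.comp
      (Primrec.nat_mul.comp (Primrec.fst.comp hu) (Primrec.succ.comp (Primrec.snd.comp hv)))
      (Primrec.nat_mul.comp (Primrec.fst.comp hv) (Primrec.succ.comp (Primrec.snd.comp hu)))
  have hB : Primrec (fun z : α × ((ℕ × ℕ) × ((ℕ × ℕ) × (ℕ × ℕ))) =>
      (z.2.2.1.2 + 1) * (z.2.2.2.2 + 1)) :=
    Primrec.nat_mul.comp (Primrec.succ.comp (Primrec.snd.comp hu))
      (Primrec.succ.comp (Primrec.snd.comp hv))
  have key := sig_frac (F := fun z : α × ((ℕ × ℕ) × ((ℕ × ℕ) × (ℕ × ℕ))) =>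
    fr z.2.2.1 + fr z.2.2.2) hA.to_comp hB.to_comp (q := fun z => z.2.1)
    (Computable.fst.comp Computable.snd) (fun z => by positivity) (fun z => by
      unfold fr; push_cast; field_simp)
  exact CR.map₂ (op := fun _ x y => x + y) hf hg f0 g0
    (fun a x y x' y' _ h1 _ h2 => add_le_add h1 h2) (fun a => by fun_prop) key.1 key.2

theorem CR.mul {f g : α → ℝ} (hf : CR f) (hg : CR g) (f0 : ∀ a, 0 < f a) (g0 : ∀ a, 0 < g a) :
    CR (fun a => f a * g a) := by
  have hu : Primrec (fun z : α × ((ℕ × ℕ) × ((ℕ × ℕ) × (ℕ × ℕ))) => z.2.2.1) :=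
    Primrec.fst.comp (Primrec.snd.comp Primrec.snd)
  have hv : Primrec (fun z : α × ((ℕ × ℕ) × ((ℕ × ℕ) × (ℕ × ℕ))) => z.2.2.2) :=
    Primrec.snd.comp (Primrec.snd.comp Primrec.snd)
  have hA : Primrec (fun z : α × ((ℕ × ℕ) × ((ℕ × ℕ) × (ℕ × ℕ))) =>
      z.2.2.1.1 * z.2.2.2.1) :=
    Primrec.nat_mul.comp (Primrec.fst.comp hu) (Primrec.fst.comp hv)
  have hB : Primrec (fun z : α × ((ℕ × ℕ) × ((ℕ × ℕ) × (ℕ × ℕ))) =>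
      (z.2.2.1.2 + 1) * (z.2.2.2.2 + 1)) :=
    Primrec.nat_mul.comp (Primrec.succ.comp (Primrec.snd.comp hu))
      (Primrec.succ.comp (Primrec.snd.comp hv))
  have key := sig_frac (F := fun z : α × ((ℕ × ℕ) × ((ℕ × ℕ) × (ℕ × ℕ))) =>
    fr z.2.2.1 * fr z.2.2.2) hA.to_comp hB.to_comp (q := fun z => z.2.1)
    (Computable.fst.comp Computable.snd) (fun z => by positivity) (fun z => by
      unfold fr; push_cast; field_simp)
  exact CR.map₂ (op := fun _ x y => x * y) hf hg f0 g0
    (fun a x y x' y' h0 h1 h3 h2 => mul_le_mul h1 h2 h3 (h0.trans h1))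
    (fun a => by fun_prop) key.1 key.2

theorem fr_lt_exp (q u : ℕ × ℕ) :
    fr q < (2 : ℝ) ^ fr u ↔ q.1 ^ (u.2 + 1) < 2 ^ u.1 * (q.2 + 1) ^ (u.2 + 1) := by
  have e : ((2 : ℝ) ^ fr u) ^ (u.2 + 1) = 2 ^ u.1 := by
    rw [← Real.rpow_natCast, ← Real.rpow_mul (by norm_num), ← Real.rpow_natCast]
    congr 1; unfold fr; push_cast; field_simp
  rw [← pow_lt_pow_iff_left₀ (fr_nonneg q) (by positivity) (Nat.succ_ne_zero u.2)]
  show fr q ^ (u.2 + 1) < ((2 : ℝ) ^ fr u) ^ (u.2 + 1) ↔ _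
  rw [e]; unfold fr
  rw [div_pow, div_lt_iff₀ (by positivity)]
  exact_mod_cast Iff.rfl

theorem fr_gt_exp (q u : ℕ × ℕ) :
    (2 : ℝ) ^ fr u < fr q ↔ 2 ^ u.1 * (q.2 + 1) ^ (u.2 + 1) < q.1 ^ (u.2 + 1) := by
  have e : ((2 : ℝ) ^ fr u) ^ (u.2 + 1) = 2 ^ u.1 := by
    rw [← Real.rpow_natCast, ← Real.rpow_mul (by norm_num), ← Real.rpow_natCast]
    congr 1; unfold fr; push_cast; field_simp
  rw [← pow_lt_pow_iff_left₀ (by positivity) (fr_nonneg q) (Nat.succ_ne_zero u.2)]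
  show ((2 : ℝ) ^ fr u) ^ (u.2 + 1) < fr q ^ (u.2 + 1) ↔ _
  rw [e]; unfold fr
  rw [div_pow, lt_div_iff₀ (by positivity)]
  exact_mod_cast Iff.rfl

theorem CR.exp2 {f : α → ℝ} (hf : CR f) (f0 : ∀ a, 0 < f a) :
    CR (fun a => (2 : ℝ) ^ f a) := by
  have hq : Primrec (fun z : α × ((ℕ × ℕ) × ((ℕ × ℕ) × (ℕ × ℕ))) => z.2.1) :=
    Primrec.fst.comp Primrec.snd
  have hu : Primrec (fun z : α × ((ℕ × ℕ) × ((ℕ × ℕ) × (ℕ × ℕ))) => z.2.2.1) :=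
    Primrec.fst.comp (Primrec.snd.comp Primrec.snd)
  have hu2 := Primrec.succ.comp (Primrec.snd.comp hu)
  have hA := prim_pow.comp (Primrec.fst.comp hq) hu2
  have hB := Primrec.nat_mul.comp (prim_pow.comp (Primrec.const 2) (Primrec.fst.comp hu))
    (prim_pow.comp (Primrec.succ.comp (Primrec.snd.comp hq)) hu2)
  have hlt : Sig (fun x : ℕ × ℕ => x.1 < x.2) := Sig.of_prim Primrec.nat_lt
  refine CR.map₂ (op := fun _ x _ => (2 : ℝ) ^ x) hf hf f0 f0
    (fun a x y x' y' h0 h1 h3 h2 => Real.rpow_le_rpow_of_exponent_le (by norm_num) h1)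
    (fun a => ?_) ?_ ?_
  · exact (Real.continuous_const_rpow (by norm_num)).comp continuous_fst
  · exact (hlt.comp (hA.pair hB).to_comp).of_eq fun z => (fr_lt_exp _ _).symm
  · exact (hlt.comp (hB.pair hA).to_comp).of_eq fun z => (fr_gt_exp _ _).symm

theorem CR.inv {f : α → ℝ} (hf : CR f) (f0 : ∀ a, 0 < f a) : CR (fun a => (f a)⁻¹) := by
  have c1 : Computable (fun z : (α × (ℕ × ℕ)) × (ℕ × ℕ) => (z.1.1, z.2)) :=
    (Computable.fst.comp Computable.fst).pair Computable.snd
  have hlt : Sig (fun x : ℕ × ℕ => x.1 < x.2) := Sig.of_prim Primrec.nat_lt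
  have hq : Primrec (fun z : (α × (ℕ × ℕ)) × (ℕ × ℕ) => z.1.2) :=
    Primrec.snd.comp Primrec.fst
  have hu : Primrec (fun z : (α × (ℕ × ℕ)) × (ℕ × ℕ) => z.2) := Primrec.snd
  have hA := Primrec.nat_mul.comp (Primrec.fst.comp hq) (Primrec.fst.comp hu)
  have hB := Primrec.nat_mul.comp (Primrec.succ.comp (Primrec.snd.comp hq))
    (Primrec.succ.comp (Primrec.snd.comp hu))
  have e1 : ∀ q u : ℕ × ℕ, q.1 * u.1 < (q.2 + 1) * (u.2 + 1) ↔ fr q * fr u < 1 := by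
    intro q u
    unfold fr
    rw [div_mul_div_comm, div_lt_one (by positivity)]
    exact_mod_cast Iff.rfl
  have e2 : ∀ q u : ℕ × ℕ, (q.2 + 1) * (u.2 + 1) < q.1 * u.1 ↔ 1 < fr q * fr u := by
    intro q u
    unfold fr
    rw [div_mul_div_comm, one_lt_div (by positivity)]
    exact_mod_cast Iff.rfl
  constructor
  · refine (Sig.ex ((hf.2.comp c1).and (hlt.comp (hA.pair hB).to_comp))).of_eq fun x => ?_
    obtain ⟨a, q⟩ := x
    show (∃ u, f a < fr u ∧ q.1 * u.1 < (q.2 + 1) * (u.2 + 1)) ↔ fr q < (f a)⁻¹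
    simp only [e1]
    constructor
    · rintro ⟨u, h1, h2⟩
      rw [← one_div, lt_div_iff₀ (f0 a)]
      exact (mul_le_mul_of_nonneg_left (le_of_lt h1) (fr_nonneg q)).trans_lt h2
    · intro h
      have h' := (inv_lt_inv₀ (inv_pos.2 (f0 a)) (show 0 < max (fr q) ((f a)⁻¹ / 2) from
        lt_max_of_lt_right (by have := inv_pos.2 (f0 a); linarith))).2
        (max_lt h (by have := inv_pos.2 (f0 a); linarith))
      rw [inv_inv] at h'
      obtain ⟨u, h1, h2⟩ := fr_dense (f0 a).le h'
      refine ⟨u, h1, ?_⟩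
      have hm : 0 < max (fr q) ((f a)⁻¹ / 2) :=
        lt_max_of_lt_right (by have := inv_pos.2 (f0 a); linarith)
      rw [← one_div, lt_div_iff₀ hm] at h2
      calc fr q * fr u ≤ max (fr q) ((f a)⁻¹ / 2) * fr u :=
            mul_le_mul_of_nonneg_right (le_max_left _ _) (fr_nonneg u)
        _ < 1 := by rwa [mul_comm]
  · refine (Sig.ex ((hf.1.comp c1).and (hlt.comp (hB.pair hA).to_comp))).of_eq fun x => ?_
    obtain ⟨a, q⟩ := x
    show (∃ u, fr u < f a ∧ (q.2 + 1) * (u.2 + 1) < q.1 * u.1) ↔ (f a)⁻¹ < fr q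
    simp only [e2]
    constructor
    · rintro ⟨u, h1, h2⟩
      rw [← one_div, div_lt_iff₀ (f0 a)]
      exact h2.trans_le (mul_le_mul_of_nonneg_left (le_of_lt h1) (fr_nonneg q))
    · intro h
      have hq0 : 0 < fr q := (inv_pos.2 (f0 a)).trans h
      have h' : (fr q)⁻¹ < f a := by
        rw [← one_div, div_lt_iff₀ hq0]
        rw [← one_div, div_lt_iff₀ (f0 a)] at h
        rwa [mul_comm]
      obtain ⟨u, h1, h2⟩ := fr_dense (inv_pos.2 hq0).le h'
      refine ⟨u, h2, ?_⟩
      rw [← one_div, div_lt_iff₀ hq0] at h1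
      rwa [mul_comm]

theorem CR.pow {f : α → ℝ} (hf : CR f) (f0 : ∀ a, 0 < f a) (n : ℕ) :
    CR (fun a => f a ^ n) := by
  induction n with
  | zero => exact (CR.natConst 1).of_eq fun a => by simp
  | succ n ih => exact (ih.mul hf (fun a => pow_pos (f0 a) n) f0).of_eq fun a => (pow_succ _ _).symm

theorem toNat_eq (q : ℚ) : ((q.num.toNat : ℕ) : ℝ) / (q.den : ℝ) = max (q : ℝ) 0 := by
  have hd : (0 : ℝ) < q.den := by exact_mod_cast q.den_pos
  rcases le_total 0 q with h | h
  · have hn : ((q.num.toNat : ℕ) : ℝ) = (q.num : ℝ) := by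
      have : ((q.num.toNat : ℕ) : ℤ) = q.num := Int.toNat_of_nonneg (Rat.num_nonneg.2 h)
      exact_mod_cast this
    rw [hn, max_eq_left (by exact_mod_cast h)]
    exact (Rat.cast_def q).symm
  · have : q.num.toNat = 0 := Int.toNat_of_nonpos (Rat.num_nonpos.2 h)
    rw [this, max_eq_right (by exact_mod_cast h)]; simp

theorem CR.const {s : ℝ} (hs : ComputableReal s) (s0 : 0 < s) : CR (fun _ : α => s) := by
  obtain ⟨f, hf, hfs⟩ := hs
  have hf' : ∀ n : ℕ, |s - max (f (n + 1) : ℝ) 0| < 1 / ((n : ℝ) + 1) := by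
    intro n
    have h := hfs (n + 1) (Nat.succ_pos n)
    push_cast at h
    rcases le_total (f (n + 1) : ℝ) 0 with h0 | h0
    · rw [max_eq_right h0]
      rw [abs_lt] at h ⊢
      constructor <;> [linarith [h.1, h.2, abs_nonneg (s - (f (n+1) : ℝ))]; linarith]
    · rwa [max_eq_left h0]
  have hn : Computable (fun z : (α × (ℕ × ℕ)) × ℕ => (f (z.2 + 1)).num.toNat) :=
    computable_rat_toNat.comp (hf.comp (Computable.succ.comp Computable.snd))
  have hd : Computable (fun z : (α × (ℕ × ℕ)) × ℕ => (f (z.2 + 1)).den) :=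
    computable_rat_den.comp (hf.comp (Computable.succ.comp Computable.snd))
  have hk : Computable (fun z : (α × (ℕ × ℕ)) × ℕ => z.2 + 1) := Computable.succ.comp Computable.snd
  have hp : Computable (fun z : (α × (ℕ × ℕ)) × ℕ => z.1.2.1) :=
    Computable.fst.comp (Computable.snd.comp Computable.fst)
  have hq : Computable (fun z : (α × (ℕ × ℕ)) × ℕ => z.1.2.2 + 1) :=
    Computable.succ.comp (Computable.snd.comp (Computable.snd.comp Computable.fst))
  have mul := Primrec.nat_mul.to_comp
  have add := Primrec.nat_add.to_comp
  have hlt : Sig (fun x : ℕ × ℕ => x.1 < x.2) := Sig.of_prim Primrec.nat_lt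
  constructor
  · refine (Sig.ex (hlt.comp ((mul.comp (add.comp (mul.comp hp hk) hq) hd).pair
      (mul.comp hn (mul.comp hq hk))))).of_eq fun x => ?_
    obtain ⟨a, q⟩ := x
    have e : ∀ n : ℕ, (q.1 * (n + 1) + (q.2 + 1)) * (f (n + 1)).den <
        (f (n + 1)).num.toNat * ((q.2 + 1) * (n + 1)) ↔
        fr q + 1 / ((n : ℝ) + 1) < max (f (n + 1) : ℝ) 0 := by
      intro n
      have hd : (0 : ℝ) < (f (n + 1)).den := by exact_mod_cast (f (n + 1)).den_pos
      rw [← toNat_eq]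
      unfold fr
      rw [div_add_div _ _ (by positivity) (by positivity),
        div_lt_div_iff₀ (by positivity) hd, mul_one]
      exact_mod_cast Iff.rfl
    show (∃ n : ℕ, (q.1 * (n + 1) + (q.2 + 1)) * (f (n + 1)).den <
        (f (n + 1)).num.toNat * ((q.2 + 1) * (n + 1))) ↔ fr q < s
    simp only [e]
    constructor
    · rintro ⟨n, h⟩
      have := abs_lt.1 (hf' n)
      linarith [this.1, this.2]
    · intro h
      obtain ⟨n, hn⟩ := exists_nat_one_div_lt (show 0 < (s - fr q) / 2 by linarith)
      have := abs_lt.1 (hf' n)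
      exact ⟨n, by linarith [this.1, this.2]⟩
  · refine (Sig.ex (hlt.comp ((mul.comp (add.comp (mul.comp hn hk) hd) hq).pair
      (mul.comp hp (mul.comp hd hk))))).of_eq fun x => ?_
    obtain ⟨a, q⟩ := x
    have e : ∀ n : ℕ, ((f (n + 1)).num.toNat * (n + 1) + (f (n + 1)).den) * (q.2 + 1) <
        q.1 * ((f (n + 1)).den * (n + 1)) ↔
        max (f (n + 1) : ℝ) 0 + 1 / ((n : ℝ) + 1) < fr q := by
      intro n
      have hd : (0 : ℝ) < (f (n + 1)).den := by exact_mod_cast (f (n + 1)).den_pos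
      rw [← toNat_eq]
      unfold fr
      rw [div_add_div _ _ (by positivity) (by positivity),
        div_lt_div_iff₀ (by positivity) (by positivity), mul_one]
      exact_mod_cast Iff.rfl
    show (∃ n : ℕ, ((f (n + 1)).num.toNat * (n + 1) + (f (n + 1)).den) * (q.2 + 1) <
        q.1 * ((f (n + 1)).den * (n + 1))) ↔ s < fr q
    simp only [e]
    constructor
    · rintro ⟨n, h⟩
      have := abs_lt.1 (hf' n)
      linarith [this.1, this.2]
    · intro h
      obtain ⟨n, hn⟩ := exists_nat_one_div_lt (show 0 < (fr q - s) / 2 by linarith)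
      have := abs_lt.1 (hf' n)
      exact ⟨n, by linarith [this.1, this.2]⟩

/-- Value of a sparse polynomial given by a list of (coefficient, exponent). -/
noncomputable def polyVal (L : List (ℕ × ℕ)) (x : ℝ) : ℝ :=
  (L.map (fun c => (c.1 : ℝ) * x ^ c.2)).sum

theorem polyVal_frac (L : List (ℕ × ℕ)) (M a b : ℕ) (hb : 0 < b) (hM : ∀ c ∈ L, c.2 ≤ M) :
    polyVal L ((a : ℝ) / b) =
      (((L.map (fun c => c.1 * (a ^ c.2 * b ^ (M - c.2)))).sum : ℕ) : ℝ) / ((b ^ M : ℕ) : ℝ) := by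
  induction L with
  | nil => simp [polyVal]
  | cons c L ih =>
    have h1 := ih fun c hc => hM c (List.mem_cons_of_mem _ hc)
    have hc := hM c List.mem_cons_self
    simp only [polyVal, List.map_cons, List.sum_cons] at h1 ⊢
    rw [h1]
    have hb' : (b : ℝ) ≠ 0 := by positivity
    push_cast
    rw [add_div]
    congr 1
    obtain ⟨k, rfl⟩ := Nat.exists_eq_add_of_le hc
    rw [Nat.add_sub_cancel_left, div_pow, pow_add]
    field_simp

theorem polyVal_mono (L : List (ℕ × ℕ)) {x y : ℝ} (hx : 0 ≤ x) (h : x ≤ y) :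
    polyVal L x ≤ polyVal L y := by
  unfold polyVal
  refine List.sum_le_sum fun c _ => ?_
  gcongr

theorem CR.poly {f : α → ℝ} {L : α → List (ℕ × ℕ)} (hL : Computable L) (hf : CR f)
    (f0 : ∀ a, 0 < f a) : CR (fun a => polyVal (L a) (f a)) := by
  have hL' : Computable (fun z : α × ((ℕ × ℕ) × ((ℕ × ℕ) × (ℕ × ℕ))) => L z.1) :=
    hL.comp Computable.fst
  have hu : Primrec (fun z : α × ((ℕ × ℕ) × ((ℕ × ℕ) × (ℕ × ℕ))) => z.2.2.1) :=
    Primrec.fst.comp (Primrec.snd.comp Primrec.snd)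
  have hm : Primrec (fun L : List (ℕ × ℕ) => (L.map Prod.snd).sum) :=
    prim_list_sum.comp (Primrec.list_map Primrec.id (Primrec.snd.comp Primrec.snd).to₂)
  have hA : Primrec (fun w : List (ℕ × ℕ) × (ℕ × ℕ) =>
      (w.1.map (fun c => c.1 * (w.2.1 ^ c.2 * (w.2.2 + 1) ^ ((w.1.map Prod.snd).sum - c.2)))).sum) := by
    refine prim_list_sum.comp (Primrec.list_map Primrec.fst ?_)
    have hc : Primrec (fun v : (List (ℕ × ℕ) × (ℕ × ℕ)) × (ℕ × ℕ) => v.2) := Primrec.snd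
    have hw : Primrec (fun v : (List (ℕ × ℕ) × (ℕ × ℕ)) × (ℕ × ℕ) => v.1.2) :=
      Primrec.snd.comp Primrec.fst
    exact Primrec.nat_mul.comp (Primrec.fst.comp hc)
      (Primrec.nat_mul.comp (prim_pow.comp (Primrec.fst.comp hw) (Primrec.snd.comp hc))
        (prim_pow.comp (Primrec.succ.comp (Primrec.snd.comp hw))
          (Primrec.nat_sub.comp (hm.comp (Primrec.fst.comp Primrec.fst)) (Primrec.snd.comp hc))))
  have hB : Primrec (fun w : List (ℕ × ℕ) × (ℕ × ℕ) => (w.2.2 + 1) ^ (w.1.map Prod.snd).sum) :=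
    prim_pow.comp (Primrec.succ.comp (Primrec.snd.comp Primrec.snd)) (hm.comp Primrec.fst)
  have key := sig_frac (F := fun z : α × ((ℕ × ℕ) × ((ℕ × ℕ) × (ℕ × ℕ))) =>
    polyVal (L z.1) (fr z.2.2.1)) (hA.to_comp.comp (hL'.pair hu.to_comp))
    (hB.to_comp.comp (hL'.pair hu.to_comp)) (q := fun z => z.2.1)
    (Computable.fst.comp Computable.snd) (fun z => by positivity) (fun z => by
      unfold fr
      have := polyVal_frac (L z.1) ((L z.1).map Prod.snd).sum z.2.2.1.1 (z.2.2.1.2 + 1)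
        (Nat.succ_pos _) (fun c hc => List.single_le_sum (by simp) _
          (List.mem_map_of_mem (f := Prod.snd) hc))
      push_cast at this ⊢
      exact this)
  refine CR.map₂ (op := fun a x _ => polyVal (L a) x) hf hf f0 f0
    (fun a x y x' y' h0 h1 h3 h2 => polyVal_mono _ h0 h1) (fun a => ?_) key.1 key.2
  unfold polyVal
  induction L a with
  | nil => simp; exact continuous_const
  | cons c l ih =>
    simp only [List.map_cons, List.sum_cons]
    exact (by fun_prop : Continuous (fun p : ℝ × ℝ => (c.1 : ℝ) * p.1 ^ c.2)).add ih

end CRAlgebra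

section Stages

/-- Computable finite stages of the domain of a computer. -/
structure IsStage (V : Computer) (st : ℕ → List (List Bool × List Bool)) : Prop where
  comp : Computable st
  nodup : ∀ k, ((st k).map Prod.fst).Nodup
  sound : ∀ k x, x ∈ st k → x.2 ∈ V.f x.1
  exhaust : ∀ p ∈ V.f.Dom, ∃ k0, ∀ k, k0 ≤ k → p ∈ (st k).map Prod.fst

theorem exists_stage (V : Computer) : ∃ st, IsStage V st := by
  obtain ⟨c, hc⟩ := Nat.Partrec.Code.exists_code.1 V.partrec
  have hev : ∀ (p s : List Bool), Encodable.encode s ∈ c.eval (Encodable.encode p) ↔ s ∈ V.f p := by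
    intro p s
    rw [hc]
    simp
  let g : ℕ → ℕ → Option (List Bool × List Bool) := fun k n =>
    (Encodable.decode₂ (List Bool) n).bind fun p =>
      (Nat.Partrec.Code.evaln k c n).bind fun m =>
        (Encodable.decode (α := List Bool) m).map fun s => (p, s)
  have hg : Primrec₂ g := by
    have hd : Primrec (fun x : ℕ × ℕ => Encodable.decode₂ (List Bool) x.2) :=
      Primrec.decode₂.comp Primrec.snd
    refine Primrec.option_bind hd ?_
    have he : Primrec (fun y : (ℕ × ℕ) × List Bool =>
        Nat.Partrec.Code.evaln y.1.1 c y.1.2) :=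
      Nat.Partrec.Code.primrec_evaln.comp
        (((Primrec.fst.comp Primrec.fst).pair (Primrec.const c)).pair
          (Primrec.snd.comp Primrec.fst))
    refine Primrec.option_bind he ?_
    refine Primrec.option_map (Primrec.decode.comp Primrec.snd) ?_
    exact ((Primrec.snd.comp (Primrec.fst.comp Primrec.fst)).pair Primrec.snd).to₂
  have hgs : ∀ k n x, g k n = some x →
      Encodable.encode x.1 = n ∧ x.2 ∈ V.f x.1 := by
    intro k n x h
    simp only [g, Option.bind_eq_some_iff, Option.map_eq_some_iff] at h
    obtain ⟨p, hp, m, hm, s, hs, rfl⟩ := h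
    have hp := Encodable.decode₂_eq_some.1 hp
    refine ⟨hp, ?_⟩
    have hm' := Nat.Partrec.Code.evaln_sound hm
    rw [hc] at hm'
    simp only [Part.mem_bind_iff, Part.mem_map_iff] at hm'
    obtain ⟨a, ha, b, hb, rfl⟩ := hm'
    rw [← hp] at ha
    simp only [Encodable.encodek, Option.some.injEq] at hs
    subst hs
    simpa [Part.mem_some_iff.1 (by simpa using ha)] using hb
  refine ⟨fun k => (List.range k).filterMap (g k), ?_, ?_, ?_, ?_⟩
  · exact (Primrec.listFilterMap Primrec.list_range hg).to_comp
  · intro k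
    rw [List.map_filterMap]
    refine List.Nodup.filterMap ?_ List.nodup_range
    intro n n' p hp hp'
    simp only [Option.mem_def, Option.map_eq_some_iff] at hp hp'
    obtain ⟨x, hx, rfl⟩ := hp
    obtain ⟨x', hx', h⟩ := hp'
    have h1 := (hgs _ _ _ hx).1
    have h2 := (hgs _ _ _ hx').1
    rw [h, h1] at h2
    exact h2
  · intro k x hx
    obtain ⟨n, _, hn⟩ := List.mem_filterMap.1 hx
    exact (hgs _ _ _ hn).2
  · intro p hp
    obtain ⟨s, hs⟩ := Part.dom_iff_mem.1 hp
    obtain ⟨k, hk⟩ := Nat.Partrec.Code.evaln_complete.1 ((hev p s).2 hs)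
    refine ⟨max k (Encodable.encode p + 1), fun k' hk' => ?_⟩
    rw [List.mem_map]
    refine ⟨(p, s), List.mem_filterMap.2 ⟨Encodable.encode p, List.mem_range.2 ?_, ?_⟩, rfl⟩
    · exact lt_of_lt_of_le (Nat.lt_succ_self _) ((le_max_right _ _).trans hk')
    · have := Nat.Partrec.Code.evaln_mono ((le_max_left _ _).trans hk') hk
      simp only [Option.mem_def] at this
      simp [g, this]

end Stages

section Strings

/-- Numerical value of a binary string. -/
def bval (l : List Bool) : ℕ := l.foldl (fun a b => 2 * a + (bif b then 1 else 0)) 0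

/-- The `n`-bit binary string of a number. -/
def bitsOf (n N : ℕ) : List Bool := (List.range n).map (fun i => decide (N / 2 ^ (n - 1 - i) % 2 = 1))

theorem bval_append (l : List Bool) (b : Bool) :
    bval (l ++ [b]) = 2 * bval l + (bif b then 1 else 0) := by
  simp [bval]

theorem bitsOf_succ (n N : ℕ) : bitsOf (n + 1) N = bitsOf n (N / 2) ++ [decide (N % 2 = 1)] := by
  unfold bitsOf
  rw [List.range_succ, List.map_append]
  congr 1
  · refine List.map_congr_left fun i hi => ?_
    rw [List.mem_range] at hi
    have : n + 1 - 1 - i = (n - 1 - i) + 1 := by omega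
    rw [this, pow_succ', Nat.div_div_eq_div_mul]
  · simp

theorem bitsOf_length (n N : ℕ) : (bitsOf n N).length = n := by simp [bitsOf]

theorem bitsOf_bval (l : List Bool) : bitsOf l.length (bval l) = l := by
  induction l using List.reverseRecOn with
  | nil => rfl
  | append_singleton l b ih =>
    rw [List.length_append, List.length_singleton, bitsOf_succ, bval_append]
    cases b
    · simp [ih]
    · have : (2 * bval l + 1) / 2 = bval l := by omega
      simp [this, ih]

theorem bval_bitsOf (n N : ℕ) (h : N < 2 ^ n) : bval (bitsOf n N) = N := by
  induction n generalizing N with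
  | zero => simp at h; subst h; rfl
  | succ n ih =>
    rw [bitsOf_succ, bval_append, ih (N / 2) (by rw [pow_succ] at h; omega)]
    rcases Nat.mod_two_eq_zero_or_one N with h2 | h2 <;> simp [h2] <;> omega

theorem prim_bval : Primrec bval := by
  have hs : Primrec₂ (fun (_ : List Bool) (x : ℕ × Bool) => 2 * x.1 + (bif x.2 then 1 else 0)) := by
    refine Primrec.nat_add.comp (Primrec.nat_mul.comp (Primrec.const 2)
      (Primrec.fst.comp Primrec.snd)) ?_
    exact Primrec.cond (Primrec.snd.comp Primrec.snd) (Primrec.const 1) (Primrec.const 0)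
  exact (Primrec.list_foldl Primrec.id (Primrec.const 0) hs).of_eq fun l => rfl

theorem prim_bitsOf : Primrec₂ bitsOf := by
  unfold bitsOf
  refine Primrec.list_map (Primrec.list_range.comp Primrec.fst) ?_
  have h : PrimrecPred (fun z : (ℕ × ℕ) × ℕ => z.1.2 / 2 ^ (z.1.1 - 1 - z.2) % 2 = 1) := by
    refine Primrec.eq.comp (Primrec.nat_mod.comp (Primrec.nat_div.comp
      (Primrec.snd.comp Primrec.fst) (prim_pow.comp (Primrec.const 2) ?_)) (Primrec.const 2))
      (Primrec.const 1)
    exact Primrec.nat_sub.comp (Primrec.nat_sub.comp (Primrec.fst.comp Primrec.fst)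
      (Primrec.const 1)) Primrec.snd
  exact h.decide

theorem firstBits_length (T : ℝ) (n : ℕ) : (firstBits T n).length = n := by simp [firstBits]

theorem bval_firstBits {T : ℝ} (h0 : 0 < T) (h1 : T < 1) (n : ℕ) :
    bval (firstBits T n) = ⌊T * 2 ^ n⌋₊ := by
  have hT : ⌊T⌋ = 0 := Int.floor_eq_zero_iff.2 ⟨h0.le, h1⟩
  induction n with
  | zero => simp [firstBits, bval]; exact (Nat.floor_eq_zero.2 h1).symm
  | succ n ih =>
    have : firstBits T (n + 1) = firstBits T n ++ [bitOf T n] := by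
      simp [firstBits, List.range_succ]
    rw [this, bval_append, ih]
    have hb : bitOf T n = decide (⌊T * 2 ^ (n + 1)⌋₊ % 2 = 1) := by
      unfold bitOf
      rw [hT, Int.cast_zero, sub_zero]
      rw [← Int.natCast_floor_eq_floor (by positivity)]
      congr 1
      exact propext (by norm_cast)
    have hd : ⌊T * 2 ^ n⌋₊ = ⌊T * 2 ^ (n + 1)⌋₊ / 2 := by
      have := Nat.floor_div_natCast (T * 2 ^ (n + 1)) 2
      rw [← this]; congr 1
      push_cast; rw [pow_succ]; ring
    rw [hb, hd]
    rcases Nat.mod_two_eq_zero_or_one ⌊T * 2 ^ (n + 1)⌋₊ with h2 | h2 <;> simp [h2] <;> omega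

theorem firstBits_eq {T : ℝ} (h0 : 0 < T) (h1 : T < 1) (n : ℕ) :
    firstBits T n = bitsOf n ⌊T * 2 ^ n⌋₊ := by
  rw [← bval_firstBits h0 h1]
  conv_lhs => rw [← bitsOf_bval (firstBits T n), firstBits_length]

end Strings

section Machines

theorem complexity_le {C : Computer} {p s : List Bool} (h : s ∈ C.f p) :
    complexity C s ≤ p.length := Nat.sInf_le ⟨p, h, rfl⟩

/-- Optimality transferred to arbitrary prefix-free partial recursive functions. -/
theorem Optimal.machine {V : Computer} (hV : Optimal V) {g : List Bool →. List Bool}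
    (hg : Partrec g) (hpf : PrefixFree g.Dom) :
    ∃ d : ℕ, ∀ p s, s ∈ g p → ∃ q, s ∈ V.f q ∧ q.length ≤ p.length + d := by
  by_cases hne : g.Dom.Nonempty
  · obtain ⟨d, hd⟩ := hV ⟨g, hg, hne, hpf⟩
    refine ⟨d, fun p s hs => ?_⟩
    obtain ⟨q, hq, hl⟩ := hd p (Part.dom_iff_mem.2 ⟨s, hs⟩)
    exact ⟨q, by rw [hq]; exact hs, hl⟩
  · exact ⟨0, fun p s hs => absurd ⟨p, Part.dom_iff_mem.2 ⟨s, hs⟩⟩ hne⟩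

theorem Optimal.post {V U : Computer} (hV : Optimal V) {h : List Bool →. List Bool}
    (hh : Partrec h) :
    ∃ d : ℕ, ∀ p σ s, σ ∈ U.f p → s ∈ h σ → ∃ q, s ∈ V.f q ∧ q.length ≤ p.length + d := by
  have hg : Partrec (fun p => (U.f p).bind h) := U.partrec.bind (hh.comp Computable.snd)
  obtain ⟨d, hd⟩ := hV.machine hg (by
    intro p hp q hq hpq
    exact U.dom_prefixFree p (Part.Dom.of_bind hp) q (Part.Dom.of_bind hq) hpq)
  exact ⟨d, fun p σ s h1 h2 => hd p s (Part.mem_bind h1 h2)⟩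

theorem Optimal.surj {V : Computer} (hV : Optimal V) (s : List Bool) : ∃ p, s ∈ V.f p := by
  obtain ⟨p0, hp0⟩ := V.dom_nonempty
  obtain ⟨σ, hσ⟩ := Part.dom_iff_mem.1 hp0
  obtain ⟨d, hd⟩ := hV.post (U := V) (h := fun _ => Part.some s)
    (Computable.const s)
  obtain ⟨q, hq, _⟩ := hd p0 σ s hσ (Part.mem_some s)
  exact ⟨q, hq⟩

theorem Optimal.exists_complexity {V : Computer} (hV : Optimal V) (s : List Bool) :
    ∃ p, s ∈ V.f p ∧ p.length = complexity V s := by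
  have : {n | ∃ p : List Bool, s ∈ V.f p ∧ p.length = n}.Nonempty := by
    obtain ⟨p, hp⟩ := hV.surj s
    exact ⟨_, p, hp, rfl⟩
  exact Nat.sInf_mem this

theorem Optimal.pos {V : Computer} (hV : Optimal V) {p : List Bool} (hp : p ∈ V.f.Dom) :
    0 < p.length := by
  rcases p with _ | ⟨b, p⟩
  · exfalso
    have h : ∀ q ∈ V.f.Dom, q = [] := fun q hq =>
      (V.dom_prefixFree [] hp q hq List.nil_prefix).symm
    obtain ⟨q1, h1⟩ := hV.surj []
    obtain ⟨q2, h2⟩ := hV.surj [true]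
    have e1 := h q1 (Part.dom_iff_mem.2 ⟨_, h1⟩)
    have e2 := h q2 (Part.dom_iff_mem.2 ⟨_, h2⟩)
    subst e1; subst e2
    exact absurd (Part.mem_unique h1 h2) (by simp)
  · simp

/-- The input format of the compression machine. -/
def encFmt (i j e : ℕ) (w : List Bool) : List Bool :=
  List.replicate i true ++ (false :: (List.replicate j true ++ (false ::
    (List.replicate e true ++ (false :: w)))))

theorem unary_prefix {i i' : ℕ} {u u' : List Bool}
    (h : List.replicate i true ++ (false :: u) <+: List.replicate i' true ++ (false :: u')) :
    i = i' ∧ u <+: u' := by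
  induction i generalizing i' with
  | zero =>
    cases i' with
    | zero => simpa using h
    | succ i' => simp [List.replicate_succ] at h
  | succ i ih =>
    cases i' with
    | zero => simp [List.replicate_succ] at h
    | succ i' =>
      simp only [List.replicate_succ, List.cons_append, List.cons_prefix_cons, true_and] at h
      obtain ⟨h1, h2⟩ := ih h
      exact ⟨by rw [h1], h2⟩

theorem encFmt_prefix {i j e i' j' e' : ℕ} {w w' : List Bool}
    (h : encFmt i j e w <+: encFmt i' j' e' w') : i = i' ∧ j = j' ∧ e = e' ∧ w <+: w' := by
  obtain ⟨h1, h⟩ := unary_prefix h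
  obtain ⟨h2, h⟩ := unary_prefix h
  obtain ⟨h3, h⟩ := unary_prefix h
  exact ⟨h1, h2, h3, h⟩

theorem prim_replicate (b : Bool) : Primrec (fun n : ℕ => List.replicate n b) := by
  have : Primrec (fun n : ℕ => (List.range n).map (fun _ => b)) :=
    Primrec.list_map Primrec.list_range (Primrec.const b).to₂
  exact this.of_eq fun n => by simp

theorem prim_encFmt : Primrec (fun z : (ℕ × ℕ × ℕ) × List Bool => encFmt z.1.1 z.1.2.1 z.1.2.2 z.2) := by
  unfold encFmt
  have r := prim_replicate true
  have hi : Primrec (fun z : (ℕ × ℕ × ℕ) × List Bool => z.1.1) := Primrec.fst.comp Primrec.fst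
  have hj : Primrec (fun z : (ℕ × ℕ × ℕ) × List Bool => z.1.2.1) :=
    Primrec.fst.comp (Primrec.snd.comp Primrec.fst)
  have he : Primrec (fun z : (ℕ × ℕ × ℕ) × List Bool => z.1.2.2) :=
    Primrec.snd.comp (Primrec.snd.comp Primrec.fst)
  refine Primrec.list_append.comp (r.comp hi) (Primrec.list_cons.comp (Primrec.const _) ?_)
  refine Primrec.list_append.comp (r.comp hj) (Primrec.list_cons.comp (Primrec.const _) ?_)
  refine Primrec.list_append.comp (r.comp he) (Primrec.list_cons.comp (Primrec.const _) Primrec.snd)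

/-- The generic compression lemma. -/
theorem compress {U : Computer} (hU : Optimal U) {T : ℝ} (h0 : 0 < T) (h1 : T < 1)
    {m : ℕ → ℕ} (hm : Computable m) (C : ℕ) {R : (ℕ × ℕ) × ℕ → Prop} (hR : Sig R) :
    ∃ c : ℕ, ∀ n, (∃ x, x < 2 ^ m n ∧ (∃ J, R ((x, n), J)) ∧
        ∀ J, R ((x, n), J) → ⌊T * 2 ^ n⌋₊ ≤ J + C ∧ J ≤ ⌊T * 2 ^ n⌋₊ + C) →
      complexity U (firstBits T n) ≤ m n + 2 * n.sqrt + c := by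
  let nn : ℕ × ℕ × ℕ → ℕ := fun t => Nat.pair t.1 t.2.1
  have hnn : Computable nn :=
    (Primrec₂.natPair.comp Primrec.fst (Primrec.fst.comp Primrec.snd)).to_comp
  let Z := List Bool × ((ℕ × ℕ × ℕ) × ℕ)
  have ht : Computable (fun z : Z => z.2.1) := Computable.fst.comp Computable.snd
  have hx : Computable (fun z : Z => z.2.2) := Computable.snd.comp Computable.snd
  have hn : Computable (fun z : Z => nn z.2.1) := hnn.comp ht
  have hw : Computable (fun z : Z => bitsOf (m (nn z.2.1)) z.2.2) :=
    prim_bitsOf.to_comp.comp (hm.comp hn) hx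
  have he : Computable (fun z : Z => encFmt z.2.1.1 z.2.1.2.1 z.2.1.2.2
      (bitsOf (m (nn z.2.1)) z.2.2)) := prim_encFmt.to_comp.comp (ht.pair hw)
  have heq : Sig (fun x : List Bool × List Bool => x.1 = x.2) := Sig.of_prim Primrec.eq
  have hlt : Sig (fun x : ℕ × ℕ => x.1 < x.2) := Sig.of_prim Primrec.nat_lt
  have hS := (heq.comp (Computable.fst.pair he)).and
    (hlt.comp (hx.pair (prim_pow.to_comp.comp (Computable.const 2) (hm.comp hn))))
  obtain ⟨f, hf, hf1, hf2⟩ := Sig.select hS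
  obtain ⟨r, hr, hr1, hr2⟩ := Sig.select hR
  have hg : Partrec (fun p => (f p).bind (fun y : (ℕ × ℕ × ℕ) × ℕ =>
      (r (y.2, nn y.1)).map (fun J => bitsOf (nn y.1) (J + y.1.2.2 - C)))) := by
    refine hf.bind ?_
    refine Partrec.map (hr.comp (hx.pair hn)) ?_
    have hy1 : Computable (fun z : Z => z.2.1.2.2) :=
      Computable.snd.comp (Computable.snd.comp ht)
    exact prim_bitsOf.to_comp.comp (hn.comp Computable.fst) (Primrec.nat_sub.to_comp.comp
      (Primrec.nat_add.to_comp.comp Computable.snd (hy1.comp Computable.fst)) (Computable.const C))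
  obtain ⟨d, hd⟩ := hU.machine hg (by
    intro p hp q hq hpq
    obtain ⟨sp, hsp⟩ := Part.dom_iff_mem.1 hp
    obtain ⟨y, hy, _⟩ := Part.mem_bind_iff.1 hsp
    obtain ⟨sq, hsq⟩ := Part.dom_iff_mem.1 hq
    obtain ⟨z, hz, _⟩ := Part.mem_bind_iff.1 hsq
    obtain ⟨hy1, _⟩ := hf1 _ _ hy
    obtain ⟨hz1, _⟩ := hf1 _ _ hz
    simp only at hy1 hz1
    rw [hy1, hz1] at hpq ⊢
    obtain ⟨e1, e2, e3, e4⟩ := encFmt_prefix hpq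
    have e5 : nn y.1 = nn z.1 := by simp only [nn, e1, e2]
    rw [e1, e2, e3]
    congr 1
    refine e4.eq_of_length ?_
    rw [bitsOf_length, bitsOf_length, e5])
  refine ⟨2 * C + 3 + d, fun n ⟨x, hx, hRJ, hJ⟩ => ?_⟩
  let t : ℕ → ℕ × ℕ × ℕ := fun e => (n.unpair.1, n.unpair.2, e)
  have hnt : ∀ e, nn (t e) = n := fun e => by simp [nn, t]
  let P : ℕ → List Bool := fun e => encFmt n.unpair.1 n.unpair.2 e (bitsOf (m n) x)
  have hdom : ∀ e, ((t e, x) : (ℕ × ℕ × ℕ) × ℕ) ∈ f (P e) := by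
    intro e
    have : (f (P e)).Dom := by
      refine hf2 _ ⟨(t e, x), ?_, ?_⟩
      · show P e = encFmt _ _ _ (bitsOf (m (nn (t e))) x)
        rw [hnt]
      · show x < 2 ^ m (nn (t e))
        rwa [hnt]
    obtain ⟨y, hy⟩ := Part.dom_iff_mem.1 this
    obtain ⟨q1, q2⟩ := hf1 _ _ hy
    obtain ⟨⟨i, j, e'⟩, x'⟩ := y
    simp only at q1 q2
    have hpre : encFmt n.unpair.1 n.unpair.2 e (bitsOf (m n) x) <+:
        encFmt i j e' (bitsOf (m (nn (i, j, e'))) x') := by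
      show P e <+: _
      rw [q1]
    obtain ⟨e1, e2, e3, e4⟩ := encFmt_prefix hpre
    subst e1; subst e2; subst e3
    have e5 : nn (n.unpair.1, n.unpair.2, e) = n := hnt e
    rw [e5] at q2 e4
    have e6 := e4.eq_of_length (by rw [bitsOf_length, bitsOf_length])
    have e7 : x = x' := by rw [← bval_bitsOf _ _ hx, e6, bval_bitsOf _ _ q2]
    subst e7
    exact hy
  obtain ⟨J, hJm⟩ := Part.dom_iff_mem.1 (hr2 _ hRJ)
  obtain ⟨b1, b2⟩ := hJ J (hr1 _ _ hJm)
  have hex : ∃ e, e ≤ 2 * C ∧ firstBits T n ∈ (f (P e)).bind (fun y : (ℕ × ℕ × ℕ) × ℕ =>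
      (r (y.2, nn y.1)).map (fun J => bitsOf (nn y.1) (J + y.1.2.2 - C))) := by
    refine ⟨⌊T * 2 ^ n⌋₊ + C - J, by omega, Part.mem_bind (hdom _) ?_⟩
    rw [Part.mem_map_iff]
    refine ⟨J, by rw [hnt]; exact hJm, ?_⟩
    rw [hnt, firstBits_eq h0 h1]
    congr 1
    show J + (⌊T * 2 ^ n⌋₊ + C - J) - C = _
    omega
  obtain ⟨e, he, hmem⟩ := hex
  obtain ⟨q, hq, hl⟩ := hd (P e) _ hmem
  refine (complexity_le hq).trans (hl.trans ?_)
  have hlen : (P e).length = n.unpair.1 + n.unpair.2 + e + 3 + m n := by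
    simp only [P, encFmt, List.length_append, List.length_replicate, List.length_cons, bitsOf_length]
    omega
  have hsq : max n.unpair.1 n.unpair.2 ≤ n.sqrt := by
    rw [Nat.le_sqrt']
    have := Nat.max_sq_add_min_le_pair n.unpair.1 n.unpair.2
    rw [Nat.pair_unpair] at this
    omega
  have := le_max_left n.unpair.1 n.unpair.2
  have := le_max_right n.unpair.1 n.unpair.2
  omega

end Machines

section Kraft

theorem uniquelyDecodable_of_prefixFree {S : Set (List Bool)} (h : PrefixFree S) (h0 : [] ∉ S) :
    InformationTheory.UniquelyDecodable S := by
  intro L₁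
  induction L₁ with
  | nil =>
    intro L₂ _ h2 he
    cases L₂ with
    | nil => rfl
    | cons w L =>
      exfalso
      have : w = [] := by
        have := he.symm
        simp only [List.flatten_cons, List.flatten_nil, List.append_eq_nil_iff] at this
        exact this.1
      exact h0 (this ▸ h2 w List.mem_cons_self)
  | cons v L₁ ih =>
    intro L₂ h1 h2 he
    cases L₂ with
    | nil =>
      exfalso
      have : v = [] := by
        simp only [List.flatten_cons, List.flatten_nil, List.append_eq_nil_iff] at he
        exact he.1
      exact h0 (this ▸ h1 v List.mem_cons_self)
    | cons w L₂ =>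
      have hv := h1 v List.mem_cons_self
      have hw := h2 w List.mem_cons_self
      simp only [List.flatten_cons] at he
      have hvw : v = w := by
        rcases List.append_eq_append_iff.1 he with ⟨a, ha, _⟩ | ⟨a, ha, _⟩
        · exact h v hv w hw ⟨a, ha.symm⟩
        · exact (h w hw v hv ⟨a, ha.symm⟩).symm
      subst hvw
      rw [ih L₂ (fun w hw => h1 w (List.mem_cons_of_mem _ hw))
        (fun w hw => h2 w (List.mem_cons_of_mem _ hw)) (List.append_cancel_left he)]

theorem kraft_finset {V : Computer} (hV : Optimal V) (K : Finset V.f.Dom) :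
    ∑ p ∈ K, (1 / 2 : ℝ) ^ p.1.length ≤ 1 := by
  classical
  have hS : InformationTheory.UniquelyDecodable ((K.image Subtype.val : Finset (List Bool)) : Set (List Bool)) := by
    refine uniquelyDecodable_of_prefixFree ?_ ?_
    · intro p hp q hq hpq
      simp only [Finset.coe_image, Set.mem_image] at hp hq
      obtain ⟨p, _, rfl⟩ := hp
      obtain ⟨q, _, rfl⟩ := hq
      exact V.dom_prefixFree _ p.2 _ q.2 hpq
    · intro h
      simp only [Finset.coe_image, Set.mem_image] at h
      obtain ⟨p, _, h⟩ := h
      have := hV.pos p.2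
      rw [h] at this
      simp at this
  have := InformationTheory.kraft_mcmillan_inequality hS
  rw [Finset.sum_image (fun a _ b _ h => Subtype.ext h)] at this
  simpa using this

theorem kraft_summable {V : Computer} (hV : Optimal V) :
    Summable (fun p : V.f.Dom => (1 / 2 : ℝ) ^ p.1.length) :=
  summable_of_sum_le (fun p => by positivity) (kraft_finset hV)

theorem kraft_tsum {V : Computer} (hV : Optimal V) :
    ∑' p : V.f.Dom, (1 / 2 : ℝ) ^ p.1.length ≤ 1 :=
  (kraft_summable hV).tsum_le_of_sum_le (kraft_finset hV)

theorem pow_exp_bdd (j : ℕ) {η : ℝ} (hη : 0 < η) :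
    ∃ B : ℝ, 0 < B ∧ ∀ l : ℕ, (l : ℝ) ^ j * (2 : ℝ) ^ (-(l : ℝ) * η) ≤ B := by
  have hr : |(2 : ℝ) ^ (-η)| < 1 := by
    rw [abs_of_pos (by positivity)]
    exact Real.rpow_lt_one_of_one_lt_of_neg (by norm_num) (by linarith)
  obtain ⟨B, hB⟩ := (tendsto_pow_const_mul_const_pow_of_abs_lt_one j hr).bddAbove_range
  refine ⟨max B 1, by positivity, fun l => ?_⟩
  have := hB ⟨l, rfl⟩
  refine le_trans (le_of_eq ?_) (this.trans (le_max_left _ _))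
  show _ = (l : ℝ) ^ j * ((2 : ℝ) ^ (-η)) ^ l
  rw [← Real.rpow_natCast (2 ^ (-η)), ← Real.rpow_mul (by norm_num)]
  congr 2; ring

theorem half_pow_eq (l : ℕ) : (1 / 2 : ℝ) ^ l = (2 : ℝ) ^ (-(l : ℝ)) := by
  rw [Real.rpow_neg (by norm_num), Real.rpow_natCast]; simp

theorem summable_pow_exp {ι : Type} {l : ι → ℕ} (hl : Summable (fun i => (1 / 2 : ℝ) ^ l i))
    (j : ℕ) {t : ℝ} (h0 : 0 < t) (h1 : t < 1) :
    Summable (fun i => (l i : ℝ) ^ j * (2 : ℝ) ^ (-(l i : ℝ) / t)) := by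
  have hη : 0 < 1 / t - 1 := by
    rw [sub_pos, lt_div_iff₀ h0]; linarith
  obtain ⟨B, hB0, hB⟩ := pow_exp_bdd j hη
  refine Summable.of_nonneg_of_le (fun i => by positivity) (fun i => ?_) (hl.mul_left B)
  have : (2 : ℝ) ^ (-(l i : ℝ) / t) = (2 : ℝ) ^ (-(l i : ℝ) * (1 / t - 1)) * (1 / 2 : ℝ) ^ l i := by
    rw [half_pow_eq, ← Real.rpow_add (by norm_num)]; congr 1; ring
  rw [this, ← mul_assoc]
  exact mul_le_mul_of_nonneg_right (hB _) (by positivity)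

open Classical in
/-- The stage as a finset of the domain. -/
noncomputable def Kst (V : Computer) (st : ℕ → List (List Bool × List Bool)) (k : ℕ) :
    Finset V.f.Dom := ((st k).map Prod.fst).toFinset.subtype (· ∈ V.f.Dom)

theorem mem_Kst {V : Computer} {st : ℕ → List (List Bool × List Bool)} {k : ℕ} {p : V.f.Dom} :
    p ∈ Kst V st k ↔ p.1 ∈ (st k).map Prod.fst := by
  simp [Kst]

theorem Kst_sum {V : Computer} {st : ℕ → List (List Bool × List Bool)} (hst : IsStage V st) (k : ℕ)
    (g : List Bool → ℝ) : ∑ p ∈ Kst V st k, g p.1 = ((st k).map (fun x => g x.1)).sum := by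
  classical
  have h1 : ∑ p ∈ Kst V st k, g p.1 = ∑ p ∈ ((st k).map Prod.fst).toFinset, g p := by
    unfold Kst
    rw [Finset.sum_subtype_eq_sum_filter, Finset.filter_true_of_mem]
    intro p hp
    rw [List.mem_toFinset, List.mem_map] at hp
    obtain ⟨x, hx, rfl⟩ := hp
    exact Part.dom_iff_mem.2 ⟨_, hst.sound k x hx⟩
  rw [h1, List.sum_toFinset _ (hst.nodup k), List.map_map]
  rfl

theorem Kst_exhaust {V : Computer} {st : ℕ → List (List Bool × List Bool)} (hst : IsStage V st)
    (A : Finset V.f.Dom) : ∃ k0, ∀ k, k0 ≤ k → A ⊆ Kst V st k := by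
  classical
  induction A using Finset.induction_on with
  | empty => exact ⟨0, fun k _ => by simp⟩
  | insert p A _ ih =>
    obtain ⟨k1, h1⟩ := ih
    obtain ⟨k2, h2⟩ := hst.exhaust p.1 p.2
    refine ⟨max k1 k2, fun k hk => ?_⟩
    rw [Finset.insert_subset_iff]
    exact ⟨mem_Kst.2 (h2 k ((le_max_right _ _).trans hk)), h1 k ((le_max_left _ _).trans hk)⟩

theorem exists_stage_containing (V : Computer) (A : Finset V.f.Dom) :
    ∃ st, IsStage V st ∧ ∀ k, A ⊆ Kst V st k := by
  obtain ⟨st, hst⟩ := exists_stage V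
  obtain ⟨k0, hk0⟩ := Kst_exhaust hst A
  refine ⟨fun k => st (k0 + k), ⟨?_, ?_, ?_, ?_⟩, ?_⟩
  · exact hst.comp.comp (Primrec.nat_add.comp (Primrec.const k0) Primrec.id).to_comp
  · exact fun k => hst.nodup _
  · exact fun k => hst.sound _
  · intro p hp
    obtain ⟨k1, h1⟩ := hst.exhaust p hp
    exact ⟨k1, fun k hk => h1 _ (by omega)⟩
  · intro k p hp
    exact mem_Kst.2 (mem_Kst.1 (hk0 (k0 + k) (by omega) hp))

/-- The test rationals. -/
noncomputable def rr (u : ℕ × ℕ) : ℝ := ((u.1 : ℝ) + 1) / 2 ^ u.2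

theorem rr_pos (u : ℕ × ℕ) : 0 < rr u := by unfold rr; positivity

theorem CR_rr : CR rr := by
  refine CR.frac (A := fun u => u.1 + 1) (B := fun u => 2 ^ u.2)
    (Primrec.succ.comp (Primrec.fst : Primrec (fun u : ℕ × ℕ => u.1))).to_comp
    (prim_pow.comp (Primrec.const 2) Primrec.snd).to_comp (fun u => by positivity) (fun u => ?_)
  unfold rr
  push_cast; rfl

end Kraft

section Criteria

/-- The analytic and computability data of a fixed point criterion. -/
structure Crit (V : Computer) (T : ℝ) (st : ℕ → List (List Bool × List Bool))
    (Pp Nn : ℕ → ℝ → Prop) (w : ℕ → ℝ) (t1 t2 C : ℝ) : Prop where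
  stage : IsStage V st
  sigP : Sig (fun x : ℕ × (ℕ × ℕ) => Pp x.1 (rr x.2))
  sigN : Sig (fun x : ℕ × (ℕ × ℕ) => Nn x.1 (rr x.2))
  t1pos : 0 < t1
  t1T : t1 < T
  Tt2 : T < t2
  t2one : t2 < 1
  Cpos : 0 < C
  p1 : ∀ k t, t1 ≤ t → t ≤ T → ¬ Pp k t
  n1 : ∀ k t, t1 ≤ t → t < T → Nn k t
  pn : ∀ k t, Pp k t → ¬ Nn k t
  p2 : ∀ k t (p : V.f.Dom), T < t → t ≤ t2 → Pp k t → p ∉ Kst V st k →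
    w p.1.length ≤ C * (t - T)
  p3 : ∀ k t, T < t → t ≤ t2 →
    C * (∑' p : V.f.Dom, (p.1.length : ℝ) * (2 : ℝ) ^ (-(p.1.length : ℝ) / T) -
      ∑ p ∈ Kst V st k, (p.1.length : ℝ) * (2 : ℝ) ^ (-(p.1.length : ℝ) / T)) < t - T → Pp k t

theorem stage_tail {V : Computer} {st : ℕ → List (List Bool × List Bool)} (hst : IsStage V st)
    {g : V.f.Dom → ℝ} (hg : Summable g) {ε : ℝ} (he : 0 < ε) :
    ∃ k0, ∀ k, k0 ≤ k → ∑' p, g p - ∑ p ∈ Kst V st k, g p < ε := by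
  have h := hg.hasSum.eventually (lt_mem_nhds (show ∑' p, g p - ε < ∑' p, g p by linarith))
  obtain ⟨A, hA⟩ := Filter.eventually_atTop.1 h
  obtain ⟨k0, hk0⟩ := Kst_exhaust hst A
  exact ⟨k0, fun k hk => by have := hA _ (hk0 k hk); linarith⟩

theorem summable_len {V : Computer} (hV : Optimal V) {T : ℝ} (h0 : 0 < T) (h1 : T < 1) :
    Summable (fun p : V.f.Dom => (p.1.length : ℝ) * (2 : ℝ) ^ (-(p.1.length : ℝ) / T)) := by
  simpa using summable_pow_exp (kraft_summable hV) 1 h0 h1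

theorem floor_bounds {T : ℝ} (h0 : 0 < T) (n : ℕ) :
    T < ((⌊T * 2 ^ n⌋₊ : ℝ) + 1) / 2 ^ n ∧ (⌊T * 2 ^ n⌋₊ : ℝ) / 2 ^ n ≤ T := by
  constructor
  · rw [lt_div_iff₀ (by positivity)]; exact Nat.lt_floor_add_one _
  · rw [div_le_iff₀ (by positivity)]; exact Nat.floor_le (by positivity)

theorem exists_pow_lt' {ε : ℝ} (he : 0 < ε) : ∃ n0 : ℕ, ∀ n, n0 ≤ n → 1 / 2 ^ n < ε := by
  obtain ⟨n0, h⟩ := exists_pow_lt_of_lt_one he (show (1 / 2 : ℝ) < 1 by norm_num)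
  refine ⟨n0, fun n hn => lt_of_le_of_lt ?_ h⟩
  rw [one_div_pow]
  exact one_div_le_one_div_of_le (by positivity) (pow_le_pow_right₀ (by norm_num) hn)

theorem Crit.random {U V : Computer} (hU : Optimal U) (hV : Optimal V) {T : ℝ}
    {st : ℕ → List (List Bool × List Bool)}
    {Pp Nn : ℕ → ℝ → Prop} {w : ℕ → ℝ} {t1 t2 C : ℝ} (h : Crit V T st Pp Nn w t1 t2 C) :
    ∃ c n0 : ℕ, ∀ n, n0 ≤ n → ∃ l : ℕ, w l ≤ C / 2 ^ n ∧
      l ≤ complexity U (firstBits T n) + c := by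
  have T0 := h.t1pos.trans h.t1T
  have T1 := h.Tt2.trans h.t2one
  -- the diagonal output
  let out : ℕ → List Bool := fun k =>
    List.replicate (((st k).map (fun x => x.2.length)).sum + 1) true
  have hout : Computable out := by
    refine (prim_replicate true).to_comp.comp (Computable.succ.comp ?_)
    have : Primrec (fun L : List (List Bool × List Bool) => (L.map (fun x => x.2.length)).sum) :=
      prim_list_sum.comp (Primrec.list_map Primrec.id
        (Primrec.list_length.comp (Primrec.snd.comp Primrec.snd)).to₂)
    exact this.to_comp.comp h.stage.comp
  have hout' : ∀ k x, x ∈ st k → x.2 ≠ out k := by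
    intro k x hx he
    have h1 : x.2.length ≤ ((st k).map (fun x => x.2.length)).sum :=
      List.single_le_sum (by simp) _ (List.mem_map_of_mem (f := fun x => x.2.length) hx)
    rw [he] at h1
    simp only [out, List.length_replicate] at h1
    omega
  have hS : Sig (fun x : List Bool × ℕ => Pp x.2 (rr (bval x.1, x.1.length))) :=
    h.sigP.comp (Computable.snd.pair ((prim_bval.to_comp.comp Computable.fst).pair
      (Primrec.list_length.to_comp.comp Computable.fst)))
  obtain ⟨f, hf, hf1, hf2⟩ := Sig.select hS
  obtain ⟨d, hd⟩ := hV.post (U := U) (h := fun σ => (f σ).map out) (hf.map (hout.comp Computable.snd))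
  obtain ⟨n0, hn0⟩ := exists_pow_lt' (sub_pos.2 h.Tt2)
  refine ⟨d, n0, fun n hn => ?_⟩
  obtain ⟨p, hp, hpl⟩ := hU.exists_complexity (firstBits T n)
  set t := rr (bval (firstBits T n), (firstBits T n).length) with ht
  have ht' : t = ((⌊T * 2 ^ n⌋₊ : ℝ) + 1) / 2 ^ n := by
    rw [ht, bval_firstBits T0 T1, firstBits_length]; rfl
  obtain ⟨b1, b2⟩ := floor_bounds T0 n
  have htT : T < t := by rw [ht']; exact b1
  have htT' : t - T ≤ 1 / 2 ^ n := by rw [ht', add_div]; linarith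
  have ht2 : t ≤ t2 := by have := hn0 n hn; linarith
  have hdom : (f (firstBits T n)).Dom := by
    apply hf2
    obtain ⟨k0, hk0⟩ := stage_tail h.stage (summable_len hV T0 T1)
      (div_pos (sub_pos.2 htT) h.Cpos)
    refine ⟨k0, h.p3 k0 t htT ht2 ?_⟩
    have := hk0 k0 le_rfl
    rwa [lt_div_iff₀ h.Cpos, mul_comm] at this
  obtain ⟨k, hk⟩ := Part.dom_iff_mem.1 hdom
  have hP : Pp k t := hf1 _ _ hk
  obtain ⟨q, hq, hql⟩ := hd p _ (out k) hp (Part.mem_map out hk)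
  refine ⟨q.length, ?_, by rw [← hpl]; exact hql⟩
  have hqd : q ∈ V.f.Dom := Part.dom_iff_mem.2 ⟨_, hq⟩
  have := h.p2 k t ⟨q, hqd⟩ htT ht2 hP (by
    rw [mem_Kst]
    intro hm
    obtain ⟨x, hx, hxq⟩ := List.mem_map.1 hm
    have h1 := h.stage.sound k x hx
    rw [hxq] at h1
    exact hout' k x hx (Part.mem_unique h1 hq))
  refine this.trans ?_
  rw [div_eq_mul_one_div]
  exact mul_le_mul_of_nonneg_left htT' h.Cpos.le

/-- If `T` is pinned down by two semidecidable one-sided tests then it has low complexity. -/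
theorem lowComplexity {U : Computer} (hU : Optimal U) {T : ℝ} (h0 : 0 < T) (h1 : T < 1)
    {P N : ℝ → Prop} (hP : Sig (fun u => P (rr u))) (hN : Sig (fun u => N (rr u)))
    (hP' : ∀ t, 0 < t → (P t ↔ T < t)) (hN' : ∀ t, 0 < t → (N t ↔ t < T)) :
    ∃ c n0 : ℕ, ∀ n, n0 ≤ n → complexity U (firstBits T n) ≤ 2 * n.sqrt + c := by
  have hJ : Computable (fun z : (ℕ × ℕ) × ℕ => z.2) := Computable.snd
  have hn : Computable (fun z : (ℕ × ℕ) × ℕ => z.1.2) := Computable.snd.comp Computable.fst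
  have hJ3 : Computable (fun z : (ℕ × ℕ) × ℕ => z.2 + 3) :=
    (Primrec.nat_add.comp Primrec.snd (Primrec.const 3)).to_comp
  have hR : Sig (fun z : (ℕ × ℕ) × ℕ => N (rr (z.2, z.1.2)) ∧ P (rr (z.2 + 3, z.1.2))) :=
    (hN.comp (hJ.pair hn)).and (hP.comp (hJ3.pair hn))
  obtain ⟨c, hc⟩ := compress hU h0 h1 (m := fun _ => 0) (Computable.const 0) 4 hR
  obtain ⟨n0, hn0⟩ := exists_pow_lt' (show 0 < T / 2 by positivity)
  refine ⟨c, n0, fun n hn => ?_⟩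
  have h2 : 2 ≤ ⌊T * 2 ^ n⌋₊ := by
    refine Nat.le_floor ?_
    have := hn0 n hn
    rw [div_lt_iff₀ (by positivity)] at this
    push_cast; linarith
  obtain ⟨b1, b2⟩ := floor_bounds h0 n
  rw [lt_div_iff₀ (by positivity)] at b1
  rw [div_le_iff₀ (by positivity)] at b2
  have := hc n ⟨0, by simp, ⟨⌊T * 2 ^ n⌋₊ - 2, ?_, ?_⟩, ?_⟩
  · simpa using this
  · rw [hN' _ (rr_pos _)]
    unfold rr
    rw [div_lt_iff₀ (by positivity)]
    simp only
    rw [Nat.cast_sub h2]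
    push_cast; linarith
  · rw [hP' _ (rr_pos _)]
    unfold rr
    rw [lt_div_iff₀ (by positivity)]
    simp only
    rw [Nat.cast_add, Nat.cast_sub h2]
    push_cast; linarith
  · rintro J ⟨j1, j2⟩
    rw [hN' _ (rr_pos _)] at j1
    rw [hP' _ (rr_pos _)] at j2
    unfold rr at j1 j2
    rw [div_lt_iff₀ (by positivity)] at j1
    rw [lt_div_iff₀ (by positivity)] at j2
    simp only at j1 j2
    push_cast at j2
    have k1 : (J : ℝ) < ⌊T * 2 ^ n⌋₊ := by linarith
    have k2 : (⌊T * 2 ^ n⌋₊ : ℝ) < J + 4 := by linarith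
    have k1' : J < ⌊T * 2 ^ n⌋₊ := by exact_mod_cast k1
    have k2' : ⌊T * 2 ^ n⌋₊ < J + 4 := by exact_mod_cast k2
    omega

theorem sqrt_small {ε : ℝ} (he : 0 < ε) (c : ℝ) :
    ∃ n0 : ℕ, ∀ n : ℕ, n0 ≤ n → 2 * (n.sqrt : ℝ) + c < ε * n := by
  have h : Tendsto (fun n : ℕ => (n : ℝ) ^ (1 / 2 : ℝ)) atTop atTop :=
    (tendsto_rpow_atTop (by norm_num)).comp tendsto_natCast_atTop_atTop
  have h1 := h.eventually_ge_atTop (4 / ε)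
  have h2 := (tendsto_natCast_atTop_atTop (R := ℝ)).eventually_gt_atTop (2 * c / ε)
  obtain ⟨n0, hn0⟩ := Filter.eventually_atTop.1 (h1.and h2)
  refine ⟨n0, fun n hn => ?_⟩
  obtain ⟨h1, h2⟩ := hn0 n hn
  rw [div_le_iff₀ he] at h1
  rw [div_lt_iff₀ he] at h2
  rw [← Real.sqrt_eq_rpow] at h1
  have h3 : (n.sqrt : ℝ) ≤ √(n : ℝ) := Real.nat_sqrt_le_real_sqrt
  have h4 : √(n : ℝ) * √(n : ℝ) = n := Real.mul_self_sqrt (by positivity)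
  have h5 : 0 ≤ √(n : ℝ) := Real.sqrt_nonneg _
  nlinarith

theorem not_weakRandom {U : Computer} (hU : Optimal U) {T : ℝ} (h0 : 0 < T) (h1 : T < 1)
    {P N : ℝ → Prop} (hP : Sig (fun u => P (rr u))) (hN : Sig (fun u => N (rr u)))
    (hP' : ∀ t, 0 < t → (P t ↔ T < t)) (hN' : ∀ t, 0 < t → (N t ↔ t < T)) :
    ¬ WeaklyChaitinTRandom U T T := by
  rintro ⟨c', hc'⟩
  obtain ⟨c, n0, hc⟩ := lowComplexity hU h0 h1 hP hN hP' hN'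
  obtain ⟨n1, hn1⟩ := sqrt_small h0 (c + c')
  have e1 := hc (max n0 n1 + 1) (by omega)
  have e2 := hn1 (max n0 n1 + 1) (by omega)
  have e3 := hc' (max n0 n1 + 1) (by omega)
  have e1' : (complexity U (firstBits T (max n0 n1 + 1)) : ℝ) ≤
      2 * ((max n0 n1 + 1).sqrt : ℝ) + c := by exact_mod_cast e1
  linarith

end Criteria

section Compressibility

theorem CR_Z1 {V : Computer} {st : ℕ → List (List Bool × List Bool)} (hst : IsStage V st) :
    CR (fun k => ∑ p ∈ Kst V st k, (1 / 2 : ℝ) ^ p.1.length) := by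
  have hL : Computable (fun k => (st k).map (fun x => ((1 : ℕ), x.1.length))) := by
    have : Primrec (fun L : List (List Bool × List Bool) =>
        L.map (fun x => ((1 : ℕ), x.1.length))) :=
      Primrec.list_map Primrec.id ((Primrec.const 1).pair
        (Primrec.list_length.comp (Primrec.fst.comp Primrec.snd))).to₂
    exact this.to_comp.comp hst.comp
  have hh : CR (fun _ : ℕ => (1 / 2 : ℝ)) :=
    CR.frac (A := fun _ => 1) (B := fun _ => 2) (Computable.const _) (Computable.const _)
      (fun _ => two_pos) (fun _ => by simp)
  refine (CR.poly hL hh (fun _ => by norm_num)).of_eq fun k => ?_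
  rw [Kst_sum hst k (fun p => (1 / 2 : ℝ) ^ p.length), polyVal, List.map_map]
  congr 1
  refine List.map_congr_left fun x _ => ?_
  simp

theorem tail_bound {ι : Type} {l : ι → ℕ} (hl : Summable (fun i => (1 / 2 : ℝ) ^ l i))
    {T T' : ℝ} (h0 : 0 < T) (h1 : T < T') (h2 : T' < 1) :
    ∃ B : ℝ, 0 < B ∧ ∀ (K : Finset ι) (m n : ℕ), T' * n ≤ m →
      ∑' i, (1 / 2 : ℝ) ^ l i - ∑ i ∈ K, (1 / 2 : ℝ) ^ l i < (1 / 2) ^ m →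
      ∑' i, (l i : ℝ) * (2 : ℝ) ^ (-(l i : ℝ) / T) - ∑ i ∈ K, (l i : ℝ) * (2 : ℝ) ^ (-(l i : ℝ) / T)
        ≤ B / 2 ^ n := by
  have hT' : 0 < T' := h0.trans h1
  have hη : 0 < 1 / T - 1 / T' := by
    rw [sub_pos]; exact one_div_lt_one_div_of_lt h0 h1
  have hθ : 0 < 1 / T' - 1 := by rw [sub_pos, lt_div_iff₀ hT']; linarith
  obtain ⟨B, hB0, hB⟩ := pow_exp_bdd 1 hη
  refine ⟨B, hB0, fun K m n hmn ht => ?_⟩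
  have hs2 : Summable (fun i => (l i : ℝ) * (2 : ℝ) ^ (-(l i : ℝ) / T)) := by
    simpa using summable_pow_exp hl 1 h0 (h1.trans h2)
  have e1 := hl.sum_add_tsum_compl (s := K)
  have e2 := hs2.sum_add_tsum_compl (s := K)
  have hlc : Summable (fun i : ((K : Set ι)ᶜ : Set ι) => (1 / 2 : ℝ) ^ l i) :=
    hl.subtype _
  have hsc : Summable (fun i : ((K : Set ι)ᶜ : Set ι) => (l i : ℝ) * (2 : ℝ) ^ (-(l i : ℝ) / T)) :=
    hs2.subtype _
  have ht' : ∑' i : ((K : Set ι)ᶜ : Set ι), (1 / 2 : ℝ) ^ l i < (1 / 2) ^ m := by linarith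
  have hlm : ∀ i : ((K : Set ι)ᶜ : Set ι), m ≤ l i := by
    intro i
    have h := (hlc.le_tsum i (fun j _ => by positivity)).trans_lt ht'
    by_contra hc
    push Not at hc
    exact absurd h (not_lt.2 (pow_le_pow_of_le_one (by norm_num) (by norm_num) hc.le))
  have hterm : ∀ i : ((K : Set ι)ᶜ : Set ι), (l i : ℝ) * (2 : ℝ) ^ (-(l i : ℝ) / T) ≤
      (B * (2 : ℝ) ^ (-(m : ℝ) * (1 / T' - 1))) * (1 / 2 : ℝ) ^ l i := by
    intro i
    have e : (2 : ℝ) ^ (-(l i : ℝ) / T) = (2 : ℝ) ^ (-(l i : ℝ) * (1 / T - 1 / T')) *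
        (2 : ℝ) ^ (-(l i : ℝ) * (1 / T' - 1)) * (1 / 2 : ℝ) ^ l i := by
      rw [half_pow_eq, ← Real.rpow_add (by norm_num), ← Real.rpow_add (by norm_num)]
      congr 1; ring
    rw [e, ← mul_assoc, ← mul_assoc]
    refine mul_le_mul_of_nonneg_right ?_ (by positivity)
    have hBi := hB (l i)
    rw [pow_one] at hBi
    refine mul_le_mul hBi ?_ (by positivity) hB0.le
    refine Real.rpow_le_rpow_of_exponent_le (by norm_num) ?_
    have : (m : ℝ) ≤ l i := by exact_mod_cast hlm i
    nlinarith
  have h3 := hsc.tsum_le_tsum hterm (hlc.mul_left _)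
  rw [tsum_mul_left] at h3
  have h4 : (B * (2 : ℝ) ^ (-(m : ℝ) * (1 / T' - 1))) *
      ∑' i : ((K : Set ι)ᶜ : Set ι), (1 / 2 : ℝ) ^ l i ≤ B / 2 ^ n := by
    refine (mul_le_mul_of_nonneg_left ht'.le (by positivity)).trans ?_
    rw [half_pow_eq, mul_assoc, ← Real.rpow_add (by norm_num), div_eq_mul_inv]
    refine mul_le_mul_of_nonneg_left ?_ hB0.le
    rw [← Real.rpow_natCast, ← Real.rpow_neg (by norm_num)]
    refine Real.rpow_le_rpow_of_exponent_le (by norm_num) ?_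
    have : -(m : ℝ) * (1 * T'⁻¹ - 1) + -(m : ℝ) = -((m : ℝ) / T') := by ring
    rw [this, neg_le_neg_iff, le_div_iff₀ hT', mul_comm]
    exact hmn
  linarith

theorem Crit.compress_rat {U V : Computer} (hU : Optimal U) (hV : Optimal V) {T : ℝ}
    {st : ℕ → List (List Bool × List Bool)}
    {Pp Nn : ℕ → ℝ → Prop} {w : ℕ → ℝ} {t1 t2 C : ℝ} (h : Crit V T st Pp Nn w t1 t2 C)
    {a b : ℕ} (hb : 0 < b) (hT1 : T < (a : ℝ) / b) (hT2 : (a : ℝ) / b < 1) :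
    ∃ c n0 : ℕ, ∀ n, n0 ≤ n →
      complexity U (firstBits T n) ≤ n * a / b + 1 + 2 * n.sqrt + c := by
  have T0 := h.t1pos.trans h.t1T
  have T1 := h.Tt2.trans h.t2one
  obtain ⟨u1, hu1, hu1'⟩ := fr_dense h.t1pos.le h.t1T
  obtain ⟨u2, hu2, hu2'⟩ := fr_dense T0.le h.Tt2
  obtain ⟨B, hB0, hB⟩ := tail_bound (kraft_summable hV) T0 hT1 hT2
  let m : ℕ → ℕ := fun n => n * a / b + 1
  have hm : Computable m :=
    (Primrec.succ.comp (Primrec.nat_div.comp (Primrec.nat_mul.comp Primrec.id (Primrec.const a))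
      (Primrec.const b))).to_comp
  have hmT : ∀ n : ℕ, (a : ℝ) / b * n ≤ m n := by
    intro n
    have h1 : n * a < b * (n * a / b + 1) := Nat.lt_mul_div_succ _ hb
    have h2 : (n : ℝ) * a ≤ b * (m n : ℝ) := by exact_mod_cast h1.le
    rw [div_mul_eq_mul_div, div_le_iff₀ (by exact_mod_cast hb)]
    linarith
  let Z1 : ℕ → ℝ := fun k => ∑ p ∈ Kst V st k, (1 / 2 : ℝ) ^ p.1.length
  have hZ1 : CR Z1 := CR_Z1 h.stage
  -- variables: (((x,n),J),k)
  let W := ((ℕ × ℕ) × ℕ) × ℕ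
  have hx : Computable (fun z : W => z.1.1.1) :=
    Computable.fst.comp (Computable.fst.comp Computable.fst)
  have hn : Computable (fun z : W => z.1.1.2) :=
    Computable.snd.comp (Computable.fst.comp Computable.fst)
  have hJ : Computable (fun z : W => z.1.2) := Computable.snd.comp Computable.fst
  have hk : Computable (fun z : W => z.2) := Computable.snd
  have hJ3 : Computable (fun z : W => z.1.2 + 3) :=
    (Primrec.nat_add.to_comp.comp hJ (Computable.const 3))
  have hxm : CR (fun z : W => (z.1.1.1 : ℝ) / 2 ^ m z.1.1.2) :=
    CR.frac hx (B := fun z : W => 2 ^ m z.1.1.2)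
      (prim_pow.to_comp.comp (Computable.const 2) (hm.comp hn)) (fun z => by positivity)
      (fun z => by push_cast; rfl)
  have s1 : Sig (fun z : W => (z.1.1.1 : ℝ) / 2 ^ m z.1.1.2 < Z1 z.2) :=
    hxm.lt (hZ1.comp hk) (fun z => by positivity)
  have s2 : Sig (fun z : W => Nn z.2 (rr (z.1.2, z.1.1.2))) :=
    h.sigN.comp (hk.pair (hJ.pair hn))
  have s3 : Sig (fun z : W => Pp z.2 (rr (z.1.2 + 3, z.1.1.2))) :=
    h.sigP.comp (hk.pair (hJ3.pair hn))
  have s4 : Sig (fun z : W => fr u1 < rr (z.1.2, z.1.1.2)) :=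
    CR_rr.1.comp ((hJ.pair hn).pair (Computable.const u1))
  have s5 : Sig (fun z : W => rr (z.1.2 + 3, z.1.1.2) < fr u2) :=
    CR_rr.2.comp ((hJ3.pair hn).pair (Computable.const u2))
  have hR := Sig.ex (s1.and (s2.and (s3.and (s4.and s5))))
  obtain ⟨c, hc⟩ := compress hU T0 T1 hm (⌈C * B⌉₊ + 4) hR
  obtain ⟨n0, hn0⟩ := exists_pow_lt' (show 0 < min (min ((T - fr u1) / 2) ((fr u2 - T) / 2)) (T / 2) from
    lt_min (lt_min (by linarith) (by linarith)) (by linarith))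
  refine ⟨c, n0, fun n hn => ?_⟩
  have hsm := hn0 n hn
  have e1 : 1 / 2 ^ n < (T - fr u1) / 2 := hsm.trans_le ((min_le_left _ _).trans (min_le_left _ _))
  have e2 : 1 / 2 ^ n < (fr u2 - T) / 2 := hsm.trans_le ((min_le_left _ _).trans (min_le_right _ _))
  have e3 : 1 / 2 ^ n < T / 2 := hsm.trans_le (min_le_right _ _)
  have h2 : 2 ≤ ⌊T * 2 ^ n⌋₊ := by
    refine Nat.le_floor ?_
    rw [div_lt_iff₀ (by positivity)] at e3
    push_cast; linarith
  obtain ⟨b1, b2⟩ := floor_bounds T0 n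
  rw [add_div] at b1
  set N := ⌊T * 2 ^ n⌋₊ with hN
  set Ω := ∑' p : V.f.Dom, (1 / 2 : ℝ) ^ p.1.length with hΩ
  have hΩ1 : Ω ≤ 1 := kraft_tsum hV
  have hΩ0 : 0 < Ω := by
    obtain ⟨p, hp⟩ := V.dom_nonempty
    exact (kraft_summable hV).tsum_pos (fun p => by positivity) ⟨p, hp⟩ (by positivity)
  have hc0 : 0 < ⌈Ω * 2 ^ m n⌉₊ := Nat.ceil_pos.2 (by positivity)
  have hrr : ∀ i : ℕ, rr (i, n) = (i : ℝ) / 2 ^ n + 1 / 2 ^ n := fun i => by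
    unfold rr; rw [add_div]
  have hJ2 : rr (N - 2, n) = (N : ℝ) / 2 ^ n - 1 / 2 ^ n := by
    rw [hrr, Nat.cast_sub h2]; push_cast; ring
  have hJ5 : rr (N - 2 + 3, n) = (N : ℝ) / 2 ^ n + 2 * (1 / 2 ^ n) := by
    rw [hrr, Nat.cast_add, Nat.cast_sub h2]; push_cast; ring
  have hpos : (0 : ℝ) < 1 / 2 ^ n := by positivity
  obtain ⟨x, hxd⟩ : ∃ x, ⌈Ω * 2 ^ m n⌉₊ = x + 1 := ⟨_, (Nat.succ_pred_eq_of_pos hc0).symm⟩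
  have hxΩ : (x : ℝ) / 2 ^ m n < Ω := by
    rw [div_lt_iff₀ (by positivity)]
    exact Nat.lt_ceil.1 (by omega)
  have hΩx : Ω ≤ (x : ℝ) / 2 ^ m n + (1 / 2) ^ m n := by
    have := Nat.le_ceil (Ω * 2 ^ m n)
    rw [hxd] at this
    rw [one_div_pow, ← add_div, le_div_iff₀ (by positivity)]
    push_cast at this; exact this
  refine hc n ⟨x, ?_, ⟨N - 2, ?_⟩, ?_⟩
  · have : ⌈Ω * 2 ^ m n⌉₊ ≤ 2 ^ m n := by
      refine Nat.ceil_le.2 ?_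
      push_cast
      exact mul_le_of_le_one_left (by positivity) hΩ1
    omega
  · -- existence of a stage
    obtain ⟨k1, hk1⟩ := stage_tail h.stage (summable_len hV T0 T1)
      (div_pos (show 0 < rr (N - 2 + 3, n) - T by rw [hJ5]; linarith) h.Cpos)
    obtain ⟨k2, hk2⟩ := stage_tail h.stage (kraft_summable hV) (sub_pos.2 hxΩ)
    refine ⟨max k1 k2, ?_, ?_, ?_, ?_, ?_⟩
    · have := hk2 _ (le_max_right k1 k2)
      show (x : ℝ) / 2 ^ m n < Z1 _
      simp only [Z1]
      linarith
    · refine h.n1 _ _ ?_ ?_ <;> simp only <;> rw [hJ2] <;> linarith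
    · have := hk1 _ (le_max_left k1 k2)
      rw [lt_div_iff₀ h.Cpos, mul_comm] at this
      refine h.p3 _ _ ?_ ?_ this <;> rw [hJ5] <;> linarith
    · show fr u1 < rr (N - 2, n)
      rw [hJ2]; linarith
    · show rr (N - 2 + 3, n) < fr u2
      rw [hJ5]; linarith
  · rintro J ⟨k, q1, q2, q3, q4, q5⟩
    simp only at q1 q2 q3 q4 q5
    have hlt : rr (J, n) < rr (J + 3, n) := by
      rw [hrr, hrr]; push_cast; rw [add_div]; 
      have : (0 : ℝ) < 3 / 2 ^ n := by positivity
      linarith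
    have r1 : T < rr (J + 3, n) := by
      by_contra hcon
      exact h.p1 _ _ (by linarith) (not_lt.1 hcon) q3
    have htail := hB (Kst V st k) (m n) n (hmT n) (by
      have : (x : ℝ) / 2 ^ m n < ∑ p ∈ Kst V st k, (1 / 2 : ℝ) ^ p.1.length := q1
      linarith)
    have r2 : rr (J, n) - T ≤ C * (B / 2 ^ n) := by
      by_contra hcon
      push Not at hcon
      have hcb : 0 < C * (B / 2 ^ n) := by have := h.Cpos; positivity
      refine h.pn k _ (h.p3 k (rr (J, n)) (by linarith) (by linarith) ?_) q2
      exact (mul_le_mul_of_nonneg_left htail h.Cpos.le).trans_lt hcon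
    have hp2 : (0 : ℝ) < 2 ^ n := by positivity
    unfold rr at r1 r2
    simp only at r1 r2
    rw [lt_div_iff₀ hp2] at r1
    rw [sub_le_iff_le_add, div_le_iff₀ hp2, add_mul, ← mul_div_assoc, div_mul_cancel₀ _ hp2.ne'] at r2
    have b2' := Nat.floor_le (show 0 ≤ T * 2 ^ n by positivity)
    have b1' := Nat.lt_floor_add_one (T * 2 ^ n)
    rw [← hN] at b2' b1'
    have hce := Nat.le_ceil (C * B)
    push_cast at r1
    constructor
    · have : (N : ℝ) < J + 4 := by linarith
      have : N < J + 4 := by exact_mod_cast this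
      omega
    · have : (J : ℝ) < N + ⌈C * B⌉₊ := by linarith
      have : J < N + ⌈C * B⌉₊ := by exact_mod_cast this
      omega

theorem Crit.compressible {U V : Computer} (hU : Optimal U) (hV : Optimal V) {T : ℝ}
    {st : ℕ → List (List Bool × List Bool)}
    {Pp Nn : ℕ → ℝ → Prop} {w : ℕ → ℝ} {t1 t2 C : ℝ} (h : Crit V T st Pp Nn w t1 t2 C) :
    TCompressible U T T := by
  have T0 := h.t1pos.trans h.t1T
  have T1 := h.Tt2.trans h.t2one
  refine ⟨fun n => max ((complexity U (firstBits T n) : ℝ) - T * n) 0, ?_, fun n _ => ?_⟩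
  · rw [Metric.tendsto_atTop]
    intro ε he
    obtain ⟨u, hu1, hu2⟩ := fr_dense T0.le (lt_min (show T < T + ε / 2 by linarith) T1)
    have hu3 := hu2.trans_le (min_le_left _ _)
    have hu4 := hu2.trans_le (min_le_right _ _)
    have hfr : fr u = (u.1 : ℝ) / ((u.2 + 1 : ℕ) : ℝ) := by unfold fr; push_cast; rfl
    obtain ⟨c, n0, hc⟩ := h.compress_rat hU hV (a := u.1) (b := u.2 + 1) (Nat.succ_pos _)
      (by rw [← hfr]; exact hu1) (by rw [← hfr]; exact hu4)
    obtain ⟨n1, hn1⟩ := sqrt_small (show 0 < ε / 2 by linarith) (c + 1)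
    refine ⟨max n0 n1 + 1, fun n hn => ?_⟩
    have e1 := hc n (by omega)
    have e2 := hn1 n (by omega)
    have hn0 : (0 : ℝ) < n := by exact_mod_cast (show 0 < n by omega)
    have e3 : ((n * u.1 / (u.2 + 1) : ℕ) : ℝ) ≤ fr u * n := by
      refine Nat.cast_div_le.trans (le_of_eq ?_)
      rw [hfr]; push_cast; ring
    have e4 : (complexity U (firstBits T n) : ℝ) ≤
        ((n * u.1 / (u.2 + 1) : ℕ) : ℝ) + 1 + 2 * (n.sqrt : ℝ) + c := by exact_mod_cast e1
    rw [Real.dist_eq, sub_zero, abs_of_nonneg (by positivity), div_lt_iff₀ hn0]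
    refine max_lt ?_ (by positivity)
    nlinarith
  · have := le_max_left ((complexity U (firstBits T n) : ℝ) - T * n) 0
    linarith

end Compressibility

section Analytic

/-- The shifted Boltzmann factor. -/
noncomputable def bz (y t : ℝ) : ℝ := (2 : ℝ) ^ (-y / t)

theorem bz_pos (y t : ℝ) : 0 < bz y t := Real.rpow_pos_of_pos (by norm_num) _

theorem bz_exp (y t : ℝ) : bz y t = Real.exp (Real.log 2 * (-y / t)) := by
  unfold bz; rw [Real.rpow_def_of_pos (by norm_num)]

theorem ln2_pos : 0 < Real.log 2 := Real.log_pos (by norm_num)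

theorem ln2_le : Real.log 2 ≤ 1 := by have := Real.log_two_lt_d9; linarith

theorem bz_lower (y : ℝ) {s t : ℝ} (hs : 0 < s) (ht : 0 < t) :
    bz y s * (Real.log 2 * y * ((t - s) / (s * t))) ≤ bz y t - bz y s := by
  rw [bz_exp, bz_exp]
  have e : Real.log 2 * (-y / t) = Real.log 2 * (-y / s) + Real.log 2 * y * ((t - s) / (s * t)) := by
    field_simp; ring
  rw [e, Real.exp_add]
  have := Real.add_one_le_exp (Real.log 2 * y * ((t - s) / (s * t)))
  have hp := Real.exp_pos (Real.log 2 * (-y / s))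
  nlinarith

theorem bz_upper (y : ℝ) {s t : ℝ} (hs : 0 < s) (ht : 0 < t) :
    bz y t - bz y s ≤ bz y t * (Real.log 2 * y * ((t - s) / (s * t))) := by
  have := bz_lower y ht hs
  have e : (s - t) / (t * s) = - ((t - s) / (s * t)) := by rw [mul_comm t s]; ring
  rw [e] at this
  linarith

theorem bz_mono {y s t : ℝ} (hs : 0 < s) (hst : s ≤ t) (hy : 0 ≤ y) : bz y s ≤ bz y t := by
  have := bz_lower y hs (hs.trans_le hst)
  have h2 : 0 ≤ bz y s * (Real.log 2 * y * ((t - s) / (s * t))) := by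
    have := bz_pos y s; have := ln2_pos; have := hs.trans_le hst
    have : 0 ≤ (t - s) / (s * t) := div_nonneg (by linarith) (by positivity)
    positivity
  linarith

theorem bz_shift_le (l a : ℝ) (hl : 0 ≤ l) {T t t2 : ℝ} (h0 : 0 < T) (h1 : T ≤ t) (h2 : t ≤ t2) :
    bz (l - a) t ≤ (2 : ℝ) ^ (|a| / T) * (2 : ℝ) ^ (-l / t2) := by
  unfold bz
  rw [← Real.rpow_add (by norm_num)]
  refine Real.rpow_le_rpow_of_exponent_le (by norm_num) ?_
  have ht : 0 < t := h0.trans_le h1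
  have e : -(l - a) / t = a / t + -l / t := by ring
  rw [e]
  have e1 : a / t ≤ |a| / T := by
    refine (div_le_div_of_nonneg_right (le_abs_self a) ht.le).trans ?_
    exact div_le_div_of_nonneg_left (abs_nonneg a) h0 h1
  have e2 : -l / t ≤ -l / t2 := by
    rw [neg_div, neg_div, neg_le_neg_iff]
    exact div_le_div_of_nonneg_left hl ht h2
  linarith

variable {ι : Type} {l : ι → ℕ}

/-- Uniform bound for weighted sums. -/
theorem weighted_bound (hl : Summable (fun i => (1 / 2 : ℝ) ^ l i))
    {T : ℝ} (h0 : 0 < T) {t2 : ℝ} (h1 : T < t2) (h2 : t2 < 1) (a : ℝ) {H : ℝ} (hH : 0 ≤ H)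
    {g : ι → ℝ} (hg : ∀ i, |g i| ≤ H * (l i : ℝ) ^ 2) :
    ∃ M : ℝ, 0 < M ∧ ∀ (K : Finset ι) t, T ≤ t → t ≤ t2 →
      ∑ i ∈ K, |g i| * bz (l i - a) t ≤ M := by
  have hs := summable_pow_exp hl 2 (h0.trans h1) h2
  set Q := ∑' i, (l i : ℝ) ^ 2 * (2 : ℝ) ^ (-(l i : ℝ) / t2) with hQ
  have hQ0 : 0 ≤ Q := tsum_nonneg fun i => by positivity
  refine ⟨H * (2 : ℝ) ^ (|a| / T) * Q + 1, by positivity, fun K t hT ht => ?_⟩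
  have : ∑ i ∈ K, |g i| * bz (l i - a) t ≤
      ∑ i ∈ K, (H * (2 : ℝ) ^ (|a| / T)) * ((l i : ℝ) ^ 2 * (2 : ℝ) ^ (-(l i : ℝ) / t2)) := by
    refine Finset.sum_le_sum fun i _ => ?_
    refine (mul_le_mul (hg i) (bz_shift_le (l i) a (by positivity) h0 hT ht) (bz_pos _ _).le
      (by positivity)).trans (le_of_eq ?_)
    ring
  rw [← Finset.mul_sum] at this
  have h3 : ∑ i ∈ K, ((l i : ℝ) ^ 2 * (2 : ℝ) ^ (-(l i : ℝ) / t2)) ≤ Q :=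
    hs.sum_le_tsum K (fun i _ => by positivity)
  have := mul_le_mul_of_nonneg_left h3 (show 0 ≤ H * (2 : ℝ) ^ (|a| / T) by positivity)
  linarith

theorem tail_eq {g : ι → ℝ} {b : ℝ} (hg : HasSum g b) (K : Finset ι) :
    HasSum (fun i : ((K : Set ι)ᶜ : Set ι) => g i) (b - ∑ i ∈ K, g i) := by
  have h := (hg.summable.subtype ((K : Set ι)ᶜ : Set ι)).hasSum
  have e := hg.summable.sum_add_tsum_compl (s := K)
  rw [hg.tsum_eq] at e
  have e' : b - ∑ i ∈ K, g i = ∑' i : ((K : Set ι)ᶜ : Set ι), g i := by linarith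
  rw [e']
  exact h

theorem tail_nonneg {g : ι → ℝ} {b : ℝ} (hg : HasSum g b) (K : Finset ι)
    (h : ∀ i, i ∉ K → 0 ≤ g i) : ∑ i ∈ K, g i ≤ b := by
  have := (tail_eq hg K).nonneg
    (fun i : ((K : Set ι)ᶜ : Set ι) => h i.1 (fun hi => i.2 (Finset.mem_coe.2 hi)))
  linarith

theorem tail_single {g : ι → ℝ} {b : ℝ} (hg : HasSum g b) (K : Finset ι)
    (h : ∀ i, i ∉ K → 0 ≤ g i) {p : ι} (hp : p ∉ K) : g p ≤ b - ∑ i ∈ K, g i := by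
  exact le_hasSum (tail_eq hg K) ⟨p, by simpa using hp⟩
    (fun i _ => h i.1 (fun hi => i.2 (Finset.mem_coe.2 hi)))

theorem tail_le {g : ι → ℝ} {b : ℝ} (hg : HasSum g b) (hl : Summable (fun i => (1 / 2 : ℝ) ^ l i))
    {T : ℝ} (h0 : 0 < T) (h1 : T < 1) (a : ℝ) {H : ℝ} (hH : 0 ≤ H)
    {h : ι → ℝ} (hh : ∀ i, |h i| ≤ H * (l i : ℝ)) (hgh : ∀ i, g i = h i * bz (l i - a) T)
    (K : Finset ι) :
    b - ∑ i ∈ K, g i ≤ (H * (2 : ℝ) ^ (|a| / T)) *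
      (∑' i, (l i : ℝ) * (2 : ℝ) ^ (-(l i : ℝ) / T) -
        ∑ i ∈ K, (l i : ℝ) * (2 : ℝ) ^ (-(l i : ℝ) / T)) := by
  have hs : Summable (fun i => (l i : ℝ) * (2 : ℝ) ^ (-(l i : ℝ) / T)) := by
    simpa using summable_pow_exp hl 1 h0 h1
  refine hasSum_le (fun i => ?_) (tail_eq hg K) ((tail_eq hs.hasSum K).mul_left _)
  rw [hgh]
  refine (mul_le_mul_of_nonneg_right ((le_abs_self _).trans (hh i)) (bz_pos _ _).le).trans ?_
  refine (mul_le_mul_of_nonneg_left (bz_shift_le (l i) a (by positivity) h0 le_rfl le_rfl)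
    (by positivity)).trans (le_of_eq ?_)
  ring

theorem tail_len_nonneg (hl : Summable (fun i => (1 / 2 : ℝ) ^ l i)) {T : ℝ} (h0 : 0 < T)
    (h1 : T < 1) (K : Finset ι) : 0 ≤ ∑' i, (l i : ℝ) * (2 : ℝ) ^ (-(l i : ℝ) / T) -
        ∑ i ∈ K, (l i : ℝ) * (2 : ℝ) ^ (-(l i : ℝ) / T) := by
  have hs : Summable (fun i => (l i : ℝ) * (2 : ℝ) ^ (-(l i : ℝ) / T)) := by
    simpa using summable_pow_exp hl 1 h0 h1
  have := tail_nonneg hs.hasSum K (fun i _ => by positivity)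
  linarith

/-- The sums are Lipschitz in the temperature. -/
theorem slope_upper (hl : Summable (fun i => (1 / 2 : ℝ) ^ l i)) (hl1 : ∀ i, 1 ≤ l i)
    {T : ℝ} (h0 : 0 < T) {t2 : ℝ} (h1 : T < t2) (h2 : t2 < 1) (a : ℝ) {H : ℝ} (hH : 0 ≤ H)
    {h : ι → ℝ} (hh : ∀ i, |h i| ≤ H * (l i : ℝ)) :
    ∃ M : ℝ, 0 < M ∧ ∀ (K : Finset ι) t, T ≤ t → t ≤ t2 →
      ∑ i ∈ K, h i * bz (l i - a) t - ∑ i ∈ K, h i * bz (l i - a) T ≤ M * (t - T) := by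
  have hya : ∀ i, |(l i : ℝ) - a| ≤ (1 + |a|) * l i := fun i => by
    have h1 : (1 : ℝ) ≤ l i := by exact_mod_cast hl1 i
    have := abs_sub (l i : ℝ) a
    rw [abs_of_nonneg (show (0 : ℝ) ≤ l i by positivity)] at this
    have := abs_nonneg a
    nlinarith
  obtain ⟨M, hM0, hM⟩ := weighted_bound hl h0 h1 h2 a (H := H * (1 + |a|)) (by positivity)
    (g := fun i => h i * (l i - a)) (fun i => by
      rw [abs_mul]
      refine (mul_le_mul (hh i) (hya i) (abs_nonneg _) (by positivity)).trans (le_of_eq ?_)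
      ring)
  refine ⟨(M + M) * (1 / T ^ 2), by positivity, fun K t hT ht => ?_⟩
  have htp : 0 < t := h0.trans_le hT
  rw [← Finset.sum_sub_distrib]
  have hd : 0 ≤ (t - T) / (T * t) := div_nonneg (by linarith) (by positivity)
  have hd2 : (t - T) / (T * t) ≤ 1 / T ^ 2 * (t - T) := by
    rw [one_div, inv_mul_eq_div]
    exact div_le_div_of_nonneg_left (by linarith) (by positivity) (by nlinarith)
  have hterm : ∀ i ∈ K, h i * bz (l i - a) t - h i * bz (l i - a) T ≤
      (|h i * (l i - a)| * bz (l i - a) t + |h i * (l i - a)| * bz (l i - a) T)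
        * ((t - T) / (T * t)) := by
    intro i _
    have l1 := bz_lower (l i - a) h0 htp
    have l2 := bz_upper (l i - a) h0 htp
    have b1 := bz_pos (l i - a) t
    have b2 := bz_pos (l i - a) T
    set y := (l i : ℝ) - a
    set δ := (t - T) / (T * t)
    have key : |bz y t - bz y T| ≤ (|y| * bz y t + |y| * bz y T) * δ := by
      have k1 : |bz y t * (Real.log 2 * y * δ)| ≤ |y| * bz y t * δ := by
        rw [abs_mul, abs_mul, abs_mul, abs_of_pos b1, abs_of_pos ln2_pos, abs_of_nonneg hd]
        have := mul_le_mul_of_nonneg_right ln2_le (show 0 ≤ |y| * bz y t * δ by positivity)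
        linarith
      have k2 : |bz y T * (Real.log 2 * y * δ)| ≤ |y| * bz y T * δ := by
        rw [abs_mul, abs_mul, abs_mul, abs_of_pos b2, abs_of_pos ln2_pos, abs_of_nonneg hd]
        have := mul_le_mul_of_nonneg_right ln2_le (show 0 ≤ |y| * bz y T * δ by positivity)
        linarith
      rw [abs_le] at k1 k2 ⊢
      have p1 : 0 ≤ |y| * bz y t * δ := by positivity
      have p2 : 0 ≤ |y| * bz y T * δ := by positivity
      constructor <;> linarith [k1.1, k1.2, k2.1, k2.2]
    rw [← mul_sub, abs_mul]
    calc h i * (bz y t - bz y T) ≤ |h i| * |bz y t - bz y T| := by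
          rw [← abs_mul]; exact le_abs_self _
      _ ≤ |h i| * ((|y| * bz y t + |y| * bz y T) * δ) :=
          mul_le_mul_of_nonneg_left key (abs_nonneg _)
      _ = _ := by ring
  refine (Finset.sum_le_sum hterm).trans ?_
  rw [← Finset.sum_mul, Finset.sum_add_distrib, mul_assoc]
  exact mul_le_mul (add_le_add (hM K t hT ht) (hM K T le_rfl h1.le)) hd2 hd (by positivity)

theorem term_mono {T t : ℝ} (h0 : 0 < T) (h1 : T ≤ t) {h y : ℝ} (hy : 0 ≤ h * y) :
    h * bz y T ≤ h * bz y t := by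
  have htp : 0 < t := h0.trans_le h1
  have hd : 0 ≤ (t - T) / (T * t) := div_nonneg (by linarith) (by positivity)
  have key : ∀ s, 0 ≤ h * (bz y s * (Real.log 2 * y * ((t - T) / (T * t)))) := fun s => by
    have := bz_pos y s; have := ln2_pos
    have e : h * (bz y s * (Real.log 2 * y * ((t - T) / (T * t)))) =
      (h * y) * (bz y s * Real.log 2 * ((t - T) / (T * t))) := by ring
    rw [e]; positivity
  rcases le_total 0 h with hh | hh
  · have := mul_le_mul_of_nonneg_left (bz_lower y h0 htp) hh
    have := key T
    linarith
  · have := mul_le_mul_of_nonpos_left (bz_upper y h0 htp) hh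
    have := key t
    linarith

theorem sum_mono {T t : ℝ} (h0 : 0 < T) (h1 : T ≤ t) (a : ℝ) {h : ι → ℝ}
    (hy : ∀ i, 0 ≤ h i * (l i - a)) (K : Finset ι) :
    ∑ i ∈ K, h i * bz (l i - a) T ≤ ∑ i ∈ K, h i * bz (l i - a) t :=
  Finset.sum_le_sum fun i _ => term_mono h0 h1 (hy i)

theorem slope_lower {T t : ℝ} (h0 : 0 < T) (h1 : T ≤ t) (h2 : t ≤ 1) (a : ℝ) {h : ι → ℝ}
    (hy : ∀ i, 0 ≤ h i * (l i - a)) (K : Finset ι) {i0 : ι} (hi0 : i0 ∈ K) (hh : 0 ≤ h i0) :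
    (h i0 * (l i0 - a) * bz (l i0 - a) T * Real.log 2) * (t - T) ≤
      ∑ i ∈ K, h i * bz (l i - a) t - ∑ i ∈ K, h i * bz (l i - a) T := by
  have htp : 0 < t := h0.trans_le h1
  rw [← Finset.sum_sub_distrib]
  have hd : t - T ≤ (t - T) / (T * t) := by
    rw [le_div_iff₀ (by positivity)]
    have : T * t ≤ 1 := by nlinarith
    nlinarith
  have hterm : (h i0 * (l i0 - a) * bz (l i0 - a) T * Real.log 2) * (t - T) ≤
      h i0 * bz (l i0 - a) t - h i0 * bz (l i0 - a) T := by
    have b2 := bz_pos (l i0 - a) T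
    have hp : 0 ≤ h i0 * (l i0 - a) * bz (l i0 - a) T * Real.log 2 := by
      have := hy i0; have := ln2_pos; positivity
    refine (mul_le_mul_of_nonneg_left hd hp).trans ?_
    have := mul_le_mul_of_nonneg_left (bz_lower (l i0 - a) h0 htp) hh
    linarith
  refine le_trans hterm (Finset.single_le_sum
    (f := fun i => h i * bz (l i - a) t - h i * bz (l i - a) T) (fun i _ => ?_) hi0)
  exact sub_nonneg.2 (term_mono h0 h1 (hy i))

/-- The linear criterion. -/
theorem lin_criterion (hl : Summable (fun i => (1 / 2 : ℝ) ^ l i)) (hl1 : ∀ i, 1 ≤ l i)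
    {T : ℝ} (h0 : 0 < T) {t2 : ℝ} (h1 : T < t2) (h2 : t2 < 1) (a : ℝ) {H : ℝ} (hH : 0 ≤ H)
    {h : ι → ℝ} (hh : ∀ i, |h i| ≤ H * (l i : ℝ)) (hy : ∀ i, 0 ≤ h i * (l i - a))
    {b : ℝ} (hb : HasSum (fun i => h i * bz (l i - a) T) b)
    {K0 : Finset ι} (hK0 : ∀ i, i ∉ K0 → 0 ≤ h i) {i0 : ι} (hi0 : i0 ∈ K0) (hi1 : 0 < h i0)
    (hi2 : 0 < (l i0 : ℝ) - a) :
    ∃ C : ℝ, 0 < C ∧ ∀ K : Finset ι, K0 ⊆ K →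
      (∀ t, 0 < t → t ≤ T → ∑ i ∈ K, h i * bz (l i - a) t ≤ b) ∧
      (∀ t, 0 < t → t < T → ∑ i ∈ K, h i * bz (l i - a) t < b) ∧
      (∀ t, T < t → t ≤ t2 → b < ∑ i ∈ K, h i * bz (l i - a) t → ∀ p, p ∉ K →
        h p * bz (l p - a) T ≤ C * (t - T)) ∧
      (∀ t, T < t → t ≤ t2 → C * (∑' i, (l i : ℝ) * (2 : ℝ) ^ (-(l i : ℝ) / T) -
        ∑ i ∈ K, (l i : ℝ) * (2 : ℝ) ^ (-(l i : ℝ) / T)) < t - T →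
        b < ∑ i ∈ K, h i * bz (l i - a) t) := by
  obtain ⟨M, hM0, hM⟩ := slope_upper hl hl1 h0 h1 h2 a hH hh
  have T1 : T < 1 := h1.trans h2
  set c := h i0 * (l i0 - a) * bz (l i0 - a) T * Real.log 2 with hc
  have hc0 : 0 < c := by
    have := bz_pos (l i0 - a) T; have := ln2_pos; positivity
  set D := H * (2 : ℝ) ^ (|a| / T) with hD
  have hD0 : 0 ≤ D := by positivity
  refine ⟨M + D / c, by positivity, fun K hK => ?_⟩
  have hKn : ∀ i, i ∉ K → 0 ≤ h i * bz (l i - a) T := fun i hi =>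
    mul_nonneg (hK0 i (fun h => hi (hK h))) (bz_pos _ _).le
  have hKb := tail_nonneg hb K hKn
  refine ⟨fun t ht hT => (sum_mono ht hT a hy K).trans hKb, fun t ht hT => ?_,
    fun t hT ht hP p hp => ?_, fun t hT ht hC => ?_⟩
  · have := slope_lower ht hT.le T1.le a hy K (hK hi0) hi1.le
    have hpos : 0 < h i0 * (l i0 - a) * bz (l i0 - a) t * Real.log 2 * (T - t) := by
      have := bz_pos (l i0 - a) t; have := ln2_pos
      have : 0 < T - t := by linarith
      positivity
    linarith
  · have e1 := tail_single hb K hKn hp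
    have e2 := hM K t hT.le ht
    have e3 : 0 ≤ D / c * (t - T) := mul_nonneg (by positivity) (by linarith)
    rw [add_mul]
    linarith
  · have e1 := slope_lower h0 hT.le (ht.trans h2.le) a hy K (hK hi0) hi1.le
    have e2 := tail_le hb hl h0 T1 a hH hh (fun i => rfl) K
    have e3 := tail_len_nonneg hl h0 T1 K
    set τ := ∑' i, (l i : ℝ) * (2 : ℝ) ^ (-(l i : ℝ) / T) -
        ∑ i ∈ K, (l i : ℝ) * (2 : ℝ) ^ (-(l i : ℝ) / T)
    rw [← hc] at e1
    rw [← hD] at e2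
    have e4 : D / c * τ < t - T := by nlinarith
    have e5 : D * τ < c * (t - T) := by
      rw [div_mul_eq_mul_div, div_lt_iff₀ hc0] at e4
      linarith
    linarith

theorem log_ge {z : ℝ} (hz : 0 < z) : 1 - 1 / z ≤ Real.log z := by
  have := Real.log_le_sub_one_of_pos (inv_pos.2 hz)
  rw [Real.log_inv] at this
  rw [one_div]; linarith

set_option maxHeartbeats 1000000 in
/-- The entropy criterion. -/
theorem ent_criterion (hl : Summable (fun i => (1 / 2 : ℝ) ^ l i)) (hl1 : ∀ i, 1 ≤ l i)
    {T : ℝ} (h0 : 0 < T) {t2 : ℝ} (h1 : T < t2) (h2 : t2 < 1) (a : ℝ) {X : ℝ}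
    (hX : HasSum (fun i => bz (l i - a) T) X)
    (hY : HasSum (fun i => (l i - a) * bz (l i - a) T) 0)
    {K0 : Finset ι} (hK0 : ∀ i, i ∉ K0 → 0 ≤ (l i : ℝ) - a) {i0 : ι} (hi0 : i0 ∈ K0)
    (hi1 : 0 < (l i0 : ℝ) - a) {S : Finset ι → ℝ → ℝ}
    (hS : ∀ K t, S K t = (∑ i ∈ K, (l i - a) * bz (l i - a) t) / (t * ∑ i ∈ K, bz (l i - a) t)
      + Real.log (∑ i ∈ K, bz (l i - a) t) / Real.log 2) {s : ℝ}
    (hs : s = Real.log X / Real.log 2) :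
    ∃ C : ℝ, 0 < C ∧ ∀ K : Finset ι, K0 ⊆ K →
      (∀ t, 0 < t → t ≤ T → S K t ≤ s) ∧
      (∀ t, 0 < t → t < T → S K t < s) ∧
      (∀ t, T < t → t ≤ t2 → s < S K t → ∀ p, p ∉ K →
        (l p - a) * bz (l p - a) T ≤ C * (t - T)) ∧
      (∀ t, T < t → t ≤ t2 → C * (∑' i, (l i : ℝ) * (2 : ℝ) ^ (-(l i : ℝ) / T) -
        ∑ i ∈ K, (l i : ℝ) * (2 : ℝ) ^ (-(l i : ℝ) / T)) < t - T →
        s < S K t) := by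
  have T1 : T < 1 := h1.trans h2
  have hln := ln2_pos
  have hln1 := ln2_le
  have hL1 : ∀ i, (1 : ℝ) ≤ l i := fun i => by exact_mod_cast hl1 i
  have hya : ∀ i, |(l i : ℝ) - a| ≤ (1 + |a|) * l i := fun i => by
    have h1 := hL1 i
    have := abs_sub (l i : ℝ) a
    rw [abs_of_nonneg (show (0 : ℝ) ≤ l i by positivity)] at this
    have := abs_nonneg a
    nlinarith
  have h1l : ∀ i, |(1 : ℝ)| ≤ 1 * l i := fun i => by rw [abs_one, one_mul]; exact hL1 i
  have hyy : ∀ i, 0 ≤ ((l i : ℝ) - a) * (l i - a) := fun i => mul_self_nonneg _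
  have ha1 : 0 ≤ 1 + |a| := by positivity
  obtain ⟨MY, hMY0, hMY⟩ := slope_upper hl hl1 h0 h1 h2 a ha1 hya
  obtain ⟨MX, hMX0, hMX⟩ := slope_upper hl hl1 h0 h1 h2 a zero_le_one (h := fun _ => 1) h1l
  simp only [one_mul] at hMX
  obtain ⟨M0, hM00, hM0⟩ := weighted_bound hl h0 h1 h2 a zero_le_one (g := fun _ => 1)
    (fun i => by rw [abs_one, one_mul]; exact one_le_pow₀ (hL1 i))
  simp only [abs_one, one_mul] at hM0
  set c := (l i0 - a) * (l i0 - a) * bz (l i0 - a) T * Real.log 2 with hc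
  have hc0 : 0 < c := by
    have := bz_pos (l i0 - a) T; positivity
  set DY := (1 + |a|) * (2 : ℝ) ^ (|a| / T) with hDY
  set DX := 1 * (2 : ℝ) ^ (|a| / T) with hDX
  have hDY0 : 0 < DY := by positivity
  have hDX0 : 0 < DX := by positivity
  have hX0 : 0 < X := (bz_pos _ _).trans_le (le_hasSum hX i0 (fun i _ => (bz_pos _ _).le))
  set C1 := M0 * MX / (X * Real.log 2) with hC1
  set C2 := DY + (DX + 1 / T ^ 2 * DY) / Real.log 2 with hC2
  have hC10 : 0 < C1 := by positivity
  have hC20 : 0 < C2 := by positivity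
  refine ⟨(MY + C1) + C2 / c, by positivity, fun K hK => ?_⟩
  have hKX : ∑ i ∈ K, bz (l i - a) T ≤ X := tail_nonneg hX K (fun i _ => (bz_pos _ _).le)
  have hKn : ∀ i, i ∉ K → 0 ≤ ((l i : ℝ) - a) * bz (l i - a) T := fun i hi =>
    mul_nonneg (hK0 i (fun h => hi (hK h))) (bz_pos _ _).le
  have hKY := tail_nonneg hY K hKn
  have hXp : ∀ t, 0 < ∑ i ∈ K, bz (l i - a) t := fun t =>
    Finset.sum_pos (fun i _ => bz_pos _ _) ⟨i0, hK hi0⟩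
  -- Jensen
  have jen : ∀ t, 0 < t → t ≤ T → S K t ≤ s + (∑ i ∈ K, (l i - a) * bz (l i - a) t) /
      (T * ∑ i ∈ K, bz (l i - a) t) := by
    intro t ht hT
    set Xt := ∑ i ∈ K, bz (l i - a) t with hXt
    set Yt := ∑ i ∈ K, (l i - a) * bz (l i - a) t with hYt
    have hXt0 : 0 < Xt := hXp t
    set δ := 1 / t - 1 / T with hδ
    set m := Real.log 2 * δ * (Yt / Xt) with hm
    have term : ∀ i ∈ K, bz (l i - a) t * (Real.exp m * (1 + (Real.log 2 * δ * (l i - a) - m)))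
        ≤ bz (l i - a) T := by
      intro i _
      have e : bz (l i - a) T = bz (l i - a) t * (Real.exp m *
          Real.exp (Real.log 2 * δ * (l i - a) - m)) := by
        rw [bz_exp, bz_exp, ← Real.exp_add, ← Real.exp_add, hδ]
        congr 1; ring
      rw [e]
      refine mul_le_mul_of_nonneg_left ?_ (bz_pos _ _).le
      refine mul_le_mul_of_nonneg_left ?_ (Real.exp_pos _).le
      have := Real.add_one_le_exp (Real.log 2 * δ * (l i - a) - m)
      linarith
    have hsum := Finset.sum_le_sum term
    have e1 : ∑ i ∈ K, bz (l i - a) t * (Real.exp m * (1 + (Real.log 2 * δ * (l i - a) - m)))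
        = Real.exp m * Xt := by
      have : ∀ i ∈ K, bz (l i - a) t * (Real.exp m * (1 + (Real.log 2 * δ * (l i - a) - m))) =
          (Real.exp m * (1 - m)) * bz (l i - a) t +
          (Real.exp m * (Real.log 2 * δ)) * ((l i - a) * bz (l i - a) t) := fun i _ => by ring
      rw [Finset.sum_congr rfl this, Finset.sum_add_distrib, ← Finset.mul_sum, ← Finset.mul_sum,
        ← hXt, ← hYt, hm]
      field_simp
      ring
    rw [e1] at hsum
    have e2 : Real.exp m * Xt ≤ X := hsum.trans hKX
    have e3 := Real.log_le_log (by positivity) e2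
    rw [Real.log_mul (Real.exp_pos _).ne' hXt0.ne', Real.log_exp] at e3
    rw [hS, hs, ← hXt, ← hYt]
    have e4 : (m + Real.log Xt) / Real.log 2 ≤ Real.log X / Real.log 2 :=
      div_le_div_of_nonneg_right e3 hln.le
    have e5 : (m + Real.log Xt) / Real.log 2 = Yt / (t * Xt) - Yt / (T * Xt) +
        Real.log Xt / Real.log 2 := by
      rw [hm, hδ]; field_simp
    linarith
  have sl : ∀ t, 0 < t → t < T → ∑ i ∈ K, (l i - a) * bz (l i - a) t < 0 := by
    intro t ht hT
    have := slope_lower ht hT.le T1.le a hyy K (hK hi0) hi1.le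
    have hpos : 0 < (l i0 - a) * (l i0 - a) * bz (l i0 - a) t * Real.log 2 * (T - t) := by
      have := bz_pos (l i0 - a) t
      have : 0 < T - t := by linarith
      positivity
    linarith
  have p2 : ∀ t, 0 < t → t < T → S K t < s := fun t ht hT => by
    have := jen t ht hT.le
    have h3 := div_neg_of_neg_of_pos (sl t ht hT) (mul_pos h0 (hXp t))
    linarith
  refine ⟨fun t ht hT => ?_, p2, fun t hT ht hP p hp => ?_, fun t hT ht hC => ?_⟩
  · rcases eq_or_lt_of_le hT with rfl | hT
    · have := jen t ht le_rfl
      have h3 := div_nonpos_of_nonpos_of_nonneg hKY (mul_pos h0 (hXp t)).le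
      linarith
    · exact (p2 t ht hT).le
  · have htp : 0 < t := h0.trans hT
    have e1 := tail_single hY K hKn hp
    have e2 := hMY K t hT.le ht
    have e3 := hMX K t hT.le ht
    have e4 := hM0 K t hT.le ht
    have e5 := hXp t
    rw [hS, hs] at hP
    set Xt := ∑ i ∈ K, bz (l i - a) t with hXt
    set Yt := ∑ i ∈ K, (l i - a) * bz (l i - a) t with hYt
    have e6 := log_ge (div_pos hX0 e5)
    rw [Real.log_div hX0.ne' e5.ne', one_div_div] at e6
    have e7 : (1 - Xt / X) / Real.log 2 < Yt / (t * Xt) := by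
      have := div_le_div_of_nonneg_right e6 hln.le
      rw [sub_div (Real.log X)] at this
      linarith
    rw [lt_div_iff₀ (by positivity)] at e7
    have e8 : -(C1 * (t - T)) ≤ (1 - Xt / X) / Real.log 2 * (t * Xt) := by
      have : (1 - Xt / X) / Real.log 2 * (t * Xt) = (t * Xt * (X - Xt)) / (X * Real.log 2) := by
        field_simp
      rw [this, hC1, div_mul_eq_mul_div, ← neg_div]
      refine div_le_div_of_nonneg_right ?_ (by positivity)
      have f1 : -(MX * (t - T)) ≤ X - Xt := by linarith
      have f2 : t * Xt ≤ M0 := (mul_le_of_le_one_left e5.le (by linarith)).trans e4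
      have f3 : 0 < t * Xt := by positivity
      have f4 : 0 ≤ MX * (t - T) := mul_nonneg hMX0.le (by linarith)
      have f5 := mul_le_mul_of_nonneg_left f1 f3.le
      have f6 := mul_le_mul_of_nonneg_right f2 f4
      linarith
    have e9 : 0 ≤ C2 / c * (t - T) := mul_nonneg (by positivity) (by linarith)
    rw [add_mul, add_mul]
    linarith
  · have htp : 0 < t := h0.trans hT
    have e1 := slope_lower h0 hT.le (ht.trans h2.le) a hyy K (hK hi0) hi1.le
    have e2 := tail_le hY hl h0 T1 a ha1 hya (fun i => rfl) K
    have e2' := tail_le hX hl h0 T1 a zero_le_one h1l (fun i => (one_mul _).symm) K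
    have e3 := tail_len_nonneg hl h0 T1 K
    set τ := ∑' i, (l i : ℝ) * (2 : ℝ) ^ (-(l i : ℝ) / T) -
        ∑ i ∈ K, (l i : ℝ) * (2 : ℝ) ^ (-(l i : ℝ) / T)
    rw [← hc] at e1
    rw [← hDY] at e2
    rw [← hDX] at e2'
    have e4 : C2 / c * τ < t - T := by
      have : 0 ≤ (MY + C1) * τ := by positivity
      rw [add_mul] at hC; linarith
    have e5 : C2 * τ < c * (t - T) := by
      rw [div_mul_eq_mul_div, div_lt_iff₀ hc0] at e4
      linarith
    have hd : 0 ≤ (t - T) / (T * t) := div_nonneg (by linarith) (by positivity)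
    have hd2 : (t - T) / (T * t) ≤ 1 / T ^ 2 := by
      rw [div_le_div_iff₀ (by positivity) (by positivity)]
      have : t - T ≤ 1 := by linarith
      have : T ^ 2 ≤ T * t := by nlinarith
      nlinarith [mul_pos h0 htp, sq_nonneg T]
    have e6 : Real.log 2 * ((t - T) / (T * t)) * ∑ i ∈ K, (l i - a) * bz (l i - a) T ≤
        ∑ i ∈ K, bz (l i - a) t - ∑ i ∈ K, bz (l i - a) T := by
      rw [← Finset.sum_sub_distrib, Finset.mul_sum]
      refine Finset.sum_le_sum fun i _ => ?_
      have := bz_lower (l i - a) h0 htp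
      linarith
    rw [hS, hs]
    have hXt0 := hXp t
    set Xt := ∑ i ∈ K, bz (l i - a) t with hXt
    set Yt := ∑ i ∈ K, (l i - a) * bz (l i - a) t with hYt
    set XT := ∑ i ∈ K, bz (l i - a) T with hXT
    set YT := ∑ i ∈ K, (l i - a) * bz (l i - a) T with hYT
    have e7 : -(1 / T ^ 2 * DY * τ) ≤ Real.log 2 * ((t - T) / (T * t)) * YT := by
      have f1 : Real.log 2 * ((t - T) / (T * t)) ≤ 1 / T ^ 2 :=
        (mul_le_of_le_one_left hd hln1).trans hd2
      have f2 : 0 ≤ Real.log 2 * ((t - T) / (T * t)) := by positivity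
      have f3 : 0 ≤ DY * τ := by positivity
      have f4 : -(DY * τ) ≤ YT := by linarith
      have f5 := mul_le_mul_of_nonneg_left f4 f2
      have f6 := mul_le_mul_of_nonneg_right f1 f3
      linarith
    have e8 : X - Xt ≤ (DX + 1 / T ^ 2 * DY) * τ := by linarith
    have e9 : (X - Xt) / Real.log 2 ≤ (DX + 1 / T ^ 2 * DY) / Real.log 2 * τ := by
      rw [div_mul_eq_mul_div]
      exact div_le_div_of_nonneg_right e8 hln.le
    have e10 : C2 * τ = DY * τ + (DX + 1 / T ^ 2 * DY) / Real.log 2 * τ := by rw [hC2]; ring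
    have e10' : 0 ≤ (DX + 1 / T ^ 2 * DY) / Real.log 2 * τ := by positivity
    have e11 : (DX + 1 / T ^ 2 * DY) / Real.log 2 * τ < Yt := by linarith
    have e12 : Yt ≤ Yt / t := by
      rw [le_div_iff₀ htp]; nlinarith
    have e13 : (X - Xt) / Real.log 2 < Yt / t := by linarith
    have e14 := log_ge (div_pos hXt0 hX0)
    rw [Real.log_div hXt0.ne' hX0.ne', one_div_div] at e14
    have e15 := div_le_div_of_nonneg_right e14 hln.le
    rw [sub_div (Real.log Xt)] at e15
    have e16 : (X - Xt) / Real.log 2 / Xt < Yt / t / Xt := div_lt_div_of_pos_right e13 hXt0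
    have e17 : (X - Xt) / Real.log 2 / Xt = - ((1 - X / Xt) / Real.log 2) := by
      field_simp; ring
    rw [div_div Yt] at e16
    linarith

end Analytic

section Instances

theorem dom_infinite {V : Computer} (hV : Optimal V) : Infinite V.f.Dom := by
  choose p hp using hV.surj
  refine Infinite.of_injective (fun s => (⟨p s, Part.dom_iff_mem.2 ⟨s, hp s⟩⟩ : V.f.Dom)) ?_
  intro s s' h
  have h1 : p s = p s' := congrArg Subtype.val h
  have h2 := hp s
  rw [h1] at h2
  exact Part.mem_unique h2 (hp s')

theorem exists_K0 {V : Computer} (hV : Optimal V) (N : ℕ) :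
    ∃ (K0 : Finset V.f.Dom) (i0 : V.f.Dom), i0 ∈ K0 ∧ N < i0.1.length ∧
      ∀ p, p ∉ K0 → N < p.1.length := by
  classical
  have h := (kraft_summable hV).tendsto_cofinite_zero.eventually
    (gt_mem_nhds (show (0 : ℝ) < (1 / 2) ^ N by positivity))
  have hf : {p : V.f.Dom | ¬ (1 / 2 : ℝ) ^ p.1.length < (1 / 2) ^ N}.Finite := h
  have hK : ∀ p, p ∉ hf.toFinset → N < p.1.length := by
    intro p hp
    simp only [Set.Finite.mem_toFinset, Set.mem_ofPred_eq, not_not] at hp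
    by_contra hc
    exact absurd hp (not_lt.2 (pow_le_pow_of_le_one (by norm_num) (by norm_num) (not_lt.1 hc)))
  have := dom_infinite hV
  obtain ⟨i0, hi0⟩ := Infinite.exists_notMem_finset hf.toFinset
  exact ⟨insert i0 hf.toFinset, i0, Finset.mem_insert_self _ _, hK i0 hi0,
    fun p hp => hK p (fun h => hp (Finset.mem_insert_of_mem h))⟩

theorem bz_rpow (l : ℕ) (t : ℝ) : bz l t = ((2 : ℝ) ^ t⁻¹)⁻¹ ^ l := by
  unfold bz
  rw [← Real.rpow_neg (by norm_num), ← Real.rpow_natCast, ← Real.rpow_mul (by norm_num)]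
  congr 1; rw [div_eq_mul_inv]; ring

theorem bz_sub (l a t : ℝ) : bz (l - a) t = bz l t * (2 : ℝ) ^ (a / t) := by
  unfold bz
  rw [← Real.rpow_add (by norm_num)]
  congr 1; ring

/-- Stage partition sums. -/
noncomputable def Zs (V : Computer) (st : ℕ → List (List Bool × List Bool)) (k : ℕ) (t : ℝ) : ℝ :=
  ∑ p ∈ Kst V st k, bz p.1.length t

/-- Stage energy sums. -/
noncomputable def Ws (V : Computer) (st : ℕ → List (List Bool × List Bool)) (k : ℕ) (t : ℝ) : ℝ :=
  ∑ p ∈ Kst V st k, (p.1.length : ℝ) * bz p.1.length t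

theorem CR_x : CR (fun u : ℕ × ℕ => ((2 : ℝ) ^ (rr u)⁻¹)⁻¹) :=
  ((CR_rr.inv rr_pos).exp2 (fun u => inv_pos.2 (rr_pos u))).inv (fun u => by positivity)

theorem CR_Zs {V : Computer} {st : ℕ → List (List Bool × List Bool)} (hst : IsStage V st) :
    CR (fun x : ℕ × (ℕ × ℕ) => Zs V st x.1 (rr x.2)) := by
  have hL : Computable (fun x : ℕ × (ℕ × ℕ) => (st x.1).map (fun x => ((1 : ℕ), x.1.length))) := by
    have : Primrec (fun L : List (List Bool × List Bool) =>
        L.map (fun x => ((1 : ℕ), x.1.length))) :=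
      Primrec.list_map Primrec.id ((Primrec.const 1).pair
        (Primrec.list_length.comp (Primrec.fst.comp Primrec.snd))).to₂
    exact this.to_comp.comp (hst.comp.comp Computable.fst)
  refine (CR.poly hL (CR_x.comp Computable.snd) (fun _ => by positivity)).of_eq fun x => ?_
  unfold Zs
  rw [Kst_sum hst x.1 (fun p => bz p.length (rr x.2)), polyVal, List.map_map]
  congr 1
  refine List.map_congr_left fun y _ => ?_
  simp [bz_rpow]

theorem CR_Ws {V : Computer} {st : ℕ → List (List Bool × List Bool)} (hst : IsStage V st) :
    CR (fun x : ℕ × (ℕ × ℕ) => Ws V st x.1 (rr x.2)) := by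
  have hL : Computable (fun x : ℕ × (ℕ × ℕ) =>
      (st x.1).map (fun x => (x.1.length, x.1.length))) := by
    have h : Primrec₂ (fun (_ : List (List Bool × List Bool)) (x : List Bool × List Bool) =>
        x.1.length) := (Primrec.list_length.comp (Primrec.fst.comp Primrec.snd)).to₂
    have : Primrec (fun L : List (List Bool × List Bool) =>
        L.map (fun x => (x.1.length, x.1.length))) :=
      Primrec.list_map Primrec.id (Primrec.pair h h).to₂
    exact this.to_comp.comp (hst.comp.comp Computable.fst)
  refine (CR.poly hL (CR_x.comp Computable.snd) (fun _ => by positivity)).of_eq fun x => ?_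
  unfold Ws
  rw [Kst_sum hst x.1 (fun p => (p.length : ℝ) * bz p.length (rr x.2)), polyVal, List.map_map]
  congr 1
  refine List.map_congr_left fun y _ => ?_
  simp [bz_rpow]

theorem Zs_pos {V : Computer} {st : ℕ → List (List Bool × List Bool)} {k : ℕ}
    (h : (Kst V st k).Nonempty) (t : ℝ) : 0 < Zs V st k t :=
  Finset.sum_pos (fun _ _ => bz_pos _ _) h

theorem Ws_pos {V : Computer} (hV : Optimal V) {st : ℕ → List (List Bool × List Bool)} {k : ℕ}
    (h : (Kst V st k).Nonempty) (t : ℝ) : 0 < Ws V st k t :=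
  Finset.sum_pos (fun p _ => mul_pos (by exact_mod_cast hV.pos p.2) (bz_pos _ _)) h

theorem mkCrit {V : Computer} {T : ℝ} (h0 : 0 < T) (h1 : T < 1) {K0 : Finset V.f.Dom}
    {Φ : Finset V.f.Dom → ℝ → ℝ} {s : ℝ} {w0 : V.f.Dom → ℝ} {w : ℕ → ℝ}
    (hw : ∀ p, p ∉ K0 → w p.1.length = w0 p)
    (hcrit : ∃ C : ℝ, 0 < C ∧ ∀ K : Finset V.f.Dom, K0 ⊆ K →
      (∀ t, 0 < t → t ≤ T → Φ K t ≤ s) ∧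
      (∀ t, 0 < t → t < T → Φ K t < s) ∧
      (∀ t, T < t → t ≤ (T + 1) / 2 → s < Φ K t → ∀ p, p ∉ K → w0 p ≤ C * (t - T)) ∧
      (∀ t, T < t → t ≤ (T + 1) / 2 →
        C * (∑' p : V.f.Dom, (p.1.length : ℝ) * (2 : ℝ) ^ (-(p.1.length : ℝ) / T) -
        ∑ p ∈ K, (p.1.length : ℝ) * (2 : ℝ) ^ (-(p.1.length : ℝ) / T)) < t - T → s < Φ K t))
    {st : ℕ → List (List Bool × List Bool)} (hst : IsStage V st) (hK : ∀ k, K0 ⊆ Kst V st k)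
    {A B : ℕ → ℝ → ℝ} (hA : CR (fun x : ℕ × (ℕ × ℕ) => A x.1 (rr x.2)))
    (hB : CR (fun x : ℕ × (ℕ × ℕ) => B x.1 (rr x.2)))
    (A0 : ∀ k t, 0 < t → 0 ≤ A k t) (B0 : ∀ k t, 0 < t → 0 ≤ B k t)
    (hP : ∀ k t, 0 < t → (A k t < B k t ↔ s < Φ (Kst V st k) t))
    (hN : ∀ k t, 0 < t → (B k t < A k t ↔ Φ (Kst V st k) t < s)) :
    ∃ C, Crit V T st (fun k t => A k t < B k t) (fun k t => B k t < A k t) w (T / 2)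
      ((T + 1) / 2) C := by
  obtain ⟨C, hC0, hC⟩ := hcrit
  refine ⟨C, ⟨hst, hA.lt hB (fun x => A0 _ _ (rr_pos _)), hB.lt hA (fun x => B0 _ _ (rr_pos _)),
    by linarith, by linarith, by linarith, by linarith, hC0, ?_, ?_, ?_, ?_, ?_⟩⟩
  · intro k t h1 h2 h3
    have ht : 0 < t := by linarith
    exact absurd ((hP k t ht).1 h3) (not_lt.2 ((hC _ (hK k)).1 t ht h2))
  · intro k t h1 h2
    have ht : 0 < t := by linarith
    exact (hN k t ht).2 ((hC _ (hK k)).2.1 t ht h2)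
  · intro k t h1 h2
    exact lt_asymm h1 h2
  · intro k t p h1 h2 h3 h4
    rw [hw p (fun h => h4 (hK k h))]
    exact (hC _ (hK k)).2.2.1 t h1 h2 ((hP k t (h0.trans h1)).1 h3) p h4
  · intro k t h1 h2 h3
    exact (hP k t (h0.trans h1)).2 ((hC _ (hK k)).2.2.2 t h1 h2 h3)

theorem bz_bound {y T D : ℝ} (h0 : 0 < T) (hD : 0 < D) {n : ℕ} (h : bz y T ≤ D / 2 ^ n) :
    T * n - T * Real.logb 2 D ≤ y := by
  have h1 := Real.logb_le_logb_of_le (b := 2) (by norm_num) (bz_pos y T) h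
  unfold bz at h1
  rw [Real.logb_rpow (by norm_num) (by norm_num), Real.logb_div hD.ne' (by positivity),
    Real.logb_pow, Real.logb_self_eq_one (by norm_num), mul_one, div_le_iff₀ h0] at h1
  linarith

theorem Crit.weak {U V : Computer} (hU : Optimal U) (hV : Optimal V) {T : ℝ} (h1 : T < 1)
    {st : ℕ → List (List Bool × List Bool)}
    {Pp Nn : ℕ → ℝ → Prop} {t1 t2 C a : ℝ}
    (h : Crit V T st Pp Nn (fun l => bz (l - a) T) t1 t2 C) :
    WeaklyChaitinTRandom U T T := by
  have T0 := h.t1pos.trans h.t1T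
  obtain ⟨c, n0, hc⟩ := h.random hU hV
  refine ⟨c + n0 + ⌈T * Real.logb 2 C - a⌉₊, fun n _ => ?_⟩
  have hce := Nat.le_ceil (T * Real.logb 2 C - a)
  push_cast
  rcases le_or_gt n0 n with hn | hn
  · obtain ⟨l, hl1, hl2⟩ := hc n hn
    have e1 := bz_bound T0 h.Cpos hl1
    have e2 : (l : ℝ) ≤ complexity U (firstBits T n) + c := by exact_mod_cast hl2
    have : (0 : ℝ) ≤ n0 := by positivity
    linarith
  · have e1 : (n : ℝ) < n0 := by exact_mod_cast hn
    have e2 : (0 : ℝ) ≤ complexity U (firstBits T n) := by positivity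
    have e3 : (0 : ℝ) ≤ n := by positivity
    have e4 : (0 : ℝ) ≤ c := by positivity
    have e5 : (0 : ℝ) ≤ (⌈T * Real.logb 2 C - a⌉₊ : ℝ) := by positivity
    nlinarith

theorem Crit.strong {U V : Computer} (hU : Optimal U) (hV : Optimal V) {T : ℝ}
    {st : ℕ → List (List Bool × List Bool)}
    {Pp Nn : ℕ → ℝ → Prop} {t1 t2 C a : ℝ} {N : ℕ} (hN : a + 1 ≤ N)
    (h : Crit V T st Pp Nn (fun l => if l ≤ N then 1 else (l - a) * bz (l - a) T) t1 t2 C) :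
    ChaitinTRandom U T T := by
  have T0 := h.t1pos.trans h.t1T
  obtain ⟨c, n0, hc⟩ := h.random hU hV
  rw [ChaitinTRandom, tendsto_atTop]
  intro M
  have hC := h.Cpos
  -- choose R with T * log(R/C) + a ≥ M + c
  set R : ℝ := (2 : ℝ) ^ ((M + c - a) / T) * C with hR
  have hR0 : 0 < R := by positivity
  obtain ⟨n1, hn1⟩ := exists_pow_lt' (show 0 < 1 / C by positivity)
  obtain ⟨n2, hn2⟩ := exists_nat_ge ((R + T * Real.logb 2 C) / T)
  refine eventually_atTop.2 ⟨n0 + n1 + n2, fun n hn => ?_⟩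
  obtain ⟨l, hl1, hl2⟩ := hc n (by omega)
  have e2 : (l : ℝ) ≤ complexity U (firstBits T n) + c := by exact_mod_cast hl2
  have hn1' := hn1 n (by omega)
  have hlN : ¬ l ≤ N := by
    intro hl
    simp only [if_pos hl] at hl1
    rw [lt_div_iff₀ hC, one_div, inv_mul_eq_div] at hn1'
    linarith
  simp only [if_neg hlN] at hl1
  have hlN' : (N : ℝ) < l := by exact_mod_cast not_le.1 hlN
  have hb := bz_pos (l - a) T
  have e3 : bz (l - a) T ≤ C / 2 ^ n := by
    refine le_trans ?_ hl1
    exact le_mul_of_one_le_left hb.le (by linarith)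
  have e4 := bz_bound T0 hC e3
  have e5 : R ≤ l - a := by
    rw [div_le_iff₀ T0] at hn2
    have : (n2 : ℝ) ≤ n := by exact_mod_cast (show n2 ≤ n by omega)
    nlinarith
  have e6 : bz (l - a) T ≤ (C / R) / 2 ^ n := by
    rw [div_right_comm, le_div_iff₀ hR0]
    refine le_trans ?_ hl1
    rw [mul_comm]
    exact mul_le_mul_of_nonneg_right e5 hb.le
  have e7 := bz_bound T0 (by positivity) e6
  have e8 : Real.logb 2 (C / R) = -((M + c - a) / T) := by
    rw [hR, Real.logb_div hC.ne' (by positivity), Real.logb_mul (by positivity) hC.ne',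
      Real.logb_rpow (by norm_num) (by norm_num)]
    ring
  rw [e8, mul_neg, mul_div_cancel₀ _ T0.ne'] at e7
  linarith

end Instances

section Subsets

variable {U V : Computer} {T : ℝ}

theorem hasSum_Z (hV : Optimal V) (h0 : 0 < T) (h1 : T < 1) :
    HasSum (fun p : V.f.Dom => bz p.1.length T) (Zfun V T) := by
  have := summable_pow_exp (kraft_summable hV) 0 h0 h1
  simp only [pow_zero, one_mul] at this
  exact this.hasSum

theorem hasSum_W (hV : Optimal V) (h0 : 0 < T) (h1 : T < 1) :
    HasSum (fun p : V.f.Dom => (p.1.length : ℝ) * bz p.1.length T)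
      (∑' p : V.f.Dom, (p.1.length : ℝ) * boltzmann T p.1) :=
  (summable_len hV h0 h1).hasSum

theorem Zfun_gt (hV : Optimal V) (h0 : 0 < T) (h1 : T < 1) (p : V.f.Dom) :
    bz p.1.length T < Zfun V T := by
  classical
  have := dom_infinite hV
  obtain ⟨q, hq⟩ := exists_ne p
  have h := (hasSum_Z hV h0 h1).summable.sum_le_tsum {p, q} (fun i _ => (bz_pos _ _).le)
  rw [Finset.sum_pair hq.symm] at h
  have h2 : bz p.1.length T + bz q.1.length T ≤ Zfun V T := h
  have := bz_pos q.1.length T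
  linarith

theorem Zfun_pos (hV : Optimal V) (h0 : 0 < T) (h1 : T < 1) : 0 < Zfun V T := by
  obtain ⟨p, hp⟩ := V.dom_nonempty
  exact (bz_pos _ _).trans (Zfun_gt hV h0 h1 ⟨p, hp⟩)

theorem Zfun_lt_one (hV : Optimal V) (h0 : 0 < T) (h1 : T < 1) : Zfun V T < 1 := by
  refine lt_of_lt_of_le ?_ (kraft_tsum hV)
  have hle : ∀ p : V.f.Dom, bz p.1.length T < (1 / 2 : ℝ) ^ p.1.length := fun p => by
    rw [half_pow_eq]
    unfold bz
    refine Real.rpow_lt_rpow_of_exponent_lt (by norm_num) ?_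
    have : (0 : ℝ) < p.1.length := by exact_mod_cast hV.pos p.2
    rw [neg_div, neg_lt_neg_iff, lt_div_iff₀ h0]
    nlinarith
  obtain ⟨p, hp⟩ := V.dom_nonempty
  exact Summable.tsum_lt_tsum (fun p => (hle p).le) (hle ⟨p, hp⟩)
    (hasSum_Z hV h0 h1).summable (kraft_summable hV)

theorem Ffun_pos (hV : Optimal V) (h0 : 0 < T) (h1 : T < 1) : 0 < Ffun V T := by
  have := Real.logb_neg (b := 2) (by norm_num) (Zfun_pos hV h0 h1) (Zfun_lt_one hV h0 h1)
  unfold Ffun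
  nlinarith

theorem Ffun_lt (hV : Optimal V) (h0 : 0 < T) (h1 : T < 1) (p : V.f.Dom) :
    Ffun V T < p.1.length := by
  have h := Real.logb_lt_logb (b := 2) (by norm_num) (bz_pos _ _) (Zfun_gt hV h0 h1 p)
  unfold bz at h
  rw [Real.logb_rpow (by norm_num) (by norm_num), div_lt_iff₀ h0] at h
  unfold Ffun
  linarith

theorem Z_F (hV : Optimal V) (h0 : 0 < T) (h1 : T < 1) :
    Zfun V T * (2 : ℝ) ^ (Ffun V T / T) = 1 := by
  have hZ := Zfun_pos hV h0 h1
  have : Ffun V T / T = -Real.logb 2 (Zfun V T) := by unfold Ffun; field_simp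
  rw [this, Real.rpow_neg (by norm_num), Real.rpow_logb (by norm_num) (by norm_num) hZ,
    mul_inv_cancel₀ hZ.ne']

theorem Efun_mul (hV : Optimal V) (h0 : 0 < T) (h1 : T < 1) :
    ∑' p : V.f.Dom, (p.1.length : ℝ) * boltzmann T p.1 = Efun V T * Zfun V T := by
  have hZ := Zfun_pos hV h0 h1
  unfold Efun
  field_simp

theorem Ffun_lt_Efun (hV : Optimal V) (h0 : 0 < T) (h1 : T < 1) : Ffun V T < Efun V T := by
  have hZ := Zfun_pos hV h0 h1
  refine lt_of_mul_lt_mul_right ?_ hZ.le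
  rw [← Efun_mul hV h0 h1]
  have hlt : ∀ p : V.f.Dom, Ffun V T * bz p.1.length T < (p.1.length : ℝ) * bz p.1.length T :=
    fun p => mul_lt_mul_of_pos_right (Ffun_lt hV h0 h1 p) (bz_pos _ _)
  obtain ⟨p, hp⟩ := V.dom_nonempty
  exact hasSum_lt (fun p => (hlt p).le) (hlt ⟨p, hp⟩) ((hasSum_Z hV h0 h1).mul_left _)
    (hasSum_W hV h0 h1)

theorem Efun_pos (hV : Optimal V) (h0 : 0 < T) (h1 : T < 1) : 0 < Efun V T :=
  (Ffun_pos hV h0 h1).trans (Ffun_lt_Efun hV h0 h1)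

theorem Sfun_pos (hV : Optimal V) (h0 : 0 < T) (h1 : T < 1) : 0 < Sfun V T :=
  div_pos (sub_pos.2 (Ffun_lt_Efun hV h0 h1)) h0

theorem len_one (hV : Optimal V) (p : V.f.Dom) : 1 ≤ p.1.length := hV.pos p.2

theorem setZ_sub (hU : Optimal U) (hV : Optimal V) : setZ V ⊆ FPw U := by
  rintro T ⟨⟨h0, h1⟩, hc⟩
  have hZ := Zfun_pos hV h0 h1
  obtain ⟨K0, i0, hi0, hi1, hK0⟩ := exists_K0 hV 0
  obtain ⟨st, hst, hK⟩ := exists_stage_containing V K0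
  have hcrit := lin_criterion (kraft_summable hV) (len_one hV) h0 (t2 := (T + 1) / 2)
    (by linarith) (by linarith) 0 zero_le_one (h := fun _ => 1)
    (fun p => by rw [abs_one, one_mul]; exact_mod_cast len_one hV p)
    (fun p => by rw [one_mul, sub_zero]; positivity) (b := Zfun V T)
    (by simpa using hasSum_Z hV h0 h1) (K0 := K0) (fun _ _ => zero_le_one) hi0 one_pos
    (by rw [sub_zero]; exact_mod_cast hi1)
  obtain ⟨C, hC⟩ := mkCrit h0 h1 (w := fun l => bz (l - 0) T) (fun p _ => (one_mul _).symm) hcrit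
    hst hK (A := fun _ _ => Zfun V T) (B := fun k t => Zs V st k t) (CR.const hc hZ) (CR_Zs hst)
    (fun _ _ _ => hZ.le) (fun k t _ => (Zs_pos ⟨i0, hK k hi0⟩ t).le)
    (fun k t _ => by simp [Zs]) (fun k t _ => by simp [Zs])
  exact ⟨⟨h0, h1⟩, hC.weak hU hV h1, hC.compressible hU hV⟩

theorem setF_sub (hU : Optimal U) (hV : Optimal V) : setF V ⊆ FPw U := by
  rintro T ⟨⟨h0, h1⟩, hc⟩
  have hF := Ffun_pos hV h0 h1
  have hFl := Ffun_lt hV h0 h1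
  set F := Ffun V T with hFd
  obtain ⟨K0, i0, hi0, hi1, hK0⟩ := exists_K0 hV 0
  obtain ⟨st, hst, hK⟩ := exists_stage_containing V K0
  have hcrit := lin_criterion (kraft_summable hV) (len_one hV) h0 (t2 := (T + 1) / 2)
    (by linarith) (by linarith) F zero_le_one (h := fun _ => 1)
    (fun p => by rw [abs_one, one_mul]; exact_mod_cast len_one hV p)
    (fun p => by rw [one_mul]; have := hFl p; linarith) (b := 1)
    (by
      have := (hasSum_Z hV h0 h1).mul_right ((2 : ℝ) ^ (F / T))
      rw [Z_F hV h0 h1] at this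
      simpa only [one_mul, bz_sub] using this) (K0 := K0) (fun _ _ => zero_le_one) hi0 one_pos
    (by have := hFl i0; linarith)
  have hsum : ∀ k t, ∑ p ∈ Kst V st k, 1 * bz (p.1.length - F) t =
      Zs V st k t * (2 : ℝ) ^ (F * t⁻¹) := fun k t => by
    unfold Zs
    rw [Finset.sum_mul]
    refine Finset.sum_congr rfl fun p _ => ?_
    rw [one_mul, bz_sub, div_eq_mul_inv]
  have hFr : ∀ x : ℕ × (ℕ × ℕ), 0 < F * (rr x.2)⁻¹ := fun x =>
    mul_pos hF (inv_pos.2 (rr_pos _))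
  have hZp : ∀ k t, 0 < Zs V st k t := fun k t => Zs_pos ⟨i0, hK k hi0⟩ t
  have hB : CR (fun x : ℕ × (ℕ × ℕ) => Zs V st x.1 (rr x.2) * (2 : ℝ) ^ (F * (rr x.2)⁻¹)) :=
    CR.mul (CR_Zs hst) (CR.exp2 (CR.mul (CR.const hc hF)
      ((CR_rr.comp Computable.snd).inv (fun x => rr_pos _)) (fun _ => hF)
      (fun x => inv_pos.2 (rr_pos _))) hFr) (fun x => hZp _ _) (fun x => by positivity)
  obtain ⟨C, hC⟩ := mkCrit h0 h1 (w := fun l => bz (l - F) T) (fun p _ => (one_mul _).symm) hcrit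
    hst hK (A := fun _ _ => 1) (B := fun k t => Zs V st k t * (2 : ℝ) ^ (F * t⁻¹))
    ((CR.natConst 1).of_eq fun _ => by simp) hB
    (fun _ _ _ => zero_le_one) (fun k t _ => mul_nonneg (hZp k t).le (by positivity))
    (fun k t _ => by rw [hsum]) (fun k t _ => by rw [hsum])
  exact ⟨⟨h0, h1⟩, hC.weak hU hV h1, hC.compressible hU hV⟩

theorem hasSum_Y (hV : Optimal V) (h0 : 0 < T) (h1 : T < 1) :
    HasSum (fun p : V.f.Dom => ((p.1.length : ℝ) - Efun V T) * bz (p.1.length - Efun V T) T) 0 := by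
  have h := ((hasSum_W hV h0 h1).sub ((hasSum_Z hV h0 h1).mul_left (Efun V T))).mul_right
    ((2 : ℝ) ^ (Efun V T / T))
  rw [Efun_mul hV h0 h1, sub_self, zero_mul] at h
  have e : (fun p : V.f.Dom => ((p.1.length : ℝ) - Efun V T) * bz (p.1.length - Efun V T) T) =
      fun p : V.f.Dom => ((p.1.length : ℝ) * bz p.1.length T - Efun V T * bz p.1.length T) *
        (2 : ℝ) ^ (Efun V T / T) := by
    funext p
    rw [bz_sub]; ring
  rw [e]; exact h

theorem hasSum_X (hV : Optimal V) (h0 : 0 < T) (h1 : T < 1) (a : ℝ) :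
    HasSum (fun p : V.f.Dom => bz (p.1.length - a) T) (Zfun V T * (2 : ℝ) ^ (a / T)) := by
  simp only [bz_sub]
  exact (hasSum_Z hV h0 h1).mul_right ((2 : ℝ) ^ (a / T))

theorem sum_X (V : Computer) (st : ℕ → List (List Bool × List Bool)) (a : ℝ) (k : ℕ) (t : ℝ) :
    ∑ p ∈ Kst V st k, bz (p.1.length - a) t = Zs V st k t * (2 : ℝ) ^ (a / t) := by
  unfold Zs
  rw [Finset.sum_mul]
  exact Finset.sum_congr rfl fun p _ => by rw [bz_sub]

theorem sum_Y (V : Computer) (st : ℕ → List (List Bool × List Bool)) (a : ℝ) (k : ℕ) (t : ℝ) :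
    ∑ p ∈ Kst V st k, ((p.1.length : ℝ) - a) * bz (p.1.length - a) t =
      (Ws V st k t - a * Zs V st k t) * (2 : ℝ) ^ (a / t) := by
  unfold Zs Ws
  rw [Finset.mul_sum, ← Finset.sum_sub_distrib, Finset.sum_mul]
  exact Finset.sum_congr rfl fun p _ => by rw [bz_sub]; ring

theorem setE_sub (hU : Optimal U) (hV : Optimal V) : setE V ⊆ FP U := by
  rintro T ⟨⟨h0, h1⟩, hc⟩
  have hE := Efun_pos hV h0 h1
  have hY := hasSum_Y hV h0 h1
  set a := Efun V T with ha
  obtain ⟨N, hN⟩ := exists_nat_ge (a + 1)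
  obtain ⟨K0, i0, hi0, hi1, hK0⟩ := exists_K0 hV N
  obtain ⟨st, hst, hK⟩ := exists_stage_containing V K0
  have hgt : ∀ p : V.f.Dom, N < p.1.length → 0 < (p.1.length : ℝ) - a := fun p hp => by
    have : (N : ℝ) < p.1.length := by exact_mod_cast hp
    linarith
  have hcrit := lin_criterion (kraft_summable hV) (len_one hV) h0 (t2 := (T + 1) / 2)
    (by linarith) (by linarith) a (H := 1 + a) (by linarith)
    (h := fun p => (p.1.length : ℝ) - a)
    (fun p => by
      have : (1 : ℝ) ≤ p.1.length := by exact_mod_cast len_one hV p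
      rw [abs_le]; constructor <;> nlinarith)
    (fun p => mul_self_nonneg _) (b := 0) hY (K0 := K0) (fun p hp => (hgt p (hK0 p hp)).le) hi0
    (hgt _ hi1) (hgt _ hi1)
  have hZp : ∀ k t, 0 < Zs V st k t := fun k t => Zs_pos ⟨i0, hK k hi0⟩ t
  obtain ⟨C, hC⟩ := mkCrit h0 h1
    (w := fun l => if l ≤ N then 1 else (l - a) * bz (l - a) T)
    (fun p hp => by simp only [if_neg (not_le.2 (hK0 p hp))]) hcrit
    hst hK (A := fun k t => a * Zs V st k t) (B := fun k t => Ws V st k t)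
    (CR.mul (CR.const hc hE) (CR_Zs hst) (fun _ => hE) (fun _ => hZp _ _)) (CR_Ws hst)
    (fun k t _ => (mul_pos hE (hZp k t)).le)
    (fun k t _ => (Ws_pos hV ⟨i0, hK k hi0⟩ t).le)
    (fun k t _ => by
      rw [sum_Y, mul_pos_iff_of_pos_right (by positivity), sub_pos])
    (fun k t _ => by
      rw [sum_Y, ← neg_pos, ← neg_mul, mul_pos_iff_of_pos_right (by positivity), neg_pos, sub_neg])
  exact ⟨⟨h0, h1⟩, hC.strong hU hV hN, hC.compressible hU hV⟩

theorem setS_sub (hU : Optimal U) (hV : Optimal V) : setS V ⊆ FP U := by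
  rintro T ⟨⟨h0, h1⟩, hc⟩
  have hS := Sfun_pos hV h0 h1
  have hE := Efun_pos hV h0 h1
  have hY := hasSum_Y hV h0 h1
  have hZ := Zfun_pos hV h0 h1
  have hln := ln2_pos
  set a := Efun V T with ha
  obtain ⟨N, hN⟩ := exists_nat_ge (a + 1)
  obtain ⟨K0, i0, hi0, hi1, hK0⟩ := exists_K0 hV N
  obtain ⟨st, hst, hK⟩ := exists_stage_containing V K0
  have hgt : ∀ p : V.f.Dom, N < p.1.length → 0 < (p.1.length : ℝ) - a := fun p hp => by
    have : (N : ℝ) < p.1.length := by exact_mod_cast hp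
    linarith
  have hs : Sfun V T = Real.log (Zfun V T * (2 : ℝ) ^ (a / T)) / Real.log 2 := by
    rw [Real.log_mul hZ.ne' (by positivity), Real.log_rpow (by norm_num)]
    unfold Sfun Ffun Real.logb
    rw [← ha]
    field_simp
    ring
  have hcrit := ent_criterion (kraft_summable hV) (len_one hV) h0 (t2 := (T + 1) / 2)
    (by linarith) (by linarith) a (hasSum_X hV h0 h1 a) hY (K0 := K0)
    (fun p hp => (hgt p (hK0 p hp)).le) hi0 (hgt _ hi1) (fun _ _ => rfl) hs
  have hZp : ∀ k t, 0 < Zs V st k t := fun k t => Zs_pos ⟨i0, hK k hi0⟩ t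
  have hWp : ∀ k t, 0 < Ws V st k t := fun k t => Ws_pos hV ⟨i0, hK k hi0⟩ t
  have hform : ∀ k t, 0 < t → Real.log ((2 : ℝ) ^ (Ws V st k t * (t * Zs V st k t)⁻¹) *
      Zs V st k t) / Real.log 2 =
      (∑ p ∈ Kst V st k, ((p.1.length : ℝ) - a) * bz (p.1.length - a) t) /
        (t * ∑ p ∈ Kst V st k, bz (p.1.length - a) t) +
      Real.log (∑ p ∈ Kst V st k, bz (p.1.length - a) t) / Real.log 2 := by
    intro k t ht
    have hz := hZp k t
    have h2 : (0 : ℝ) < (2 : ℝ) ^ (a / t) := by positivity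
    rw [sum_X, sum_Y, Real.log_mul (by positivity) hz.ne', Real.log_mul hz.ne' (by positivity),
      Real.log_rpow (by norm_num), Real.log_rpow (by norm_num)]
    field_simp
    ring
  have hform2 : Real.log ((2 : ℝ) ^ Sfun V T) / Real.log 2 = Sfun V T := by
    rw [Real.log_rpow (by norm_num)]; field_simp
  have hpos : ∀ k t, 0 < (2 : ℝ) ^ (Ws V st k t * (t * Zs V st k t)⁻¹) * Zs V st k t :=
    fun k t => mul_pos (by positivity) (hZp k t)
  have hpos2 : 0 < (2 : ℝ) ^ Sfun V T := by positivity
  have hrz : ∀ x : ℕ × (ℕ × ℕ), 0 < rr x.2 * Zs V st x.1 (rr x.2) := fun x =>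
    mul_pos (rr_pos _) (hZp _ _)
  have hB : CR (fun x : ℕ × (ℕ × ℕ) => (2 : ℝ) ^ (Ws V st x.1 (rr x.2) *
      (rr x.2 * Zs V st x.1 (rr x.2))⁻¹) * Zs V st x.1 (rr x.2)) :=
    CR.mul (CR.exp2 (CR.mul (CR_Ws hst) (CR.inv (CR.mul (CR_rr.comp Computable.snd) (CR_Zs hst)
      (fun _ => rr_pos _) (fun _ => hZp _ _)) hrz) (fun _ => hWp _ _)
      (fun x => inv_pos.2 (hrz x)))
      (fun x => mul_pos (hWp _ _) (inv_pos.2 (hrz x)))) (CR_Zs hst) (fun _ => by positivity)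
      (fun _ => hZp _ _)
  obtain ⟨C, hC⟩ := mkCrit h0 h1
    (w := fun l => if l ≤ N then 1 else (l - a) * bz (l - a) T)
    (fun p hp => by simp only [if_neg (not_le.2 (hK0 p hp))]) hcrit
    hst hK (A := fun k t => (2 : ℝ) ^ Sfun V T)
    (B := fun k t => (2 : ℝ) ^ (Ws V st k t * (t * Zs V st k t)⁻¹) * Zs V st k t)
    (CR.exp2 (CR.const hc hS) (fun _ => hS)) hB
    (fun k t _ => hpos2.le) (fun k t _ => (hpos k t).le)
    (fun k t ht => by
      rw [← hform k t ht, ← Real.log_lt_log_iff hpos2 (hpos k t)]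
      nth_rewrite 2 [← hform2]
      rw [div_lt_div_iff_of_pos_right hln])
    (fun k t ht => by
      rw [← hform k t ht, ← Real.log_lt_log_iff (hpos k t) hpos2]
      nth_rewrite 2 [← hform2]
      rw [div_lt_div_iff_of_pos_right hln])
  exact ⟨⟨h0, h1⟩, hC.strong hU hV hN, hC.compressible hU hV⟩

end Subsets

section Sequence

/-- Strip one code word of the two word prefix code `{1, 01}`. -/
def strip : List Bool → Option (List Bool)
  | true :: p => some p
  | false :: true :: p => some p
  | _ => none

theorem strip_eq_some {p q : List Bool} :
    strip p = some q ↔ p = true :: q ∨ p = false :: true :: q := by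
  match p with
  | [] => simp [strip]
  | true :: p => simp [strip]
  | [false] => simp [strip]
  | false :: true :: p => simp [strip]
  | false :: false :: p => simp [strip]

theorem prim_strip : Primrec strip := by
  have h1 : Primrec (fun p : List Bool => if p.head? = some true then some p.tail else
      if p.head? = some false ∧ p.tail.head? = some true then some p.tail.tail else none) := by
    refine Primrec.ite (Primrec.eq.comp Primrec.list_head? (Primrec.const _))
      (Primrec.option_some.comp Primrec.list_tail) (Primrec.ite ?_
      (Primrec.option_some.comp (Primrec.list_tail.comp Primrec.list_tail)) (Primrec.const _))
    exact PrimrecPred.and (Primrec.eq.comp Primrec.list_head? (Primrec.const _))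
      (Primrec.eq.comp (Primrec.list_head?.comp Primrec.list_tail) (Primrec.const _))
  refine h1.of_eq fun p => ?_
  match p with
  | [] => simp [strip]
  | true :: p => simp [strip]
  | [false] => simp [strip]
  | false :: true :: p => simp [strip]
  | false :: false :: p => simp [strip]

/-- Iterated stripping. -/
def stripN (p : List Bool) (n : ℕ) : Option (List Bool) :=
  n.rec (motive := fun _ => Option (List Bool)) (some p) fun _ o => o.bind strip

theorem stripN_succ (p : List Bool) (n : ℕ) :
    stripN p (n + 1) = (strip p).bind (fun q => stripN q n) := by
  induction n with
  | zero =>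
    show (some p).bind strip = (strip p).bind (fun q => some q)
    rw [Option.bind_some]; cases strip p <;> rfl
  | succ n ih =>
    show (stripN p (n + 1)).bind strip = (strip p).bind (fun q => (stripN q n).bind strip)
    rw [ih, Option.bind_assoc]

theorem comp_stripN : Computable (fun x : ℕ × List Bool => stripN x.2 x.1) := by
  have : Primrec₂ stripN :=
    Primrec.nat_rec (f := fun p : List Bool => some p)
      (g := fun _ x => x.2.bind strip) Primrec.option_some
      (Primrec.option_bind (Primrec.snd.comp Primrec.snd) (prim_strip.comp Primrec.snd).to₂).to₂
  exact (this.comp Primrec.snd Primrec.fst).to_comp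

theorem nextC_dom {V : Computer} {p : List Bool} :
    ((strip p : Part (List Bool)).bind (fun q => V.f q)).Dom ↔
      ∃ q ∈ V.f.Dom, p = true :: q ∨ p = false :: true :: q := by
  rcases h : strip p with _ | q
  · simp only [Part.coe_none, Part.bind_none]
    constructor
    · intro h'; exact absurd h' (by simp)
    · rintro ⟨q, _, hq⟩
      rw [strip_eq_some.2 hq] at h
      cases h
  · simp only [Part.coe_some, Part.bind_some]
    constructor
    · intro h'; exact ⟨q, h', strip_eq_some.1 h⟩
    · rintro ⟨q', hq, hq'⟩
      rw [strip_eq_some.2 hq'] at h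
      cases h
      exact hq

/-- The next computer of the sequence. -/
def nextC (V : Computer) : Computer where
  f := fun p => (strip p : Part (List Bool)).bind (fun q => V.f q)
  partrec := (Computable.ofOption prim_strip.to_comp).bind (V.partrec.comp Computable.snd).to₂
  dom_nonempty := by
    obtain ⟨p, hp⟩ := V.dom_nonempty
    exact ⟨true :: p, nextC_dom.2 ⟨p, hp, Or.inl rfl⟩⟩
  dom_prefixFree := by
    intro p hp q hq hpq
    obtain ⟨p', hp', rfl | rfl⟩ := nextC_dom.1 hp <;>
    obtain ⟨q', hq', rfl | rfl⟩ := nextC_dom.1 hq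
    · rw [V.dom_prefixFree _ hp' _ hq' (List.cons_prefix_cons.1 hpq).2]
    · exact absurd (List.cons_prefix_cons.1 hpq).1 (by simp)
    · exact absurd (List.cons_prefix_cons.1 hpq).1 (by simp)
    · rw [V.dom_prefixFree _ hp' _ hq'
        (List.cons_prefix_cons.1 (List.cons_prefix_cons.1 hpq).2).2]

theorem nextC_optimal {V : Computer} (hV : Optimal V) : Optimal (nextC V) := by
  intro C
  obtain ⟨d, hd⟩ := hV C
  refine ⟨d + 1, fun p hp => ?_⟩
  obtain ⟨q, hq, hl⟩ := hd p hp
  refine ⟨true :: q, ?_, by simp only [List.length_cons]; omega⟩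
  rw [← hq]
  simp [nextC, strip]

/-- The sequence of computers. -/
def Vseq (U : Computer) (n : ℕ) : Computer :=
  n.rec (motive := fun _ => Computer) U fun _ V => nextC V

theorem Vseq_optimal {U : Computer} (hU : Optimal U) (n : ℕ) : Optimal (Vseq U n) := by
  induction n with
  | zero => exact hU
  | succ n ih => exact nextC_optimal ih

theorem Vseq_recursive (U : Computer) : RecursiveSeq (Vseq U) := by
  refine ⟨fun x => (stripN x.2 x.1 : Part (List Bool)).bind (fun q => U.f q),
    (Computable.ofOption comp_stripN).bind (U.partrec.comp Computable.snd).to₂, fun n => ?_⟩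
  induction n with
  | zero => intro p; simp [stripN, Vseq]
  | succ n ih =>
    intro p
    show (strip p : Part (List Bool)).bind (fun q => (Vseq U n).f q) = _
    simp only [stripN_succ]
    cases strip p with
    | none => simp
    | some q => simpa using ih q

theorem nextC_hasSum {V : Computer} {g : ℕ → ℝ} {A B : ℝ}
    (hA : HasSum (fun p : V.f.Dom => g (p.1.length + 1)) A)
    (hB : HasSum (fun p : V.f.Dom => g (p.1.length + 2)) B) :
    HasSum (fun p : (nextC V).f.Dom => g p.1.length) (A + B) := by
  let e : V.f.Dom ⊕ V.f.Dom → (nextC V).f.Dom := Sum.elim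
    (fun p => ⟨true :: p.1, nextC_dom.2 ⟨p.1, p.2, Or.inl rfl⟩⟩)
    (fun p => ⟨false :: true :: p.1, nextC_dom.2 ⟨p.1, p.2, Or.inr rfl⟩⟩)
  have he : Function.Bijective e := by
    constructor
    · rintro (⟨p, hp⟩ | ⟨p, hp⟩) (⟨q, hq⟩ | ⟨q, hq⟩) h <;>
        have h' := congrArg Subtype.val h <;> simp [e] at h' <;> subst h' <;> rfl
    · rintro ⟨p, hp⟩
      obtain ⟨q, hq, rfl | rfl⟩ := nextC_dom.1 hp
      · exact ⟨Sum.inl ⟨q, hq⟩, rfl⟩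
      · exact ⟨Sum.inr ⟨q, hq⟩, rfl⟩
  rw [← (Equiv.ofBijective e he).hasSum_iff]
  exact HasSum.sum hA hB

/-- The base `2^(-1/t)`. -/
noncomputable def xx (t : ℝ) : ℝ := ((2 : ℝ) ^ t⁻¹)⁻¹

theorem xx_pos (t : ℝ) : 0 < xx t := by unfold xx; positivity

theorem xx_lt_one {t : ℝ} (ht : 0 < t) : xx t < 1 :=
  inv_lt_one_of_one_lt₀ (Real.one_lt_rpow (by norm_num) (inv_pos.2 ht))

theorem xx_strictMono : StrictMonoOn xx (Set.Ioi 0) := by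
  intro s hs t ht hst
  have hs' : 0 < s := hs
  unfold xx
  refine inv_strictAnti₀ (by positivity) ?_
  exact Real.rpow_lt_rpow_of_exponent_lt (by norm_num) (inv_strictAnti₀ hs' hst)

theorem log_xx (t : ℝ) : Real.log (xx t) = - (t⁻¹ * Real.log 2) := by
  unfold xx; rw [Real.log_inv, Real.log_rpow (by norm_num)]

variable {V : Computer} {T : ℝ}

theorem bz_add (l k : ℕ) (T : ℝ) : bz ((l + k : ℕ) : ℝ) T = xx T ^ k * bz l T := by
  rw [bz_rpow, bz_rpow]; unfold xx; ring

theorem next_Z (hV : Optimal V) (h0 : 0 < T) (h1 : T < 1) :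
    Zfun (nextC V) T = (xx T + xx T ^ 2) * Zfun V T := by
  have h := hasSum_Z hV h0 h1
  have key : ∀ k : ℕ, HasSum (fun p : V.f.Dom => bz ((p.1.length + k : ℕ) : ℝ) T)
      (xx T ^ k * Zfun V T) := by
    intro k
    have e : (fun p : V.f.Dom => bz ((p.1.length + k : ℕ) : ℝ) T) =
        fun p => xx T ^ k * bz p.1.length T := by
      funext p; exact bz_add _ _ _
    rw [e]; exact h.mul_left _
  have h2 := nextC_hasSum (g := fun l => bz l T) (key 1) (key 2)
  have h3 := hasSum_Z (nextC_optimal hV) h0 h1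
  rw [h3.unique h2]; ring

theorem next_W (hV : Optimal V) (h0 : 0 < T) (h1 : T < 1) :
    Efun (nextC V) T * Zfun (nextC V) T = (xx T + xx T ^ 2) * (Efun V T * Zfun V T) +
      (xx T + 2 * xx T ^ 2) * Zfun V T := by
  have hz := hasSum_Z hV h0 h1
  have hw := hasSum_W hV h0 h1
  rw [Efun_mul hV h0 h1] at hw
  have key : ∀ k : ℕ, HasSum (fun p : V.f.Dom => ((p.1.length + k : ℕ) : ℝ) *
      bz ((p.1.length + k : ℕ) : ℝ) T)
      (xx T ^ k * (Efun V T * Zfun V T) + k * xx T ^ k * Zfun V T) := by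
    intro k
    have e : (fun p : V.f.Dom => ((p.1.length + k : ℕ) : ℝ) *
      bz ((p.1.length + k : ℕ) : ℝ) T) =
        fun p => xx T ^ k * ((p.1.length : ℝ) * bz p.1.length T) +
          k * xx T ^ k * bz p.1.length T := by
      funext p; rw [bz_add]; push_cast; ring
    rw [e]; exact (hw.mul_left _).add (hz.mul_left _)
  have h2 := nextC_hasSum (g := fun l => (l : ℝ) * bz l T) (key 1) (key 2)
  have h3 := hasSum_W (nextC_optimal hV) h0 h1
  rw [Efun_mul (nextC_optimal hV) h0 h1] at h3
  rw [h3.unique h2]; push_cast; ring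

theorem next_E (hV : Optimal V) (h0 : 0 < T) (h1 : T < 1) :
    Efun (nextC V) T = Efun V T + (1 + xx T * (1 + xx T)⁻¹) := by
  have hw := next_W hV h0 h1
  have hx := xx_pos T
  have hz := Zfun_pos hV h0 h1
  rw [next_Z hV h0 h1] at hw
  have h2 : (xx T + xx T ^ 2) * Zfun V T ≠ 0 := by positivity
  apply mul_right_cancel₀ h2
  rw [hw]; field_simp; ring

theorem next_F (hV : Optimal V) (h0 : 0 < T) (h1 : T < 1) :
    Ffun (nextC V) T = Ffun V T + (1 - T * Real.logb 2 (1 + xx T)) := by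
  have hx := xx_pos T
  have hz := Zfun_pos hV h0 h1
  have l2 := ln2_pos
  unfold Ffun
  rw [next_Z hV h0 h1, show (xx T + xx T ^ 2) = xx T * (1 + xx T) by ring]
  simp only [Real.logb]
  rw [Real.log_mul (by positivity) (by positivity), Real.log_mul (by positivity) (by positivity),
    log_xx]
  field_simp; ring

theorem next_S (hV : Optimal V) (h0 : 0 < T) (h1 : T < 1) :
    Sfun (nextC V) T = Sfun V T + (xx T * (1 + xx T)⁻¹ * T⁻¹ + Real.logb 2 (1 + xx T)) := by
  unfold Sfun
  rw [next_E hV h0 h1, next_F hV h0 h1]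
  field_simp; ring

variable {U : Computer}

theorem seq_Z (hU : Optimal U) (h0 : 0 < T) (h1 : T < 1) (i d : ℕ) :
    Zfun (Vseq U (i + d)) T = (xx T + xx T ^ 2) ^ d * Zfun (Vseq U i) T := by
  induction d with
  | zero => simp
  | succ d ih =>
    have := next_Z (Vseq_optimal hU (i + d)) h0 h1
    rw [pow_succ, mul_comm (_ ^ d), mul_assoc, ← ih]; exact this

theorem seq_E (hU : Optimal U) (h0 : 0 < T) (h1 : T < 1) (i d : ℕ) :
    Efun (Vseq U (i + d)) T = Efun (Vseq U i) T + d * (1 + xx T * (1 + xx T)⁻¹) := by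
  induction d with
  | zero => simp
  | succ d ih =>
    have := next_E (Vseq_optimal hU (i + d)) h0 h1
    show Efun (nextC (Vseq U (i + d))) T = _
    rw [this, ih]; push_cast; ring

theorem seq_F (hU : Optimal U) (h0 : 0 < T) (h1 : T < 1) (i d : ℕ) :
    Ffun (Vseq U (i + d)) T =
      Ffun (Vseq U i) T + d * (1 - T * Real.logb 2 (1 + xx T)) := by
  induction d with
  | zero => simp
  | succ d ih =>
    have := next_F (Vseq_optimal hU (i + d)) h0 h1
    show Ffun (nextC (Vseq U (i + d))) T = _
    rw [this, ih]; push_cast; ring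

theorem seq_S (hU : Optimal U) (h0 : 0 < T) (h1 : T < 1) (i d : ℕ) :
    Sfun (Vseq U (i + d)) T = Sfun (Vseq U i) T +
      d * (xx T * (1 + xx T)⁻¹ * T⁻¹ + Real.logb 2 (1 + xx T)) := by
  induction d with
  | zero => simp
  | succ d ih =>
    have := next_S (Vseq_optimal hU (i + d)) h0 h1
    show Sfun (nextC (Vseq U (i + d))) T = _
    rw [this, ih]; push_cast; ring

end Sequence

section Disjoint

theorem weak_of_chaitin {U : Computer} {T : ℝ} (h0 : 0 < T) (h : ChaitinTRandom U T T) :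
    WeaklyChaitinTRandom U T T := by
  obtain ⟨n0, hn0⟩ := eventually_atTop.1 (h.eventually_ge_atTop 0)
  obtain ⟨c, hc⟩ := exists_nat_ge (T * n0)
  refine ⟨c, fun n _ => ?_⟩
  rcases le_total n0 n with hn | hn
  · have := hn0 n hn
    have hc0 : (0 : ℝ) ≤ c := Nat.cast_nonneg c
    linarith
  · have h1 : T * n ≤ T * n0 := mul_le_mul_of_nonneg_left (by exact_mod_cast hn) h0.le
    have h2 : (0 : ℝ) ≤ (complexity U (firstBits T n) : ℝ) := Nat.cast_nonneg _
    linarith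

theorem notrand {U : Computer} (hU : Optimal U) {T : ℝ} (h0 : 0 < T) (h1 : T < 1)
    {A B Φ : ℝ → ℝ} (hA : CR (fun u => A (rr u))) (hB : CR (fun u => B (rr u)))
    (A0 : ∀ t, 0 < t → 0 < A t) (B0 : ∀ t, 0 < t → 0 < B t)
    (hΦ : StrictMonoOn Φ (Set.Ioi 0)) (h : ∀ t, 0 < t → (A t < B t ↔ Φ T < Φ t))
    (h' : ∀ t, 0 < t → (B t < A t ↔ Φ t < Φ T)) : ¬ WeaklyChaitinTRandom U T T := by
  refine not_weakRandom hU h0 h1 (P := fun t => A t < B t) (N := fun t => B t < A t)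
    (hA.lt hB fun u => (A0 _ (rr_pos u)).le) (hB.lt hA fun u => (B0 _ (rr_pos u)).le) ?_ ?_
  · intro t ht
    exact (h t ht).trans (hΦ.lt_iff_lt h0 ht)
  · intro t ht
    exact (h' t ht).trans (hΦ.lt_iff_lt ht h0)

theorem CR_xx : CR (fun u : ℕ × ℕ => xx (rr u)) := CR_x

theorem CR_1x : CR (fun u : ℕ × ℕ => 1 + xx (rr u)) :=
  ((CR.natConst 1).add CR_xx (fun _ => by simp) (fun u => xx_pos _)).of_eq fun u => by simp

theorem one_xx_pos (t : ℝ) : 0 < 1 + xx t := by have := xx_pos t; positivity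

theorem CR_px : CR (fun u : ℕ × ℕ => xx (rr u) * (1 + xx (rr u))⁻¹) :=
  CR_xx.mul (CR_1x.inv fun u => one_xx_pos _) (fun u => xx_pos _)
    (fun u => inv_pos.2 (one_xx_pos _))

theorem px_pos (t : ℝ) : 0 < xx t * (1 + xx t)⁻¹ := mul_pos (xx_pos _) (inv_pos.2 (one_xx_pos _))

theorem px_eq (t : ℝ) : xx t * (1 + xx t)⁻¹ = 1 - (1 + xx t)⁻¹ := by
  have := one_xx_pos t; field_simp; ring

theorem px_mono : StrictMonoOn (fun t => xx t * (1 + xx t)⁻¹) (Set.Ioi 0) := by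
  intro s hs t ht hst
  have h := xx_strictMono hs ht hst
  have h2 : (1 + xx t)⁻¹ < (1 + xx s)⁻¹ := inv_strictAnti₀ (one_xx_pos s) (by linarith)
  simp only [px_eq]
  linarith

theorem CR_q : CR (fun u : ℕ × ℕ => xx (rr u) + xx (rr u) ^ 2) :=
  CR_xx.add (CR_xx.pow (fun u => xx_pos _) 2) (fun u => xx_pos _) (fun u => pow_pos (xx_pos _) 2)

theorem q_pos (t : ℝ) : 0 < xx t + xx t ^ 2 := by have := xx_pos t; positivity

theorem logb_nonneg_xx (t : ℝ) : 0 < Real.logb 2 (1 + xx t) :=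
  Real.logb_pos (by norm_num) (by have := xx_pos t; linarith)

theorem lb_mono : StrictMonoOn (fun t => Real.logb 2 (1 + xx t)) (Set.Ioi 0) := by
  intro s hs t ht hst
  have h := xx_strictMono hs ht hst
  exact Real.logb_lt_logb (by norm_num) (one_xx_pos s) (by linarith)

theorem phiF_mono : StrictMonoOn (fun t => t * Real.logb 2 (1 + xx t)) (Set.Ioi 0) := by
  intro s hs t ht hst
  exact mul_lt_mul'' hst (lb_mono hs ht hst) (le_of_lt hs) (logb_nonneg_xx s).le

/-- Entropy increment. -/
noncomputable def phiS (t : ℝ) : ℝ := xx t * (1 + xx t)⁻¹ * t⁻¹ + Real.logb 2 (1 + xx t)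

theorem phiS_eq (t : ℝ) :
    phiS t = Real.binEntropy (xx t * (1 + xx t)⁻¹) / Real.log 2 := by
  have hx := xx_pos t
  have h1 := one_xx_pos t
  have l2 := ln2_pos
  have e : 1 - xx t * (1 + xx t)⁻¹ = (1 + xx t)⁻¹ := by rw [px_eq]; ring
  unfold phiS Real.binEntropy Real.logb
  rw [e, inv_inv, mul_inv, inv_inv, Real.log_mul (by positivity) (by positivity), Real.log_inv,
    log_xx]
  field_simp
  ring

theorem phiS_mono : StrictMonoOn phiS (Set.Ioi 0) := by
  intro s hs t ht hst
  have l2 := ln2_pos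
  have hp : ∀ r, 0 < r → xx r * (1 + xx r)⁻¹ ∈ Set.Icc (0 : ℝ) 2⁻¹ := by
    intro r hr
    refine ⟨(px_pos r).le, ?_⟩
    have h := xx_lt_one hr
    have h1 := one_xx_pos r
    rw [← div_eq_mul_inv, div_le_iff₀ h1]; linarith
  rw [phiS_eq, phiS_eq]
  exact div_lt_div_of_pos_right
    (Real.binEntropy_strictMonoOn (hp s hs) (hp t ht) (px_mono hs ht hst)) l2

variable {U : Computer} {T : ℝ}

theorem disjZ (hU : Optimal U) (i d : ℕ) (hd : 0 < d) (hi : T ∈ setZ (Vseq U i))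
    (hj : T ∈ setZ (Vseq U (i + d))) : False := by
  obtain ⟨⟨h0, h1⟩, ci⟩ := id hi
  obtain ⟨_, cj⟩ := hj
  have pi := Zfun_pos (Vseq_optimal hU i) h0 h1
  have pj := Zfun_pos (Vseq_optimal hU (i + d)) h0 h1
  have e := seq_Z hU h0 h1 i d
  refine notrand hU h0 h1 (A := fun _ => Zfun (Vseq U (i + d)) T)
    (B := fun t => (xx t + xx t ^ 2) ^ d * Zfun (Vseq U i) T)
    (Φ := fun t => (xx t + xx t ^ 2) ^ d * Zfun (Vseq U i) T)
    (CR.const cj pj) ((CR_q.pow (fun u => q_pos _) d).mul (CR.const ci pi)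
      (fun u => pow_pos (q_pos _) d) (fun _ => pi)) (fun _ _ => pj)
    (fun t _ => mul_pos (pow_pos (q_pos _) d) pi) ?_ ?_ ?_ (setZ_sub hU (Vseq_optimal hU i) hi).2.1
  · intro s hs t ht hst
    have h := xx_strictMono hs ht hst
    have hq : xx s + xx s ^ 2 < xx t + xx t ^ 2 :=
      add_lt_add h (pow_lt_pow_left₀ h (xx_pos s).le (by norm_num))
    exact mul_lt_mul_of_pos_right (pow_lt_pow_left₀ hq (q_pos s).le hd.ne') pi
  · intro t _; simp only [e]
  · intro t _; simp only [e]

theorem disjE (hU : Optimal U) (i d : ℕ) (hd : 0 < d) (hi : T ∈ setE (Vseq U i))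
    (hj : T ∈ setE (Vseq U (i + d))) : False := by
  obtain ⟨⟨h0, h1⟩, ci⟩ := id hi
  obtain ⟨_, cj⟩ := hj
  have pi := Efun_pos (Vseq_optimal hU i) h0 h1
  have pj := Efun_pos (Vseq_optimal hU (i + d)) h0 h1
  have e := seq_E hU h0 h1 i d
  have hd' : (0 : ℝ) < d := by exact_mod_cast hd
  have hp : ∀ t, 0 < 1 + xx t * (1 + xx t)⁻¹ := fun t => by have := px_pos t; positivity
  have c1 : CR (fun u : ℕ × ℕ => 1 + xx (rr u) * (1 + xx (rr u))⁻¹) :=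
    ((CR.natConst 1).add CR_px (fun _ => by simp) (fun u => px_pos _)).of_eq fun u => by simp
  refine notrand hU h0 h1 (A := fun _ => Efun (Vseq U (i + d)) T)
    (B := fun t => Efun (Vseq U i) T + d * (1 + xx t * (1 + xx t)⁻¹))
    (Φ := fun t => Efun (Vseq U i) T + d * (1 + xx t * (1 + xx t)⁻¹))
    (CR.const cj pj) ((CR.const ci pi).add ((CR.natConst d).mul c1 (fun _ => hd') (fun u => hp _))
      (fun _ => pi) (fun u => mul_pos hd' (hp _))) (fun _ _ => pj)
    (fun t _ => add_pos pi (mul_pos hd' (hp t))) ?_ ?_ ?_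
    (weak_of_chaitin h0 (setE_sub hU (Vseq_optimal hU i) hi).2.1)
  · intro s hs t ht hst
    have h := px_mono hs ht hst
    simp only at h
    have := mul_lt_mul_of_pos_left h hd'
    simp only
    linarith
  · intro t _; simp only [e]
  · intro t _; simp only [e]

theorem disjF (hU : Optimal U) (i d : ℕ) (hd : 0 < d) (hi : T ∈ setF (Vseq U i))
    (hj : T ∈ setF (Vseq U (i + d))) : False := by
  obtain ⟨⟨h0, h1⟩, ci⟩ := id hi
  obtain ⟨_, cj⟩ := hj
  have pi := Ffun_pos (Vseq_optimal hU i) h0 h1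
  have pj := Ffun_pos (Vseq_optimal hU (i + d)) h0 h1
  have e := seq_F hU h0 h1 i d
  have hd' : (0 : ℝ) < d := by exact_mod_cast hd
  have l2 := ln2_pos
  have ce : ∀ s, ComputableReal s → 0 < s → CR (fun u : ℕ × ℕ => (2 : ℝ) ^ (s * (rr u)⁻¹)) :=
    fun s cs ps => ((CR.const cs ps).mul (CR_rr.inv rr_pos) (fun _ => ps)
      (fun u => inv_pos.2 (rr_pos u))).exp2 (fun u => mul_pos ps (inv_pos.2 (rr_pos u)))
  have lA : ∀ t, Real.log ((2 : ℝ) ^ (Ffun (Vseq U i) T * t⁻¹)) =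
      Ffun (Vseq U i) T * t⁻¹ * Real.log 2 := fun t => Real.log_rpow (by norm_num) _
  have lB : ∀ t, 0 < t →
      Real.log ((2 : ℝ) ^ (Ffun (Vseq U (i + d)) T * t⁻¹) * (xx t + xx t ^ 2) ^ d) =
      Ffun (Vseq U i) T * t⁻¹ * Real.log 2 +
      d * t⁻¹ * Real.log 2 * (t * Real.logb 2 (1 + xx t) - T * Real.logb 2 (1 + xx T)) := by
    intro t ht
    have hx := xx_pos t
    rw [Real.log_mul (by positivity) (by positivity), Real.log_rpow (by norm_num), Real.log_pow,
      show xx t + xx t ^ 2 = xx t * (1 + xx t) by ring, Real.log_mul (by positivity) (by positivity),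
      log_xx, e]
    have hl : Real.log (1 + xx t) = Real.logb 2 (1 + xx t) * Real.log 2 := by
      unfold Real.logb; field_simp
    rw [hl]
    field_simp
    ring
  have pB : ∀ t, 0 < (2 : ℝ) ^ (Ffun (Vseq U (i + d)) T * t⁻¹) * (xx t + xx t ^ 2) ^ d :=
    fun t => mul_pos (by positivity) (pow_pos (q_pos t) d)
  have pk : ∀ t, 0 < t → 0 < d * t⁻¹ * Real.log 2 := fun t ht => by positivity
  refine notrand hU h0 h1 (A := fun t => (2 : ℝ) ^ (Ffun (Vseq U i) T * t⁻¹))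
    (B := fun t => (2 : ℝ) ^ (Ffun (Vseq U (i + d)) T * t⁻¹) * (xx t + xx t ^ 2) ^ d)
    (Φ := fun t => t * Real.logb 2 (1 + xx t))
    (ce _ ci pi) ((ce _ cj pj).mul (CR_q.pow (fun u => q_pos _) d) (fun _ => by positivity)
      (fun u => pow_pos (q_pos _) d)) (fun _ _ => by positivity)
    (fun t _ => pB t) phiF_mono ?_ ?_ (setF_sub hU (Vseq_optimal hU i) hi).2.1
  · intro t ht
    rw [← Real.log_lt_log_iff (by positivity) (pB t), lA, lB t ht, lt_add_iff_pos_right,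
      mul_pos_iff_of_pos_left (pk t ht), sub_pos]
  · intro t ht
    rw [← Real.log_lt_log_iff (pB t) (by positivity), lA, lB t ht, add_lt_iff_neg_left,
      ← neg_pos, ← mul_neg, mul_pos_iff_of_pos_left (pk t ht), neg_sub, sub_pos]

theorem disjS (hU : Optimal U) (i d : ℕ) (hd : 0 < d) (hi : T ∈ setS (Vseq U i))
    (hj : T ∈ setS (Vseq U (i + d))) : False := by
  obtain ⟨⟨h0, h1⟩, ci⟩ := id hi
  obtain ⟨_, cj⟩ := hj
  have pi := Sfun_pos (Vseq_optimal hU i) h0 h1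
  have pj := Sfun_pos (Vseq_optimal hU (i + d)) h0 h1
  have e : Sfun (Vseq U (i + d)) T = Sfun (Vseq U i) T + d * phiS T := seq_S hU h0 h1 i d
  have hd' : (0 : ℝ) < d := by exact_mod_cast hd
  have l2 := ln2_pos
  have ce : ∀ s, ComputableReal s → 0 < s → CR (fun _ : ℕ × ℕ => (2 : ℝ) ^ s) :=
    fun s cs ps => (CR.const cs ps).exp2 (fun _ => ps)
  have c1 : CR (fun u : ℕ × ℕ => (2 : ℝ) ^ (xx (rr u) * (1 + xx (rr u))⁻¹ * (rr u)⁻¹)) :=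
    (CR_px.mul (CR_rr.inv rr_pos) (fun u => px_pos _) (fun u => inv_pos.2 (rr_pos u))).exp2
      (fun u => mul_pos (px_pos _) (inv_pos.2 (rr_pos u)))
  have p1 : ∀ t, 0 < (2 : ℝ) ^ (xx t * (1 + xx t)⁻¹ * t⁻¹) * (1 + xx t) :=
    fun t => mul_pos (by positivity) (one_xx_pos t)
  have lA : Real.log ((2 : ℝ) ^ (Sfun (Vseq U (i + d)) T)) =
      (Sfun (Vseq U i) T + d * phiS T) * Real.log 2 := by
    rw [Real.log_rpow (by norm_num), e]
  have lB : ∀ t, Real.log (((2 : ℝ) ^ (xx t * (1 + xx t)⁻¹ * t⁻¹) * (1 + xx t)) ^ d *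
      (2 : ℝ) ^ (Sfun (Vseq U i) T)) = (Sfun (Vseq U i) T + d * phiS t) * Real.log 2 := by
    intro t
    have hx := one_xx_pos t
    rw [Real.log_mul (pow_pos (p1 t) d).ne' (by positivity), Real.log_rpow (by norm_num),
      Real.log_pow, Real.log_mul (by positivity) (by positivity), Real.log_rpow (by norm_num)]
    unfold phiS Real.logb
    field_simp
    ring
  have pB : ∀ t, 0 < ((2 : ℝ) ^ (xx t * (1 + xx t)⁻¹ * t⁻¹) * (1 + xx t)) ^ d *
      (2 : ℝ) ^ (Sfun (Vseq U i) T) :=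
    fun t => mul_pos (pow_pos (p1 t) d) (by positivity)
  refine notrand hU h0 h1 (A := fun _ => (2 : ℝ) ^ (Sfun (Vseq U (i + d)) T))
    (B := fun t => ((2 : ℝ) ^ (xx t * (1 + xx t)⁻¹ * t⁻¹) * (1 + xx t)) ^ d *
      (2 : ℝ) ^ (Sfun (Vseq U i) T))
    (Φ := phiS) (ce _ cj pj)
    (((c1.mul CR_1x (fun _ => by positivity) (fun u => one_xx_pos _)).pow (fun u => p1 _) d).mul
      (ce _ ci pi) (fun u => pow_pos (p1 _) d) (fun _ => by positivity))
    (fun _ _ => by positivity)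
    (fun t _ => pB t) phiS_mono ?_ ?_
    (weak_of_chaitin h0 (setS_sub hU (Vseq_optimal hU i) hi).2.1)
  · intro t ht
    rw [← Real.log_lt_log_iff (by positivity) (pB t), lA, lB t, mul_lt_mul_iff_left₀ l2,
      add_lt_add_iff_left, mul_lt_mul_iff_right₀ hd']
  · intro t ht
    rw [← Real.log_lt_log_iff (pB t) (by positivity), lA, lB t, mul_lt_mul_iff_left₀ l2,
      add_lt_add_iff_left, mul_lt_mul_iff_right₀ hd']

theorem disj_aux {X : Computer → Set ℝ} (U : Computer)
    (h : ∀ (T : ℝ) (i d : ℕ), 0 < d → T ∈ X (Vseq U i) → T ∈ X (Vseq U (i + d)) → False)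
    (i j : ℕ) (hij : i ≠ j) : X (Vseq U i) ∩ X (Vseq U j) = ∅ := by
  rw [Set.eq_empty_iff_forall_notMem]
  rintro T ⟨hi, hj⟩
  rcases lt_or_gt_of_ne hij with hl | hl
  · obtain ⟨d, rfl⟩ := Nat.exists_eq_add_of_le hl.le
    exact h T i d (by omega) hi hj
  · obtain ⟨d, rfl⟩ := Nat.exists_eq_add_of_le hl.le
    exact h T j d (by omega) hj hi

end Disjoint

/-- There is a recursive infinite sequence of optimal computers
whose `𝒵`, `ℱ`, `ℰ`, `𝒮`-sets are pairwise disjoint and contained in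
`FP_w` (resp. `FP`). -/
theorem main_result (U : Computer) (hU : Optimal U) :
    ∃ V : ℕ → Computer, RecursiveSeq V ∧ (∀ i, Optimal (V i)) ∧
    (∀ i j, i ≠ j →
        setZ (V i) ∩ setZ (V j) = ∅ ∧ setF (V i) ∩ setF (V j) = ∅ ∧
        setE (V i) ∩ setE (V j) = ∅ ∧ setS (V i) ∩ setS (V j) = ∅) ∧
    ((⋃ i, setZ (V i)) ⊆ FPw U ∧ (⋃ i, setF (V i)) ⊆ FPw U) ∧
    ((⋃ i, setE (V i)) ⊆ FP U ∧ (⋃ i, setS (V i)) ⊆ FP U) := by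
  have hV := Vseq_optimal hU
  refine ⟨Vseq U, Vseq_recursive U, hV, fun i j hij => ⟨?_, ?_, ?_, ?_⟩,
    ⟨Set.iUnion_subset fun i => setZ_sub hU (hV i), Set.iUnion_subset fun i => setF_sub hU (hV i)⟩,
    ⟨Set.iUnion_subset fun i => setE_sub hU (hV i), Set.iUnion_subset fun i => setS_sub hU (hV i)⟩⟩
  · exact disj_aux U (fun T i d hd h h' => disjZ hU i d hd h h') i j hij
  · exact disj_aux U (fun T i d hd h h' => disjF hU i d hd h h') i j hij
  · exact disj_aux U (fun T i d hd h h' => disjE hU i d hd h h') i j hij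
  · exact disj_aux U (fun T i d hd h h' => disjS hU i d hd h h') i j hij
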